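/- arXiv:1108.5429 — 2 statements merged into one kernel-verified Lean document; each statement's English description precedes it below -/
import Mathlib

section
/- Let Ω = Ω₀ ε^{-4} with Ω₀ > 0 and let g_{η,ε} be the positive minimizer of the restricted giant vortex functional on the annulus A_η. Then, uniformly for 𝐱 ∈ A_η, its radial derivative satisfies both |g_{η,ε}'(x)| ≤ C (αΩ)^{3/2} e^{−CΩ(1−x)²} and |g_{η,ε}'(x)| ≤ C Ω₀² η³ ε^{-2} g_{η,ε}(x). -/
open MeasureTheory Filter Topology Set Real

noncomputable section

/-- `α = √(4 + γ(s-2))`. -/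
def alphaP (s γ : ℝ) : ℝ := Real.sqrt (4 + γ * (s - 2))

/-- The giant vortex potential `U`. -/
def Upot (s γ Ω x : ℝ) : ℝ :=
  (1 / 2) * ((⌊Ω⌋ : ℝ) ^ 2 / Ω ^ 2) / x ^ 2 + (1 / 2) * x ^ 2 +
    γ * (x ^ s - 1) / s - (γ / 2) * (x ^ 2 - 1) - (⌊Ω⌋ : ℝ) / Ω

/-- The radial annulus `[1 - ε²η, 1 + ε²η]`. -/
def annIcc (ε η : ℝ) : Set ℝ := Set.Icc (1 - ε ^ 2 * η) (1 + ε ^ 2 * η)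

/-- The restricted giant vortex functional on the annulus `A_η` (radial form). -/
def gvEnergyAnn (ε s γ Ω η : ℝ) (f : ℝ → ℝ) : ℝ :=
  2 * π * ∫ x in annIcc ε η,
    x * ((1 / 2) * (deriv f x) ^ 2 + Ω ^ 2 * Upot s γ Ω x * (f x) ^ 2 +
      (1 / ε ^ 2) * (f x) ^ 4)

/-- Domain of the restricted giant vortex functional. -/
def gvAnnDomain (ε η : ℝ) : Set (ℝ → ℝ) :=
  {f | ContDiff ℝ 1 f ∧ 2 * π * (∫ x in annIcc ε η, x * (f x) ^ 2) = 1}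

/-- `g` is the positive minimizer of the restricted giant vortex functional on `A_η`. -/
def IsGVAnnMin (ε s γ Ω η : ℝ) (g : ℝ → ℝ) : Prop :=
  g ∈ gvAnnDomain ε η ∧ (∀ x ∈ annIcc ε η, 0 < g x) ∧
    ∀ f ∈ gvAnnDomain ε η, gvEnergyAnn ε s γ Ω η g ≤ gvEnergyAnn ε s γ Ω η f

/-- First variation of the constrained functional. -/
lemma gv_weak_form (a b N β : ℝ) (V g : ℝ → ℝ) (hV : Continuous V)
    (hg : ContDiff ℝ 1 g) (hN : 0 < N) (hnorm : ∫ x in a..b, x * g x ^ 2 = N)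
    (hmin : ∀ f : ℝ → ℝ, ContDiff ℝ 1 f → ∫ x in a..b, x * f x ^ 2 = N →
      (∫ x in a..b, x * (1 / 2 * deriv g x ^ 2 + V x * g x ^ 2 + β * g x ^ 4)) ≤
        ∫ x in a..b, x * (1 / 2 * deriv f x ^ 2 + V x * f x ^ 2 + β * f x ^ 4))
    (μ : ℝ) (hμ : μ = ((∫ x in a..b, x * (1 / 2 * deriv g x ^ 2 + V x * g x ^ 2)) +
      2 * ∫ x in a..b, x * (β * g x ^ 4)) / N)
    (ψ : ℝ → ℝ) (hψ : ContDiff ℝ 1 ψ) :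
    ∫ x in a..b, x * (1 / 2 * deriv g x * deriv ψ x +
      (V x + 2 * β * g x ^ 2 - μ) * g x * ψ x) = 0 := by
  have hI : ∀ f : ℝ → ℝ, Continuous f → IntervalIntegrable f volume a b :=
    fun f hf => hf.intervalIntegrable a b
  have cg : Continuous g := hg.continuous
  have cψ : Continuous ψ := hψ.continuous
  have cg' : Continuous (deriv g) := hg.continuous_deriv le_rfl
  have cψ' : Continuous (deriv ψ) := hψ.continuous_deriv le_rfl
  set Q := ∫ x in a..b, x * (1 / 2 * deriv g x ^ 2 + V x * g x ^ 2) with hQ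
  set R := ∫ x in a..b, x * (β * g x ^ 4) with hR
  set A := ∫ x in a..b, 2 * x * g x * ψ x with hA
  set B := ∫ x in a..b, x * ψ x ^ 2 with hB
  set Q1 := ∫ x in a..b, x * (deriv g x * deriv ψ x + 2 * V x * g x * ψ x) with hQ1
  set Q2 := ∫ x in a..b, x * (1 / 2 * deriv ψ x ^ 2 + V x * ψ x ^ 2) with hQ2
  set R1 := ∫ x in a..b, x * (β * (4 * g x ^ 3 * ψ x)) with hR1
  set R2 := ∫ x in a..b, x * (β * (6 * g x ^ 2 * ψ x ^ 2)) with hR2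
  set R3 := ∫ x in a..b, x * (β * (4 * g x * ψ x ^ 3)) with hR3
  set R4 := ∫ x in a..b, x * (β * (ψ x ^ 4)) with hR4
  have e1 : ∀ t : ℝ, ∫ x in a..b, x * (g x + t * ψ x) ^ 2 = N + t * A + t ^ 2 * B := by
    intro t
    have : (fun x => x * (g x + t * ψ x) ^ 2) =
        fun x => (x * g x ^ 2 + t * (2 * x * g x * ψ x)) + t ^ 2 * (x * ψ x ^ 2) := by
      funext x; ring
    rw [this, intervalIntegral.integral_add (hI _ (by fun_prop)) (hI _ (by fun_prop)),
      intervalIntegral.integral_add (hI _ (by fun_prop)) (hI _ (by fun_prop)),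
      intervalIntegral.integral_const_mul, intervalIntegral.integral_const_mul, hnorm]
  have e2 : ∀ t : ℝ, ∫ x in a..b, x * (1 / 2 * (deriv g x + t * deriv ψ x) ^ 2 +
      V x * (g x + t * ψ x) ^ 2) = Q + t * Q1 + t ^ 2 * Q2 := by
    intro t
    have : (fun x => x * (1 / 2 * (deriv g x + t * deriv ψ x) ^ 2 +
      V x * (g x + t * ψ x) ^ 2)) =
        fun x => (x * (1 / 2 * deriv g x ^ 2 + V x * g x ^ 2) +
          t * (x * (deriv g x * deriv ψ x + 2 * V x * g x * ψ x))) +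
          t ^ 2 * (x * (1 / 2 * deriv ψ x ^ 2 + V x * ψ x ^ 2)) := by
      funext x; ring
    rw [this, intervalIntegral.integral_add (hI _ (by fun_prop)) (hI _ (by fun_prop)),
      intervalIntegral.integral_add (hI _ (by fun_prop)) (hI _ (by fun_prop)),
      intervalIntegral.integral_const_mul, intervalIntegral.integral_const_mul]
  have e3 : ∀ t : ℝ, ∫ x in a..b, x * (β * (g x + t * ψ x) ^ 4) =
      R + t * R1 + t ^ 2 * R2 + t ^ 3 * R3 + t ^ 4 * R4 := by
    intro t
    have : (fun x => x * (β * (g x + t * ψ x) ^ 4)) =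
        fun x => (((x * (β * g x ^ 4) + t * (x * (β * (4 * g x ^ 3 * ψ x)))) +
          t ^ 2 * (x * (β * (6 * g x ^ 2 * ψ x ^ 2)))) +
          t ^ 3 * (x * (β * (4 * g x * ψ x ^ 3)))) + t ^ 4 * (x * (β * (ψ x ^ 4))) := by
      funext x; ring
    rw [this, intervalIntegral.integral_add (hI _ (by fun_prop)) (hI _ (by fun_prop)),
      intervalIntegral.integral_add (hI _ (by fun_prop)) (hI _ (by fun_prop)),
      intervalIntegral.integral_add (hI _ (by fun_prop)) (hI _ (by fun_prop)),
      intervalIntegral.integral_add (hI _ (by fun_prop)) (hI _ (by fun_prop)),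
      intervalIntegral.integral_const_mul, intervalIntegral.integral_const_mul,
      intervalIntegral.integral_const_mul, intervalIntegral.integral_const_mul]
  have eJ : (∫ x in a..b, x * (1 / 2 * deriv g x ^ 2 + V x * g x ^ 2 + β * g x ^ 4)) = Q + R := by
    rw [hQ, hR, ← intervalIntegral.integral_add (hI _ (by fun_prop)) (hI _ (by fun_prop))]
    congr 1; funext x; ring
  set m : ℝ → ℝ := fun t => (N + t * A + t ^ 2 * B) / N with hm
  set D : ℝ → ℝ := fun t => m t * (Q + t * Q1 + t ^ 2 * Q2) +
    (R + t * R1 + t ^ 2 * R2 + t ^ 3 * R3 + t ^ 4 * R4) - m t ^ 2 * (Q + R) with hD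
  have hD0 : ∀ t, 0 < m t → 0 ≤ D t := by
    intro t ht
    set k := (Real.sqrt (m t))⁻¹ with hk
    have hk2 : k ^ 2 = (m t)⁻¹ := by rw [hk, inv_pow, Real.sq_sqrt ht.le]
    have hf : ContDiff ℝ 1 (fun x => k * (g x + t * ψ x)) := by fun_prop
    have hd : ∀ x, deriv (fun x => k * (g x + t * ψ x)) x = k * (deriv g x + t * deriv ψ x) := by
      intro x
      have h1 : HasDerivAt g (deriv g x) x := (hg.differentiable one_ne_zero x).hasDerivAt
      have h2 : HasDerivAt ψ (deriv ψ x) x := (hψ.differentiable one_ne_zero x).hasDerivAt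
      exact ((h1.add (h2.const_mul t)).const_mul k).deriv
    have h1 := hmin _ hf (by
      have : (fun x => x * (k * (g x + t * ψ x)) ^ 2) =
        fun x => k ^ 2 * (x * (g x + t * ψ x) ^ 2) := by funext x; ring
      rw [this, intervalIntegral.integral_const_mul, e1, hk2]
      have : N + t * A + t ^ 2 * B = m t * N := by simp only [hm]; field_simp
      rw [this]; field_simp)
    rw [eJ] at h1
    simp only [hd] at h1
    have : (fun x => x * (1 / 2 * (k * (deriv g x + t * deriv ψ x)) ^ 2 +
        V x * (k * (g x + t * ψ x)) ^ 2 + β * (k * (g x + t * ψ x)) ^ 4)) =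
        fun x => k ^ 2 * (x * (1 / 2 * (deriv g x + t * deriv ψ x) ^ 2 +
      V x * (g x + t * ψ x) ^ 2)) + (k ^ 2) ^ 2 * (x * (β * (g x + t * ψ x) ^ 4)) := by
      funext x; ring
    rw [this, intervalIntegral.integral_add (hI _ (by fun_prop)) (hI _ (by fun_prop)),
      intervalIntegral.integral_const_mul, intervalIntegral.integral_const_mul, e2, e3, hk2] at h1
    have h2 := mul_le_mul_of_nonneg_left h1 (sq_nonneg (m t))
    have h3 : m t ^ 2 * ((m t)⁻¹ * (Q + t * Q1 + t ^ 2 * Q2) +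
      (m t)⁻¹ ^ 2 * (R + t * R1 + t ^ 2 * R2 + t ^ 3 * R3 + t ^ 4 * R4)) =
      m t * (Q + t * Q1 + t ^ 2 * Q2) +
      (R + t * R1 + t ^ 2 * R2 + t ^ 3 * R3 + t ^ 4 * R4) := by
      field_simp
    simp only [hD]
    linarith
  have m0 : m 0 = 1 := by simp [hm, hN.ne']
  have D0 : D 0 = 0 := by simp [hD, m0]
  have cm : Continuous m := by simp only [hm]; fun_prop
  have hloc : IsLocalMin D 0 := by
    have : ∀ᶠ t in 𝓝 (0:ℝ), 0 < m t :=
      cm.continuousAt.eventually (lt_mem_nhds (by rw [m0]; norm_num))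
    filter_upwards [this] with t ht
    rw [D0]; exact hD0 t ht
  have hder : HasDerivAt D ((A / N) * Q + (Q1 + R1) - 2 * (A / N) * (Q + R)) 0 := by
    have hmd : HasDerivAt m (A / N) 0 := by
      have : HasDerivAt (fun t : ℝ => (N + t * A + t ^ 2 * B) / N)
        ((0 + 1 * A + (2 * (0:ℝ) ^ 1 * 1) * B) / N) 0 := by
        exact ((((hasDerivAt_const _ _).add ((hasDerivAt_id _).mul_const _)).add
          (((hasDerivAt_id (0:ℝ)).pow 2).mul_const _)).div_const _).congr_deriv (by simp)
      exact this.congr_deriv (by ring)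
    have hQd : HasDerivAt (fun t : ℝ => Q + t * Q1 + t ^ 2 * Q2) Q1 0 := by
      exact (((hasDerivAt_const _ _).add ((hasDerivAt_id _).mul_const _)).add
          (((hasDerivAt_id (0:ℝ)).pow 2).mul_const _)).congr_deriv (by simp)
    have hRd : HasDerivAt (fun t : ℝ => R + t * R1 + t ^ 2 * R2 + t ^ 3 * R3 + t ^ 4 * R4) R1 0 := by
      exact (((((hasDerivAt_const _ _).add ((hasDerivAt_id _).mul_const _)).add
          (((hasDerivAt_id (0:ℝ)).pow 2).mul_const _)).add
          (((hasDerivAt_id (0:ℝ)).pow 3).mul_const _)).add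
          (((hasDerivAt_id (0:ℝ)).pow 4).mul_const _)).congr_deriv (by simp)
    refine (((hmd.mul hQd).add hRd).sub ((hmd.pow 2).mul_const (Q + R))).congr_deriv ?_
    simp [m0]; ring
  have hz := hloc.hasDerivAt_eq_zero hder
  have hfin : (fun x => x * (1 / 2 * deriv g x * deriv ψ x +
      (V x + 2 * β * g x ^ 2 - μ) * g x * ψ x)) = fun x =>
      ((1 / 2) * (x * (deriv g x * deriv ψ x + 2 * V x * g x * ψ x)) +
      (1 / 2) * (x * (β * (4 * g x ^ 3 * ψ x)))) - (μ / 2) * (2 * x * g x * ψ x) := by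
    funext x; ring
  rw [hfin, intervalIntegral.integral_sub (hI _ (by fun_prop)) (hI _ (by fun_prop)),
    intervalIntegral.integral_add (hI _ (by fun_prop)) (hI _ (by fun_prop)),
    intervalIntegral.integral_const_mul, intervalIntegral.integral_const_mul,
    intervalIntegral.integral_const_mul, ← hQ1, ← hR1, ← hA, hμ]
  have : (Q + 2 * R) / N / 2 * A = (1/2) * (A / N * (Q + 2 * R)) := by ring
  rw [this]; linarith

/-- Strong form with Neumann conditions. -/
lemma gv_strong_form (a b : ℝ) (hab : a < b) (F g : ℝ → ℝ) (hF : Continuous F)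
    (hg : ContDiff ℝ 1 g)
    (hw : ∀ ψ : ℝ → ℝ, ContDiff ℝ 1 ψ → ∫ x in a..b, (x * deriv g x * deriv ψ x + F x * ψ x) = 0) :
    (∫ x in a..b, F x) = 0 ∧ ∀ x ∈ Icc a b, x * deriv g x = ∫ y in a..x, F y := by
  have cg' : Continuous (deriv g) := hg.continuous_deriv le_rfl
  have hPb : (∫ x in a..b, F x) = 0 := by
    have := hw (fun _ => 1) contDiff_const
    simpa using this
  refine ⟨hPb, ?_⟩
  set P : ℝ → ℝ := fun x => ∫ y in a..x, F y with hP
  have hPd : ∀ x, HasDerivAt P (F x) x := fun x => by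
    exact (hF.integral_hasStrictDerivAt a x).hasDerivAt
  have cP : Continuous P := continuous_iff_continuousAt.2 fun x => (hPd x).continuousAt
  set G : ℝ → ℝ := fun x => x * deriv g x - P x with hG
  have cG : Continuous G := by simp only [hG]; fun_prop
  set ψ : ℝ → ℝ := fun x => ∫ y in a..x, G y with hψ
  have hψd : ∀ x, HasDerivAt ψ (G x) x := fun x => by
    exact (cG.integral_hasStrictDerivAt a x).hasDerivAt
  have dψ : deriv ψ = G := funext fun x => (hψd x).deriv
  have cψ : ContDiff ℝ 1 ψ := by
    rw [contDiff_one_iff_deriv]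
    exact ⟨fun x => (hψd x).differentiableAt, by rw [dψ]; exact cG⟩
  have h1 := hw ψ cψ
  rw [dψ] at h1
  have h2 : ∫ x in a..b, (G x * P x + ψ x * F x) = 0 := by
    rw [intervalIntegral.integral_deriv_mul_eq_sub (fun x _ => hψd x) (fun x _ => hPd x)
      (cG.intervalIntegrable _ _) (hF.intervalIntegrable _ _)]
    have : P b = 0 := hPb
    have h3 : P a = 0 := by simp [hP]
    rw [this, h3]; ring
  have h3 : ∫ x in a..b, G x ^ 2 = 0 := by
    have : (fun x => G x ^ 2) = fun x => (x * deriv g x * G x + F x * ψ x) -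
        (G x * P x + ψ x * F x) := by
      funext x; simp only [hG]; ring
    have cψ0 : Continuous ψ := cψ.continuous
    rw [this, intervalIntegral.integral_sub ((by fun_prop : Continuous _).intervalIntegrable _ _)
      ((by fun_prop : Continuous _).intervalIntegrable _ _), h1, h2, sub_zero]
  intro x hx
  by_contra hne
  have hGx : G x ≠ 0 := sub_ne_zero.2 hne
  have : 0 < ∫ x in a..b, G x ^ 2 :=
    intervalIntegral.integral_pos hab (by fun_prop) (fun y _ => sq_nonneg _)
      ⟨x, hx, by positivity⟩
  linarith

/-- Riccati bound. -/
lemma gv_riccati (a b M : ℝ) (ha : 0 < a) (hab : a < b) (w g : ℝ → ℝ)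
    (cw : Continuous w) (hg : ContDiff ℝ 1 g) (hpos : ∀ x ∈ Icc a b, 0 < g x)
    (hM : 0 ≤ M) (hwM : ∀ x ∈ Icc a b, 2 * x ^ 2 * w x ≤ M)
    (hb : (∫ x in a..b, 2 * x * w x * g x) = 0)
    (hs : ∀ x ∈ Icc a b, x * deriv g x = ∫ y in a..x, 2 * y * w y * g y) :
    ∀ x ∈ Icc a b, (x * deriv g x / g x) ^ 2 ≤ M := by
  have cg := hg.continuous
  have cF : Continuous fun x => 2 * x * w x * g x := by fun_prop
  set P : ℝ → ℝ := fun x => ∫ y in a..x, 2 * y * w y * g y with hP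
  have hPd : ∀ x, HasDerivAt P (2 * x * w x * g x) x := fun x =>
    (cF.integral_hasStrictDerivAt a x).hasDerivAt
  have cP : Continuous P := continuous_iff_continuousAt.2 fun x => (hPd x).continuousAt
  have cq : ContinuousOn (fun x => (P x / g x) ^ 2) (Icc a b) :=
    (cP.continuousOn.div cg.continuousOn (fun x hx => (hpos x hx).ne')).pow 2
  obtain ⟨x0, hx0, hmax⟩ := isCompact_Icc.exists_isMaxOn (nonempty_Icc.2 hab.le) cq
  have hPa : P a = 0 := by simp [hP]
  have hPb : P b = 0 := hb
  have key : (P x0 / g x0) ^ 2 ≤ M := by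
    rcases eq_or_lt_of_le hx0.1 with h | h
    · rw [← h, hPa]; simpa using hM
    rcases eq_or_lt_of_le hx0.2 with h' | h'
    · rw [h', hPb]; simpa using hM
    have hgx := hpos x0 hx0
    have h1 : HasDerivAt g (deriv g x0) x0 := (hg.differentiable one_ne_zero x0).hasDerivAt
    have hd := ((hPd x0).div h1 hgx.ne').pow 2
    have hl : IsLocalMax (fun x => (P x / g x) ^ 2) x0 := hmax.isLocalMax (Icc_mem_nhds h h')
    have hz := hl.hasDerivAt_eq_zero hd
    have hx0p : 0 < x0 := ha.trans h
    have hsx : x0 * deriv g x0 = P x0 := hs x0 hx0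
    have hgd : deriv g x0 = P x0 / x0 := by rw [← hsx]; field_simp
    simp only [Pi.div_apply, Nat.cast_ofNat, Nat.add_one_sub_one, pow_one] at hz
    rw [hgd] at hz
    rcases mul_eq_zero.1 hz with h2 | h2
    · have : P x0 / g x0 = 0 := by simpa using h2
      rw [this]; simpa using hM
    · have h3 : (P x0 / g x0) ^ 2 = 2 * x0 ^ 2 * w x0 := by
        field_simp at h2 ⊢
        linarith
      rw [h3]; exact hwM x0 hx0
  intro x hx
  rw [hs x hx]
  exact (hmax hx).trans key

/-- Agmon-type weighted bound. -/
lemma gv_agmon (a b k : ℝ) (g w : ℝ → ℝ) (cw : Continuous w) (hg : ContDiff ℝ 1 g)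
    (hw : ∀ ψ : ℝ → ℝ, ContDiff ℝ 1 ψ →
      ∫ x in a..b, x * (1 / 2 * deriv g x * deriv ψ x + w x * g x * ψ x) = 0) :
    ∫ x in a..b, x * (1 / 2 * deriv (fun x => exp (k * (x - 1) ^ 2) * g x) x ^ 2) =
      ∫ x in a..b, x * ((2 * k ^ 2 * (x - 1) ^ 2 - w x) * exp (2 * (k * (x - 1) ^ 2)) * g x ^ 2) := by
  have cg := hg.continuous
  have cg' : Continuous (deriv g) := hg.continuous_deriv le_rfl
  have hgd : ∀ x, HasDerivAt g (deriv g x) x := fun x =>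
    (hg.differentiable one_ne_zero x).hasDerivAt
  have hφ : ∀ c x : ℝ, HasDerivAt (fun x => exp (c * (x - 1) ^ 2))
      (exp (c * (x - 1) ^ 2) * (c * (2 * (x - 1)))) x := by
    intro c x
    have h := ((((hasDerivAt_id x).sub_const 1).pow 2).const_mul c).exp
    exact h.congr_deriv (by simp)
  have h := hw (fun x => exp (2 * k * (x - 1) ^ 2) * g x) (by fun_prop)
  have d1 : ∀ c x, deriv (fun x => exp (c * (x - 1) ^ 2) * g x) x =
    exp (c * (x - 1) ^ 2) * (c * (2 * (x - 1))) * g x + exp (c * (x - 1) ^ 2) * deriv g x :=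
    fun c x => ((hφ c x).mul (hgd x)).deriv
  simp only [d1] at h ⊢
  rw [← sub_eq_zero, ← intervalIntegral.integral_sub
    ((by fun_prop : Continuous _).intervalIntegrable _ _)
    ((by fun_prop : Continuous _).intervalIntegrable _ _), ← h]
  congr 1; funext x
  have e : exp (2 * k * (x - 1) ^ 2) = exp (k * (x - 1) ^ 2) ^ 2 := by
    rw [← Real.exp_nat_mul]; congr 1; push_cast; ring
  have e' : exp (2 * (k * (x - 1) ^ 2)) = exp (k * (x - 1) ^ 2) ^ 2 := by
    rw [← Real.exp_nat_mul]; congr 1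
  rw [e, e']; ring

/-- Crude one-dimensional Sobolev bound. -/
lemma gv_sobolev (a b l K : ℝ) (ha : 1 / 2 ≤ a) (hl : 0 < l) (h : ℝ → ℝ)
    (hh : ContDiff ℝ 1 h) (hK : ∫ x in a..b, x * (1 / 2 * deriv h x ^ 2) ≤ K) :
    ∀ x ∈ Icc a b, ∀ y ∈ Icc a b, h x ≤ h y + (2 * l * K + (b - a) / (2 * l)) := by
  have ch' : Continuous (deriv h) := hh.continuous_deriv le_rfl
  intro x hx y hy
  have hab : a ≤ b := hx.1.trans hx.2
  have h1 : ∫ t in y..x, deriv h t = h x - h y :=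
    intervalIntegral.integral_deriv_eq_sub (fun t _ => hh.differentiable one_ne_zero t)
      (ch'.intervalIntegrable _ _)
  have h2 : |∫ t in y..x, deriv h t| ≤ |(∫ t in y..x, (|deriv h t|))| := by
    simpa using intervalIntegral.norm_integral_le_abs_integral_norm (f := deriv h) (a := y) (b := x)
  have h3 : |(∫ t in y..x, (|deriv h t|))| ≤ ∫ t in a..b, |deriv h t| := by
    have h5 := intervalIntegral.abs_integral_mono_interval (f := fun t => |deriv h t|)
      (μ := volume) (a := y) (b := x) (c := a) (d := b) ?_ ?_ (ch'.abs.intervalIntegrable _ _)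
    · rwa [abs_of_nonneg (intervalIntegral.integral_nonneg hab (fun t _ => abs_nonneg _))] at h5
    · rw [uIoc_of_le hab]
      exact Ioc_subset_Ioc (le_min hy.1 hx.1) (max_le hy.2 hx.2)
    · exact Eventually.of_forall fun t => abs_nonneg _
  have h4 : ∫ t in a..b, |deriv h t| ≤ ∫ t in a..b, (2 * l * (t * (1 / 2 * deriv h t ^ 2)) + 1 / (2 * l)) := by
    apply intervalIntegral.integral_mono_on hab (ch'.abs.intervalIntegrable _ _)
      ((by fun_prop : Continuous _).intervalIntegrable _ _)
    intro t ht
    have ht2 : 1 / 2 ≤ t := ha.trans ht.1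
    have e1 : 0 ≤ (l * |deriv h t| - 1) ^ 2 := sq_nonneg _
    have e2 : |deriv h t| ≤ l * deriv h t ^ 2 / 2 + 1 / (2 * l) := by
      rw [← sq_abs (deriv h t)]
      rw [div_add_div _ _ (by norm_num) (by positivity), le_div_iff₀ (by positivity)]
      nlinarith
    have e3 : 0 ≤ l * deriv h t ^ 2 * (t - 1 / 2) :=
      mul_nonneg (by positivity) (by linarith)
    nlinarith
  rw [intervalIntegral.integral_add ((by fun_prop : Continuous _).intervalIntegrable _ _)
    ((by fun_prop : Continuous _).intervalIntegrable _ _), intervalIntegral.integral_const_mul,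
    intervalIntegral.integral_const, smul_eq_mul] at h4
  have h5 : 2 * l * (∫ x in a..b, x * (1 / 2 * deriv h x ^ 2)) ≤ 2 * l * K :=
    mul_le_mul_of_nonneg_left hK (by positivity)
  have h6 := le_abs_self (∫ t in y..x, deriv h t)
  have h7 : (b - a) * (1 / (2 * l)) = (b - a) / (2 * l) := by ring
  linarith

lemma gv_floor (Ω : ℝ) (hΩ : 1 ≤ Ω) : (⌊Ω⌋ : ℝ) / Ω ≤ 1 ∧ 1 - 1 / Ω ≤ (⌊Ω⌋ : ℝ) / Ω := by
  have h0 : 0 < Ω := by linarith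
  constructor
  · rw [div_le_one h0]; exact Int.floor_le Ω
  · rw [le_div_iff₀ h0, sub_mul, div_mul_cancel₀ _ h0.ne']
    linarith [Int.lt_floor_add_one Ω]

lemma gv_U_eq (s γ Ω x : ℝ) (hx : 0 < x) :
    Upot s γ Ω x = ((⌊Ω⌋ : ℝ) / Ω - x ^ 2) ^ 2 / (2 * x ^ 2) +
      γ * ((x ^ s - 1) / s - (x ^ 2 - 1) / 2) := by
  unfold Upot
  rw [← div_pow]
  generalize (⌊Ω⌋ : ℝ) / Ω = n
  generalize (x ^ s : ℝ) = X
  have : (n - x ^ 2) ^ 2 / (2 * x ^ 2) = 1 / 2 * n ^ 2 / x ^ 2 + 1 / 2 * x ^ 2 - n := by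
    field_simp; ring
  rw [this]; ring

lemma gv_pow_lower (s x : ℝ) (hs : 2 < s) (hx : 0 < x) :
    0 ≤ (x ^ s - 1) / s - (x ^ 2 - 1) / 2 := by
  have h := one_add_mul_self_le_rpow_one_add (s := x ^ 2 - 1) (p := s / 2)
    (by nlinarith [sq_nonneg x]) (by linarith)
  have e : (1 + (x ^ 2 - 1)) ^ (s / 2) = x ^ s := by
    rw [add_sub_cancel, ← Real.rpow_natCast, ← Real.rpow_mul hx.le]
    congr 1; push_cast; ring
  rw [e] at h
  rw [sub_nonneg, le_div_iff₀ (by linarith)]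
  linarith

/-- tangent-line upper bound. -/
lemma gv_pow_tangent (r x : ℝ) (hr : 1 ≤ r) (hx : 0 < x) :
    x ^ r - 1 ≤ r * x ^ (r - 1) * (x - 1) := by
  have h := one_add_mul_self_le_rpow_one_add (s := x⁻¹ - 1) (p := r)
    (by have := inv_pos.2 hx; linarith) hr
  rw [add_sub_cancel, Real.inv_rpow hx.le] at h
  have hp : 0 < x ^ r := Real.rpow_pos_of_pos hx r
  have h2 := mul_le_mul_of_nonneg_left h hp.le
  rw [mul_inv_cancel₀ hp.ne'] at h2
  have e : x ^ (r - 1) = x ^ r * x⁻¹ := by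
    rw [Real.rpow_sub hx, Real.rpow_one]; rfl
  rw [e]
  have e2 : x ^ r * x⁻¹ * x = x ^ r := by field_simp
  nlinarith

lemma gv_pow_upper (s x : ℝ) (hs : 2 < s) (hx : 1 / 2 ≤ x) (hx2 : x ≤ 3 / 2) :
    (x ^ s - 1) / s - (x ^ 2 - 1) / 2 ≤ s * 2 ^ (s - 2) * (x - 1) ^ 2 := by
  have hx0 : 0 < x := by linarith
  have h1 := gv_pow_tangent s x (by linarith) hx0
  have h2 : (x ^ s - 1) / s ≤ x ^ (s - 1) * (x - 1) := by
    rw [div_le_iff₀ (by linarith)]; linarith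
  have h3 : (x - 1) * (x ^ (s - 1) - 1) ≤ s * 2 ^ (s - 2) * (x - 1) ^ 2 := by
    have hp1 : (1:ℝ) ≤ 2 ^ (s - 2) := Real.one_le_rpow (by norm_num) (by linarith)
    rcases le_total 1 x with h | h
    · have h4 := gv_pow_tangent (s - 1) x (by linarith) hx0
      have e : s - 1 - 1 = s - 2 := by ring
      rw [e] at h4
      have h5 : x ^ (s - 2) ≤ 2 ^ (s - 2) :=
        Real.rpow_le_rpow hx0.le (by linarith) (by linarith)
      have h6 : (s - 1) * x ^ (s - 2) ≤ s * 2 ^ (s - 2) := by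
        apply mul_le_mul (by linarith) h5 (Real.rpow_nonneg hx0.le _) (by linarith)
      calc (x - 1) * (x ^ (s - 1) - 1) ≤ (x - 1) * ((s - 1) * x ^ (s - 2) * (x - 1)) :=
            mul_le_mul_of_nonneg_left h4 (by linarith)
        _ = ((s - 1) * x ^ (s - 2)) * (x - 1) ^ 2 := by ring
        _ ≤ _ := mul_le_mul_of_nonneg_right h6 (sq_nonneg _)
    · have h4 := one_add_mul_self_le_rpow_one_add (s := x - 1) (p := s - 1)
        (by linarith) (by linarith)
      rw [add_sub_cancel] at h4
      have h6 : s - 1 ≤ s * 2 ^ (s - 2) := by nlinarith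
      calc (x - 1) * (x ^ (s - 1) - 1) ≤ (x - 1) * ((s - 1) * (x - 1)) :=
            mul_le_mul_of_nonpos_left (by linarith) (by linarith)
        _ = (s - 1) * (x - 1) ^ 2 := by ring
        _ ≤ _ := mul_le_mul_of_nonneg_right h6 (sq_nonneg _)
  nlinarith [sq_nonneg (x - 1)]

lemma gv_U_nonneg (s γ Ω x : ℝ) (hs : 2 < s) (hγ : 0 < γ) (hx : 0 < x) : 0 ≤ Upot s γ Ω x := by
  rw [gv_U_eq s γ Ω x hx]
  have := gv_pow_lower s x hs hx
  positivity

lemma gv_U_lower (s γ Ω x : ℝ) (hs : 2 < s) (hγ : 0 < γ) (hΩ : 1 ≤ Ω) (hx : 0 < x)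
    (h : 2 ≤ Ω * |x - 1|) : (x - 1) ^ 2 / 2 ≤ Upot s γ Ω x := by
  rw [gv_U_eq s γ Ω x hx]
  have h1 := mul_nonneg hγ.le (gv_pow_lower s x hs hx)
  obtain ⟨n1, n2⟩ := gv_floor Ω hΩ
  set n := (⌊Ω⌋ : ℝ) / Ω
  have hΩ0 : 0 < Ω := by linarith
  have key : (x - 1) ^ 2 / 2 ≤ (n - x ^ 2) ^ 2 / (2 * x ^ 2) := by
    rw [div_le_div_iff₀ (by norm_num) (by positivity)]
    have : ((x - 1) * x) ^ 2 ≤ (n - x ^ 2) ^ 2 := by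
      rw [sq_le_sq]
      rcases le_total 1 x with h2 | h2
      · rw [abs_of_nonneg (by nlinarith), abs_of_nonpos (by nlinarith)]
        nlinarith
      · rw [abs_of_nonpos (by linarith)] at h
        have h3 : 1 / Ω ≤ 1 - x := by
          rw [div_le_iff₀ hΩ0]; linarith
        rw [abs_of_nonpos (by nlinarith), abs_of_nonneg (by nlinarith)]
        nlinarith
    nlinarith
  linarith

lemma gv_U_upper (s γ Ω x : ℝ) (hs : 2 < s) (hγ : 0 < γ) (hγ1 : γ ≤ 1) (hΩ : 1 ≤ Ω)
    (hx : 1 / 2 ≤ x) (hx2 : x ≤ 3 / 2) :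
    Ω ^ 2 * Upot s γ Ω x ≤ (25 + s * 2 ^ (s - 2)) * (Ω ^ 2 * (x - 1) ^ 2 + 1) := by
  have hx0 : 0 < x := by linarith
  rw [gv_U_eq s γ Ω x hx0]
  have hlow := gv_pow_lower s x hs hx0
  have hup := gv_pow_upper s x hs hx hx2
  obtain ⟨n1, n2⟩ := gv_floor Ω hΩ
  set n := (⌊Ω⌋ : ℝ) / Ω
  have hΩ0 : 0 < Ω := by linarith
  set c : ℝ := s * 2 ^ (s - 2)
  have hc : 0 ≤ c := by positivity
  set T := (x ^ s - 1) / s - (x ^ 2 - 1) / 2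
  have h1 : γ * T ≤ c * (x - 1) ^ 2 := by nlinarith
  have h2 : (n - x ^ 2) ^ 2 / (2 * x ^ 2) ≤ 2 * (n - x ^ 2) ^ 2 := by
    rw [div_le_iff₀ (by positivity)]
    have : 1 ≤ 2 * (2 * x ^ 2) := by nlinarith
    nlinarith [sq_nonneg (n - x ^ 2)]
  have h3 : (n - x ^ 2) ^ 2 ≤ 2 * ((1 - n) ^ 2 + (1 - x ^ 2) ^ 2) := by
    nlinarith [sq_nonneg ((1 - n) + (1 - x ^ 2))]
  have h4 : (1 - n) ^ 2 * Ω ^ 2 ≤ 1 := by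
    have : (1 - n) * Ω ≤ 1 := by
      have : 1 - n ≤ 1 / Ω := by linarith
      rwa [le_div_iff₀ hΩ0] at this
    rw [← mul_pow]
    have : 0 ≤ (1 - n) * Ω := mul_nonneg (by linarith) hΩ0.le
    nlinarith
  have h5 : (1 - x ^ 2) ^ 2 ≤ 25 / 4 * (x - 1) ^ 2 := by
    have : (1 - x ^ 2) ^ 2 = (1 + x) ^ 2 * (x - 1) ^ 2 := by ring
    rw [this]
    apply mul_le_mul_of_nonneg_right _ (sq_nonneg _)
    nlinarith
  have h6 : (n - x ^ 2) ^ 2 / (2 * x ^ 2) + γ * T ≤ 4 * (1 - n) ^ 2 + (25 + c) * (x - 1) ^ 2 := by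
    linarith
  have h7 := mul_le_mul_of_nonneg_left h6 (sq_nonneg Ω)
  nlinarith

/-- Trial function energy bound. -/
lemma gv_trial (ε δ C2 : ℝ) (V : ℝ → ℝ) (cV : Continuous V) (hε : 0 < ε)
    (hC2 : 0 ≤ C2) (hδ : ε ^ 2 ≤ δ) (hδ2 : δ ≤ 1 / 2)
    (hV : ∀ x ∈ Icc (1 - δ) (1 + δ), V x ≤ C2 / ε ^ 4 * (1 + ((x - 1) / ε ^ 2) ^ 2)) :
    ∃ f : ℝ → ℝ, ContDiff ℝ 1 f ∧ (∫ x in (1 - δ)..(1 + δ), x * f x ^ 2) = 1 / (2 * π) ∧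
      (∫ x in (1 - δ)..(1 + δ), x * (1 / 2 * deriv f x ^ 2 + V x * f x ^ 2 + 1 / ε ^ 2 * f x ^ 4))
        ≤ 6 * (3 + C2) / ε ^ 4 := by
  have hε2 : 0 < ε ^ 2 := by positivity
  have hδ0 : 0 < δ := by linarith
  have hab : 1 - δ ≤ 1 + δ := by linarith
  set φ : ℝ → ℝ := fun x => (1 + ((x - 1) / ε ^ 2) ^ 2)⁻¹ with hφ
  have hpos : ∀ x : ℝ, 0 < 1 + ((x - 1) / ε ^ 2) ^ 2 := fun x => by positivity
  have φC : ContDiff ℝ 1 φ := by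
    apply ContDiff.inv
    · fun_prop
    · exact fun x => (hpos x).ne'
  have cφ := φC.continuous
  have φpos : ∀ x, 0 < φ x := fun x => inv_pos.2 (hpos x)
  have φle : ∀ x, φ x ≤ 1 := fun x => inv_le_one_of_one_le₀ (by nlinarith [sq_nonneg ((x - 1) / ε ^ 2)])
  have φd : ∀ x, HasDerivAt φ (-(2 * ((x - 1) / ε ^ 2) * (1 / ε ^ 2)) * φ x ^ 2) x := by
    intro x
    have h := (((((hasDerivAt_id x).sub_const 1).div_const (ε ^ 2)).pow 2).const_add 1).inv
      (hpos x).ne'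
    refine h.congr_deriv ?_
    simp [hφ]; field_simp
  have φint : (∫ x in (1 - δ)..(1 + δ), φ x) ≤ 4 * ε ^ 2 := by
    have hd : ∀ x, HasDerivAt (fun x => ε ^ 2 * arctan ((x - 1) / ε ^ 2)) (φ x) x := by
      intro x
      have h := ((((hasDerivAt_id x).sub_const 1).div_const (ε ^ 2)).arctan).const_mul (ε ^ 2)
      refine h.congr_deriv ?_
      simp [hφ]; field_simp
    rw [intervalIntegral.integral_eq_sub_of_hasDerivAt (fun x _ => hd x)
      (cφ.intervalIntegrable _ _)]
    have h1 := arctan_lt_pi_div_two ((1 + δ - 1) / ε ^ 2)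
    have h2 := neg_pi_div_two_lt_arctan ((1 - δ - 1) / ε ^ 2)
    have h3 := pi_le_four
    rw [← mul_sub, mul_comm]
    apply mul_le_mul_of_nonneg_right _ hε2.le
    linarith
  set S := ∫ x in (1 - δ)..(1 + δ), x * φ x ^ 2 with hS
  have hSl : ε ^ 2 / 4 ≤ S := by
    have h1 : ∫ x in (1 - ε ^ 2)..(1 + ε ^ 2), (1 / 8 : ℝ) ≤
        ∫ x in (1 - ε ^ 2)..(1 + ε ^ 2), x * φ x ^ 2 := by
      apply intervalIntegral.integral_mono_on (by linarith) (by simp)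
        ((by fun_prop : Continuous _).intervalIntegrable _ _)
      intro x hx
      have hx1 : 1 / 2 ≤ x := by linarith [hx.1]
      have h2 : 1 / 2 ≤ φ x := by
        simp only [hφ]
        rw [one_div]
        apply inv_anti₀ (hpos x)
        have : ((x - 1) / ε ^ 2) ^ 2 ≤ 1 := by
          rw [sq_le_one_iff_abs_le_one, abs_div, abs_of_pos hε2, div_le_one hε2, abs_le]
          constructor <;> linarith [hx.1, hx.2]
        linarith
      nlinarith [mul_self_nonneg (φ x - 1/2)]
    have h2 : ∫ x in (1 - ε ^ 2)..(1 + ε ^ 2), x * φ x ^ 2 ≤ S := by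
      apply intervalIntegral.integral_mono_interval (by linarith) (by linarith) (by linarith)
      · filter_upwards [ae_restrict_mem measurableSet_Ioc] with x hx
        have : 0 < x := by linarith [hx.1]
        have := φpos x
        simp only [Pi.zero_apply]; positivity
      · exact (by fun_prop : Continuous _).intervalIntegrable _ _
    rw [intervalIntegral.integral_const, smul_eq_mul] at h1
    linarith
  have hSpos : 0 < S := by linarith
  have hN : 1 / (2 * π) ≤ 1 / 4 := by
    apply one_div_le_one_div_of_le (by norm_num)
    linarith [two_le_pi]
  have hN0 : 0 < 1 / (2 * π) := by positivity
  set κ := Real.sqrt (1 / (2 * π) / S) with hκ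
  have hκ2 : κ ^ 2 = 1 / (2 * π) / S := Real.sq_sqrt (by positivity)
  have hκle : κ ^ 2 ≤ 1 / ε ^ 2 := by
    rw [hκ2, div_le_div_iff₀ hSpos hε2]
    nlinarith
  refine ⟨fun x => κ * φ x, by fun_prop, ?_, ?_⟩
  · have : (fun x => x * (κ * φ x) ^ 2) = fun x => κ ^ 2 * (x * φ x ^ 2) := by funext x; ring
    rw [this, intervalIntegral.integral_const_mul, ← hS, hκ2]
    field_simp
  · have hfd : ∀ x, deriv (fun x => κ * φ x) x =
        κ * (-(2 * ((x - 1) / ε ^ 2) * (1 / ε ^ 2)) * φ x ^ 2) := fun x => ((φd x).const_mul κ).deriv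
    simp only [hfd]
    calc _ ≤ ∫ x in (1 - δ)..(1 + δ), (3 / 2 * (3 + C2) / ε ^ 6) * φ x := by
          apply intervalIntegral.integral_mono_on hab
            ((by fun_prop : Continuous _).intervalIntegrable _ _)
            ((by fun_prop : Continuous _).intervalIntegrable _ _)
          intro x hx
          have hx0 : 0 ≤ x := by linarith [hx.1]
          have hx2 : x ≤ 3 / 2 := by linarith [hx.2]
          have hVx := hV x hx
          have hp := φpos x
          have hl := φle x
          set t := (x - 1) / ε ^ 2 with ht
          have htφ : (1 + t ^ 2) * φ x = 1 := mul_inv_cancel₀ (hpos x).ne'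
          have hφ2 : φ x ^ 2 ≤ φ x := by nlinarith
          have hφ4 : φ x ^ 4 ≤ φ x := by nlinarith [sq_nonneg (φ x)]
          have b1 : t ^ 2 * φ x ^ 4 ≤ φ x := by
            have : t ^ 2 * φ x ≤ 1 := by nlinarith
            have h3 : φ x ^ 3 ≤ φ x := by nlinarith
            calc t ^ 2 * φ x ^ 4 = (t ^ 2 * φ x) * φ x ^ 3 := by ring
              _ ≤ 1 * φ x ^ 3 := mul_le_mul_of_nonneg_right this (by positivity)
              _ ≤ φ x := by linarith
          have b2 : V x * φ x ^ 2 ≤ C2 / ε ^ 4 * φ x := by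
            calc V x * φ x ^ 2 ≤ (C2 / ε ^ 4 * (1 + t ^ 2)) * φ x ^ 2 :=
                  mul_le_mul_of_nonneg_right hVx (by positivity)
              _ = C2 / ε ^ 4 * φ x * ((1 + t ^ 2) * φ x) := by ring
              _ = _ := by rw [htφ, mul_one]
          have c1 : 1 / 2 * (κ * (-(2 * t * (1 / ε ^ 2)) * φ x ^ 2)) ^ 2 ≤ 2 / ε ^ 6 * φ x := by
            calc _ = κ ^ 2 * (2 / ε ^ 4) * (t ^ 2 * φ x ^ 4) := by field_simp
              _ ≤ (1 / ε ^ 2) * (2 / ε ^ 4) * φ x := by gcongr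
              _ = _ := by field_simp
          have c2 : V x * (κ * φ x) ^ 2 ≤ C2 / ε ^ 6 * φ x := by
            calc _ = κ ^ 2 * (V x * φ x ^ 2) := by ring
              _ ≤ κ ^ 2 * (C2 / ε ^ 4 * φ x) := by gcongr
              _ ≤ (1 / ε ^ 2) * (C2 / ε ^ 4 * φ x) := by gcongr
              _ = _ := by field_simp
          have c3 : 1 / ε ^ 2 * (κ * φ x) ^ 4 ≤ 1 / ε ^ 6 * φ x := by
            calc _ = 1 / ε ^ 2 * ((κ ^ 2) ^ 2 * φ x ^ 4) := by ring
              _ ≤ 1 / ε ^ 2 * ((1 / ε ^ 2) ^ 2 * φ x) := by gcongr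
              _ = _ := by field_simp
          have c4 : 1 / 2 * (κ * (-(2 * t * (1 / ε ^ 2)) * φ x ^ 2)) ^ 2 +
              V x * (κ * φ x) ^ 2 + 1 / ε ^ 2 * (κ * φ x) ^ 4 ≤ (3 + C2) / ε ^ 6 * φ x := by
            calc _ ≤ 2 / ε ^ 6 * φ x + C2 / ε ^ 6 * φ x + 1 / ε ^ 6 * φ x := by linarith
              _ = _ := by ring
          calc _ ≤ x * ((3 + C2) / ε ^ 6 * φ x) := mul_le_mul_of_nonneg_left c4 hx0
            _ ≤ 3 / 2 * ((3 + C2) / ε ^ 6 * φ x) := by gcongr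
            _ = _ := by ring
      _ = (3 / 2 * (3 + C2) / ε ^ 6) * ∫ x in (1 - δ)..(1 + δ), φ x := by
          rw [intervalIntegral.integral_const_mul]
      _ ≤ (3 / 2 * (3 + C2) / ε ^ 6) * (4 * ε ^ 2) := by gcongr
      _ = _ := by field_simp; ring

set_option maxHeartbeats 4000000 in
lemma gv_core (s γ Ω₀ : ℝ) (hs : 2 < s) (hγ0 : 0 < γ) (hγ1 : γ ≤ 1) (hΩ₀ : 0 < Ω₀) :
    ∃ S7 K6 : ℝ, 0 ≤ S7 ∧ 0 ≤ K6 ∧ ∀ ε η : ℝ, 0 < ε → ε ≤ 1 → ε ^ 4 ≤ Ω₀ → 1 ≤ η →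
      ε ^ 2 * η ≤ 1 / 2 → ∀ g : ℝ → ℝ, IsGVAnnMin ε s γ (Ω₀ / ε ^ 4) η g →
      ∀ x ∈ annIcc ε η, 0 < g x ∧ |deriv g x| ≤ 2 * S7 * η / ε ^ 2 * g x ∧
        exp (1 / 4 * (Ω₀ / ε ^ 4) * (x - 1) ^ 2) * g x ≤ K6 * η / ε := by
  set C1 : ℝ := 25 + s * 2 ^ (s - 2) with hC1
  have hC1p : 0 < C1 := by positivity
  set C2 : ℝ := C1 * (Ω₀ ^ 2 + 1) with hC2
  have hC2p : 0 < C2 := by positivity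
  set K : ℝ := 6 * (3 + C2) with hK
  have hKp : 0 < K := by positivity
  set K4 : ℝ := (16 * K + 1) * exp (2 + 22 * K / Ω₀) with hK4
  have hK4p : 0 < K4 := by positivity
  set K5 : ℝ := 2 + 2 * K with hK5
  have hK5p : 0 < K5 := by positivity
  set K6 : ℝ := 3 + 2 * K + 2 * K4 with hK6
  set K7 : ℝ := 10 * (C2 + K5 ^ 2) with hK7
  have hK7p : 0 < K7 := by positivity
  refine ⟨Real.sqrt K7, K6, Real.sqrt_nonneg _, by positivity, ?_⟩
  clear_value K7 K6 K5 K4 K C2 C1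
  intro ε η hε hε1 hεΩ hη hδ g hg x hx
  obtain ⟨⟨hgC, hgN⟩, hgpos, hgmin⟩ := hg
  have hε2 : 0 < ε ^ 2 := by positivity
  have hε4 : 0 < ε ^ 4 := by positivity
  have hε4' : 1 ≤ 1 / ε ^ 4 := by
    rw [le_div_iff₀ hε4, one_mul]; exact pow_le_one₀ hε.le hε1
  set Ω := Ω₀ / ε ^ 4 with hΩ
  have hΩ1 : 1 ≤ Ω := by rw [hΩ, le_div_iff₀ hε4]; linarith
  set δ := ε ^ 2 * η with hδd
  have hδε : ε ^ 2 ≤ δ := le_mul_of_one_le_right hε2.le hη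
  have hδ0 : 0 < δ := by linarith
  set a := 1 - δ with ha
  set b := 1 + δ with hb
  have hab : a < b := by linarith
  have hann : annIcc ε η = Icc a b := rfl
  have hset : ∀ F : ℝ → ℝ, (∫ x in annIcc ε η, F x) = ∫ x in a..b, F x := by
    intro F
    rw [hann, integral_Icc_eq_integral_Ioc, intervalIntegral.integral_of_le hab.le]
  rw [hann] at hx hgpos
  have hpi := pi_pos
  set N := 1 / (2 * π) with hN
  have hN0 : 0 < N := by positivity
  have hN4 : N ≤ 1 / 4 := by
    apply one_div_le_one_div_of_le (by norm_num)
    linarith [two_le_pi]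
  have hNeq : ∀ I : ℝ, 2 * π * I = 1 ↔ I = N := by
    intro I; rw [hN, eq_div_iff (by positivity), mul_comm]
  rw [hset, hNeq] at hgN
  -- continuous potential
  set V : ℝ → ℝ := fun x => Ω ^ 2 * Upot s γ Ω (max x (1 / 2)) with hV
  have hmax : ∀ x ∈ Icc a b, max x (1 / 2) = x := fun x hx =>
    max_eq_left (by linarith [hx.1])
  have cV : Continuous V := by
    have hp : ∀ x : ℝ, 0 < max x (1 / 2) := fun x => lt_max_of_lt_right (by norm_num)
    have cm : Continuous fun x : ℝ => max x (1 / 2) := by fun_prop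
    have c1 : Continuous fun x : ℝ => (max x (1 / 2)) ^ s :=
      cm.rpow_const (fun x => Or.inl (hp x).ne')
    have c2 : Continuous fun x : ℝ => (1 / 2) * ((⌊Ω⌋ : ℝ) ^ 2 / Ω ^ 2) / (max x (1 / 2)) ^ 2 :=
      continuous_const.div (cm.pow 2) (fun x => (pow_pos (hp x) 2).ne')
    simp only [hV, Upot]
    fun_prop
  have hVeq : ∀ x ∈ Icc a b, V x = Ω ^ 2 * Upot s γ Ω x := by
    intro x hx; simp only [hV, hmax x hx]
  have hVnn : ∀ x, 0 ≤ V x := fun x => mul_nonneg (sq_nonneg _)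
    (gv_U_nonneg s γ Ω _ hs hγ0 (lt_max_of_lt_right (by norm_num)))
  clear_value V
  have hVlow : ∀ x ∈ Icc a b, 2 ≤ Ω * |x - 1| → Ω ^ 2 * (x - 1) ^ 2 / 2 ≤ V x := by
    intro x hx h
    rw [hVeq x hx, mul_div_assoc]
    exact mul_le_mul_of_nonneg_left
      (gv_U_lower s γ Ω x hs hγ0 hΩ1 (by linarith [hx.1]) h) (sq_nonneg _)
  have hVup : ∀ x ∈ Icc a b, V x ≤ C2 / ε ^ 4 * (1 + ((x - 1) / ε ^ 2) ^ 2) := by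
    intro x hx
    rw [hVeq x hx]
    refine (gv_U_upper s γ Ω x hs hγ0 hγ1 hΩ1 (by linarith [hx.1]) (by linarith [hx.2])).trans ?_
    rw [← hC1, hC2]
    set t := (x - 1) / ε ^ 2 with ht
    have e1 : Ω ^ 2 * (x - 1) ^ 2 = Ω₀ ^ 2 * (1 / ε ^ 4) * t ^ 2 := by
      rw [hΩ, ht]; field_simp
    have e2 : C1 * (Ω₀ ^ 2 + 1) / ε ^ 4 * (1 + t ^ 2) =
      C1 * ((Ω₀ ^ 2 + 1) * (1 / ε ^ 4) * (1 + t ^ 2)) := by ring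
    rw [e1, e2]
    apply mul_le_mul_of_nonneg_left _ hC1p.le
    set r := 1 / ε ^ 4
    have q1 : 0 ≤ Ω₀ ^ 2 * r := by positivity
    have q2 : 0 ≤ r * t ^ 2 := by positivity
    have q3 : (Ω₀ ^ 2 + 1) * r * (1 + t ^ 2) =
      Ω₀ ^ 2 * r + Ω₀ ^ 2 * r * t ^ 2 + r + r * t ^ 2 := by ring
    linarith
  -- minimality in terms of interval integrals
  have hEn : ∀ f : ℝ → ℝ, gvEnergyAnn ε s γ Ω η f = 2 * π *
      ∫ x in a..b, x * (1 / 2 * deriv f x ^ 2 + V x * f x ^ 2 + 1 / ε ^ 2 * f x ^ 4) := by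
    intro f
    unfold gvEnergyAnn
    rw [hset]
    congr 1
    apply intervalIntegral.integral_congr
    intro x hx
    rw [uIcc_of_le hab.le] at hx
    simp only [hVeq x hx]
  have hmin : ∀ f : ℝ → ℝ, ContDiff ℝ 1 f → ∫ x in a..b, x * f x ^ 2 = N →
      (∫ x in a..b, x * (1 / 2 * deriv g x ^ 2 + V x * g x ^ 2 + 1 / ε ^ 2 * g x ^ 4)) ≤
        ∫ x in a..b, x * (1 / 2 * deriv f x ^ 2 + V x * f x ^ 2 + 1 / ε ^ 2 * f x ^ 4) := by
    intro f hf hfN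
    have h := hgmin f ⟨hf, by rw [hset, hNeq]; exact hfN⟩
    rw [hEn, hEn] at h
    exact le_of_mul_le_mul_left h (by positivity)
  have cg := hgC.continuous
  have cg' : Continuous (deriv g) := hgC.continuous_deriv le_rfl
  have hI : ∀ f : ℝ → ℝ, Continuous f → IntervalIntegrable f volume a b :=
    fun f hf => hf.intervalIntegrable a b
  -- energy bounds
  have hJ : (∫ x in a..b, x * (1 / 2 * deriv g x ^ 2 + V x * g x ^ 2 + 1 / ε ^ 2 * g x ^ 4))
      ≤ K / ε ^ 4 := by
    obtain ⟨f, hf, hfN, hfJ⟩ := gv_trial ε δ C2 V cV hε hC2p.le hδε hδ hVup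
    rw [← hK] at hfJ
    exact (hmin f hf hfN).trans hfJ
  clear_value N Ω a b
  set T := ∫ x in a..b, x * (1 / 2 * deriv g x ^ 2) with hT
  set VV := ∫ x in a..b, x * (V x * g x ^ 2) with hVV
  set R := ∫ x in a..b, x * (1 / ε ^ 2 * g x ^ 4) with hR
  have hxpos : ∀ x ∈ Icc a b, 0 ≤ x := fun x hx => by linarith [hx.1]
  have hT0 : 0 ≤ T := intervalIntegral.integral_nonneg hab.le
    (fun x hx => mul_nonneg (hxpos x hx) (by positivity))
  have hVV0 : 0 ≤ VV := intervalIntegral.integral_nonneg hab.le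
    (fun x hx => mul_nonneg (hxpos x hx) (mul_nonneg (hVnn x) (by positivity)))
  have hR0 : 0 ≤ R := intervalIntegral.integral_nonneg hab.le
    (fun x hx => mul_nonneg (hxpos x hx) (by positivity))
  have hQ : ∫ x in a..b, x * (1 / 2 * deriv g x ^ 2 + V x * g x ^ 2) = T + VV := by
    rw [hT, hVV, ← intervalIntegral.integral_add (hI _ (by fun_prop)) (hI _ (by fun_prop))]
    congr 1; funext x; ring
  have hJeq : (∫ x in a..b, x * (1 / 2 * deriv g x ^ 2 + V x * g x ^ 2 + 1 / ε ^ 2 * g x ^ 4))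
      = (T + VV) + R := by
    rw [← hQ, hR, ← intervalIntegral.integral_add (hI _ (by fun_prop)) (hI _ (by fun_prop))]
    congr 1; funext x; ring
  rw [hJeq] at hJ
  clear_value T VV R
  set μ := ((∫ x in a..b, x * (1 / 2 * deriv g x ^ 2 + V x * g x ^ 2)) + 2 * R) / N with hμ
  have hμ0 : 0 ≤ μ := by rw [hμ, hQ]; positivity
  have hμ1 : μ ≤ 16 * K / ε ^ 4 := by
    have h1 : μ = 2 * π * (T + VV + 2 * R) := by rw [hμ, hQ, hN]; field_simp
    rw [h1]
    have h2 : T + VV + 2 * R ≤ 2 * (K / ε ^ 4) := by linarith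
    calc 2 * π * (T + VV + 2 * R) ≤ 2 * 4 * (2 * (K / ε ^ 4)) := by
          apply mul_le_mul (by linarith [pi_le_four]) h2 (by positivity) (by norm_num)
      _ = _ := by ring
  set w : ℝ → ℝ := fun x => V x + 2 * (1 / ε ^ 2) * g x ^ 2 - μ with hw
  have cw : Continuous w := by simp only [hw]; fun_prop
  have hweak : ∀ ψ : ℝ → ℝ, ContDiff ℝ 1 ψ →
      ∫ x in a..b, x * (1 / 2 * deriv g x * deriv ψ x + w x * g x * ψ x) = 0 :=
    fun ψ hψ => gv_weak_form a b N (1 / ε ^ 2) V g cV hgC hN0 hgN hmin μ (by rw [hμ, hR]) ψ hψ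
  clear_value μ w
  -- pointwise bound on g
  have hba : b - a = 2 * ε ^ 2 * η := by rw [hb, ha, hδd]; ring
  have hε3 : (b - a) / (2 * ε ^ 3) = η / ε := by rw [hba]; field_simp
  obtain ⟨y, hy, hgy⟩ : ∃ y ∈ Icc a b, g y ≤ 1 / ε := by
    by_contra hcon
    push Not at hcon
    have h1 : ∫ x in a..b, (1 / 2 * (1 / ε) ^ 2) ≤ ∫ x in a..b, x * g x ^ 2 := by
      apply intervalIntegral.integral_mono_on hab.le (by simp) (hI _ (by fun_prop))
      intro x hx
      have h2 := hcon x hx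
      have h3 : (1 / ε) ^ 2 ≤ g x ^ 2 := by gcongr
      have h4 : 1 / 2 ≤ x := by linarith [hx.1]
      exact mul_le_mul h4 h3 (by positivity) (by linarith)
    rw [intervalIntegral.integral_const, hgN, hba, smul_eq_mul] at h1
    have h2 : 2 * ε ^ 2 * η * (1 / 2 * (1 / ε) ^ 2) = η := by field_simp
    linarith
  have hgbd : ∀ x ∈ Icc a b, g x ≤ K5 * η / ε := by
    intro x hx
    have h := gv_sobolev a b (ε ^ 3) (K / ε ^ 4) (by linarith) (by positivity) g hgC
      (by linarith) x hx y hy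
    rw [hε3] at h
    have e1 : 2 * ε ^ 3 * (K / ε ^ 4) = 2 * K / ε := by field_simp
    rw [e1] at h
    calc g x ≤ 1 / ε + (2 * K / ε + η / ε) := by linarith
      _ = (1 + 2 * K + η) / ε := by ring
      _ ≤ K5 * η / ε := by
        apply div_le_div_of_nonneg_right _ hε.le
        have : 0 ≤ (1 + 2 * K) * (η - 1) := mul_nonneg (by linarith) (by linarith)
        rw [hK5]; linarith
  -- Agmon
  set k := 1 / 4 * Ω with hk
  set h : ℝ → ℝ := fun x => exp (k * (x - 1) ^ 2) * g x with hh
  have hhC : ContDiff ℝ 1 h := by simp only [hh]; fun_prop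
  have hag : (∫ x in a..b, x * (1 / 2 * deriv h x ^ 2)) ≤ K4 / ε ^ 4 := by
    rw [hh, gv_agmon a b k g w cw hgC hweak]
    calc _ ≤ ∫ x in a..b, (K4 / ε ^ 4) * (x * g x ^ 2) := by
          apply intervalIntegral.integral_mono_on hab.le (hI _ (by fun_prop)) (hI _ (by fun_prop))
          intro x hx
          have hx0 := hxpos x hx
          have key : (2 * k ^ 2 * (x - 1) ^ 2 - w x) * exp (2 * (k * (x - 1) ^ 2)) ≤ K4 / ε ^ 4 := by
            have hg2 : 0 ≤ 2 * (1 / ε ^ 2) * g x ^ 2 := by positivity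
            have hK4' : K4 / ε ^ 4 = ((16 * K + 1) / ε ^ 4) * exp (2 + 22 * K / Ω₀) := by
              rw [hK4]; ring
            have hE : 0 < exp (2 * (k * (x - 1) ^ 2)) := exp_pos _
            have hk1 : 2 * k ^ 2 * (x - 1) ^ 2 = Ω ^ 2 * (x - 1) ^ 2 / 8 := by rw [hk]; ring
            have hk2 : 2 * (k * (x - 1) ^ 2) = Ω * (x - 1) ^ 2 / 2 := by rw [hk]; ring
            have hKΩ : 0 < 22 * K / Ω₀ := by positivity
            have hsum : (16 * K + 1) / ε ^ 4 = 16 * K / ε ^ 4 + 1 / ε ^ 4 := by ring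
            have hrp : 0 ≤ (16 * K + 1) / ε ^ 4 := by positivity
            by_cases hc : 2 ≤ Ω * |x - 1|
            · have hv := hVlow x hx hc
              by_cases hc2 : 2 * k ^ 2 * (x - 1) ^ 2 - w x ≤ 0
              · exact (mul_nonpos_of_nonpos_of_nonneg hc2 hE.le).trans (by positivity)
              · push Not at hc2
                simp only [hw] at hc2 ⊢
                rw [hk1] at hc2 ⊢
                rw [hk2, hK4']
                have hX : Ω ^ 2 * (x - 1) ^ 2 ≤ 44 * K / ε ^ 4 := by
                  have : 16 * K / ε ^ 4 = 16 * (K / ε ^ 4) := by ring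
                  have : 44 * K / ε ^ 4 = 44 * (K / ε ^ 4) := by ring
                  have : 0 < K / ε ^ 4 := by positivity
                  linarith
                have hY : Ω * (x - 1) ^ 2 / 2 ≤ 22 * K / Ω₀ := by
                  have e : Ω ^ 2 * (x - 1) ^ 2 = Ω * (x - 1) ^ 2 * Ω₀ / ε ^ 4 := by
                    rw [hΩ]; ring
                  rw [e] at hX
                  have := (div_le_div_iff_of_pos_right hε4).1 hX
                  rw [div_le_div_iff₀ (by norm_num) hΩ₀]
                  linarith
                apply mul_le_mul _ (exp_le_exp.2 (by linarith)) (exp_pos _).le hrp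
                have : 0 ≤ Ω ^ 2 * (x - 1) ^ 2 := by positivity
                linarith
            · push Not at hc
              have hX : Ω ^ 2 * (x - 1) ^ 2 ≤ 4 := by
                have : Ω ^ 2 * (x - 1) ^ 2 = (Ω * |x - 1|) ^ 2 := by
                  rw [mul_pow, sq_abs]
                rw [this]
                have : 0 ≤ Ω * |x - 1| := by positivity
                exact (pow_le_pow_left₀ this hc.le 2).trans (by norm_num)
              have hY : Ω * (x - 1) ^ 2 ≤ Ω ^ 2 * (x - 1) ^ 2 :=
                mul_le_mul_of_nonneg_right (le_self_pow₀ hΩ1 two_ne_zero) (sq_nonneg _)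
              rw [hK4', hk1, hk2]
              apply mul_le_mul _ (exp_le_exp.2 (by linarith)) (exp_pos _).le hrp
              simp only [hw]
              linarith [hVnn x]
          have h2 := mul_le_mul_of_nonneg_right key (mul_nonneg hx0 (sq_nonneg (g x)))
          linarith
      _ = (K4 / ε ^ 4) * N := by rw [intervalIntegral.integral_const_mul, hgN]
      _ ≤ (K4 / ε ^ 4) * 1 := by gcongr; linarith
      _ = _ := mul_one _
  have h1mem : (1:ℝ) ∈ Icc a b := ⟨by linarith, by linarith⟩
  have hhbd : h x ≤ K6 * η / ε := by
    have h2 := gv_sobolev a b (ε ^ 3) (K4 / ε ^ 4) (by linarith) (by positivity) h hhC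
      hag x hx 1 h1mem
    rw [hε3] at h2
    have e1 : 2 * ε ^ 3 * (K4 / ε ^ 4) = 2 * K4 / ε := by field_simp
    rw [e1] at h2
    have e2 : h 1 = g 1 := by simp [hh]
    have e3 := hgbd 1 h1mem
    calc h x ≤ K5 * η / ε + (2 * K4 / ε + η / ε) := by linarith
      _ = (K5 * η + 2 * K4 + η) / ε := by ring
      _ ≤ K6 * η / ε := by
        apply div_le_div_of_nonneg_right _ hε.le
        have : 0 ≤ K4 * (η - 1) := mul_nonneg hK4p.le (by linarith)
        rw [hK5, hK6]; linarith
  -- Riccati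
  have hstrong := gv_strong_form a b hab (fun x => 2 * x * w x * g x) g (by fun_prop) hgC (by
    intro ψ hψ
    have h2 := hweak ψ hψ
    have e : (fun x => x * deriv g x * deriv ψ x + 2 * x * w x * g x * ψ x) =
      fun x => 2 * (x * (1 / 2 * deriv g x * deriv ψ x + w x * g x * ψ x)) := by
      funext x; ring
    rw [e, intervalIntegral.integral_const_mul, h2, mul_zero])
  have hric := gv_riccati a b (K7 * η ^ 2 / ε ^ 4) (by linarith) hab w g cw hgC hgpos
    (by positivity) (by
      intro x hx
      have hgx := hgpos x hx
      have hx2 : x ≤ 3 / 2 := by linarith [hx.2]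
      have hx0 := hxpos x hx
      have b1 : V x ≤ 2 * C2 * η ^ 2 / ε ^ 4 := by
        refine (hVup x hx).trans ?_
        have : ((x - 1) / ε ^ 2) ^ 2 ≤ η ^ 2 := by
          apply sq_le_sq'
          · rw [le_div_iff₀ hε2]; linarith [hx.1]
          · rw [div_le_iff₀ hε2]; linarith [hx.2]
        calc _ ≤ C2 / ε ^ 4 * (η ^ 2 + η ^ 2) := by gcongr; exact one_le_pow₀ hη
          _ = _ := by ring
      have b2 : 2 * (1 / ε ^ 2) * g x ^ 2 ≤ 2 * K5 ^ 2 * η ^ 2 / ε ^ 4 := by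
        calc _ ≤ 2 * (1 / ε ^ 2) * (K5 * η / ε) ^ 2 := by
              gcongr; exact hgbd x hx
          _ = _ := by field_simp
      have b3 : w x ≤ K7 / 5 * η ^ 2 / ε ^ 4 := by
        have : K7 / 5 * η ^ 2 / ε ^ 4 = 2 * C2 * η ^ 2 / ε ^ 4 + 2 * K5 ^ 2 * η ^ 2 / ε ^ 4 := by
          rw [hK7]; ring
        simp only [hw]; linarith
      have b4 : 2 * x ^ 2 ≤ 5 := by
        have := pow_le_pow_left₀ hx0 hx2 2
        linarith
      calc 2 * x ^ 2 * w x ≤ 2 * x ^ 2 * (K7 / 5 * η ^ 2 / ε ^ 4) := by gcongr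
        _ ≤ 5 * (K7 / 5 * η ^ 2 / ε ^ 4) := by gcongr
        _ = _ := by ring) hstrong.1 hstrong.2
  have hgx := hgpos x hx
  refine ⟨hgx, ?_, hhbd⟩
  have h3 := hric x hx
  have e1 : K7 * η ^ 2 / ε ^ 4 = (Real.sqrt K7 * η / ε ^ 2) ^ 2 := by
    rw [div_pow, mul_pow, Real.sq_sqrt hK7p.le]; ring
  rw [e1] at h3
  have h4 := abs_le_of_sq_le_sq h3 (by positivity)
  have hxh : 1 / 2 ≤ x := by linarith [hx.1]
  rw [abs_div, abs_mul, abs_of_pos hgx, abs_of_pos (by linarith : 0 < x),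
    div_le_iff₀ hgx] at h4
  have h5 : 1 / 2 * |deriv g x| ≤ x * |deriv g x| :=
    mul_le_mul_of_nonneg_right hxh (abs_nonneg _)
  calc |deriv g x| ≤ 2 * (Real.sqrt K7 * η / ε ^ 2 * g x) := by linarith
    _ = _ := by ring

/-- **Gradient estimates for `g_{η,ε}`.**
For `Ω = Ω₀ε^{-4}`, uniformly on `A_η`:
`|g_{η,ε}'(x)| ≤ C(αΩ)^{3/2} e^{-CΩ(1-x)²}` and `|g_{η,ε}'(x)| ≤ C Ω₀² η³ ε^{-2} g_{η,ε}(x)`. -/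
theorem gv_annulus_profile_gradient_estimates
    (s γ b Ω₀ : ℝ) (hs : 2 < s) (hγ0 : 0 < γ) (hγ1 : γ ≤ 1) (hb : 1 < b) (hΩ₀ : 0 < Ω₀)
    (η : ℝ → ℝ)
    (hη1 : Tendsto (fun ε => η ε / |Real.log ε|) (𝓝[>] (0 : ℝ)) atTop)
    (hη2 : Tendsto (fun ε => η ε / |Real.log ε| ^ b) (𝓝[>] (0 : ℝ)) (𝓝 0)) :
    ∃ C : ℝ, 0 < C ∧
      ∀ᶠ ε in 𝓝[>] (0 : ℝ), ∀ g : ℝ → ℝ,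
        IsGVAnnMin ε s γ (Ω₀ / ε ^ 4) (η ε) g →
        ∀ x ∈ annIcc ε (η ε),
          |deriv g x| ≤
              C * (alphaP s γ * (Ω₀ / ε ^ 4)) ^ ((3 : ℝ) / 2) *
                Real.exp (-C * (Ω₀ / ε ^ 4) * (1 - x) ^ 2) ∧
          |deriv g x| ≤ C * Ω₀ ^ 2 * (η ε) ^ 3 / ε ^ 2 * g x := by
  obtain ⟨S7, K6, hS7, hK6, hcore⟩ := gv_core s γ Ω₀ hs hγ0 hγ1 hΩ₀
  refine ⟨1 / 4, by norm_num, ?_⟩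
  set H : ℝ := 1 + 8 * S7 / Ω₀ ^ 2 with hH
  have hH1 : 1 ≤ H := by rw [hH]; have : 0 ≤ 8 * S7 / Ω₀ ^ 2 := by positivity
                         linarith
  set κ : ℝ := min (1 / 2) (min Ω₀ (Ω₀ / (8 * S7 * K6 + 1))) with hκ
  have hκ0 : 0 < κ := by
    apply lt_min (by norm_num) (lt_min hΩ₀ (by positivity))
  have hlog : Tendsto (fun ε : ℝ => |Real.log ε|) (𝓝[>] (0 : ℝ)) atTop :=
    tendsto_abs_atBot_atTop.comp tendsto_log_nhdsGT_zero
  have ev1 : ∀ᶠ ε in 𝓝[>] (0 : ℝ), H ≤ η ε := by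
    filter_upwards [hη1.eventually_ge_atTop 1, hlog.eventually_ge_atTop H] with ε h1 h2
    rw [le_div_iff₀ (by linarith)] at h1
    linarith
  have ev2 : ∀ᶠ ε in 𝓝[>] (0 : ℝ), ε * η ε ^ 2 ≤ κ := by
    have ho := (isLittleO_abs_log_rpow_rpow_nhdsGT_zero (2 * b)
      (by norm_num : (-1 : ℝ) < 0)).def hκ0
    filter_upwards [ho, ev1, hlog.eventually_ge_atTop 1,
      hη2.eventually (gt_mem_nhds (by norm_num : (0:ℝ) < 1)), self_mem_nhdsWithin]
      with ε h1 h2 h3 h4 h5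
    have hε : 0 < ε := h5
    have hL : 0 < |Real.log ε| ^ b := Real.rpow_pos_of_pos (by linarith) _
    rw [div_lt_one hL] at h4
    have h6 : η ε ^ 2 ≤ |Real.log ε| ^ (2 * b) := by
      have : |Real.log ε| ^ (2 * b) = (|Real.log ε| ^ b) ^ 2 := by
        rw [mul_comm, Real.rpow_mul (abs_nonneg _)]; norm_cast
      rw [this]
      have : 0 ≤ η ε := by linarith
      gcongr
    rw [Real.norm_of_nonneg (by positivity), Real.norm_of_nonneg (by positivity),
      Real.rpow_neg_one] at h1
    calc ε * η ε ^ 2 ≤ ε * (κ * ε⁻¹) := by gcongr; exact h6.trans h1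
      _ = κ := by field_simp
  filter_upwards [ev1, ev2, self_mem_nhdsWithin] with ε h1 h2 h5 g hg x hx
  have hε : 0 < ε := h5
  set t := η ε with ht
  have ht1 : 1 ≤ t := hH1.trans h1
  have hκ1 : κ ≤ 1 / 2 := min_le_left _ _
  have hκ2 : κ ≤ Ω₀ := (min_le_right _ _).trans (min_le_left _ _)
  have hκ3 : κ ≤ Ω₀ / (8 * S7 * K6 + 1) := (min_le_right _ _).trans (min_le_right _ _)
  have hεκ : ε ≤ κ := by
    have : ε * 1 ≤ ε * t ^ 2 := by gcongr; nlinarith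
    linarith
  have hε1 : ε ≤ 1 := by linarith
  have hε4 : ε ^ 4 ≤ ε := by
    have := pow_le_pow_of_le_one hε.le hε1 (show 1 ≤ 4 by norm_num)
    simpa using this
  have hδ : ε ^ 2 * t ≤ 1 / 2 := by
    have : ε ^ 2 * t ≤ ε * t ^ 2 := by
      have e1 : ε ^ 2 ≤ ε := by nlinarith
      have e2 : t ≤ t ^ 2 := by nlinarith
      exact mul_le_mul e1 e2 (by linarith) hε.le
    linarith
  obtain ⟨gpos, q1, q2⟩ := hcore ε t hε hε1 (by linarith) ht1 hδ g hg x hx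
  constructor
  · set Ω := Ω₀ / ε ^ 4 with hΩ
    have hΩ1 : 1 ≤ Ω := by rw [hΩ, le_div_iff₀ (by positivity)]; linarith
    have hα : 1 ≤ alphaP s γ := by
      unfold alphaP
      rw [Real.one_le_sqrt]
      nlinarith
    have hY : 1 ≤ alphaP s γ * Ω := by nlinarith
    have hY2 : Ω ≤ (alphaP s γ * Ω) ^ ((3 : ℝ) / 2) := by
      calc Ω ≤ alphaP s γ * Ω := by nlinarith
        _ = (alphaP s γ * Ω) ^ (1 : ℝ) := (Real.rpow_one _).symm
        _ ≤ _ := Real.rpow_le_rpow_of_exponent_le hY (by norm_num)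
    have hE : Real.exp (-(1 / 4) * Ω * (1 - x) ^ 2) = (exp (1 / 4 * Ω * (x - 1) ^ 2))⁻¹ := by
      rw [← Real.exp_neg]; congr 1; ring
    have hEp := exp_pos (1 / 4 * Ω * (x - 1) ^ 2)
    rw [hE]
    have q3 : g x ≤ K6 * t / ε * (exp (1 / 4 * Ω * (x - 1) ^ 2))⁻¹ := by
      rw [← div_eq_mul_inv, le_div_iff₀ hEp]; linarith
    have q4 : 2 * S7 * t / ε ^ 2 * (K6 * t / ε) ≤ 1 / 4 * Ω := by
      have hp : 0 < 8 * S7 * K6 + 1 := by positivity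
      have h6 : ε * t ^ 2 * (8 * S7 * K6 + 1) ≤ Ω₀ := by
        rw [← le_div_iff₀ hp]; linarith
      have h7 : 0 ≤ ε * t ^ 2 := by positivity
      have e : 2 * S7 * t / ε ^ 2 * (K6 * t / ε) = (1 / 4) * ((ε * t ^ 2 * (8 * S7 * K6)) / ε ^ 4) := by
        field_simp; ring
      rw [e, hΩ]
      gcongr
      nlinarith
    calc |deriv g x| ≤ 2 * S7 * t / ε ^ 2 * g x := q1
      _ ≤ 2 * S7 * t / ε ^ 2 * (K6 * t / ε * (exp (1 / 4 * Ω * (x - 1) ^ 2))⁻¹) := by gcongr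
      _ = (2 * S7 * t / ε ^ 2 * (K6 * t / ε)) * (exp (1 / 4 * Ω * (x - 1) ^ 2))⁻¹ := by ring
      _ ≤ (1 / 4 * Ω) * (exp (1 / 4 * Ω * (x - 1) ^ 2))⁻¹ := by gcongr
      _ ≤ _ := by gcongr
  · refine q1.trans (mul_le_mul_of_nonneg_right ?_ gpos.le)
    apply div_le_div_of_nonneg_right _ (by positivity)
    have h6 : 8 * S7 ≤ Ω₀ ^ 2 * t := by
      have : 8 * S7 / Ω₀ ^ 2 ≤ t := by linarith
      rw [div_le_iff₀ (by positivity)] at this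
      linarith
    have h7 : Ω₀ ^ 2 * t ≤ Ω₀ ^ 2 * t ^ 2 := by gcongr; nlinarith
    calc 2 * S7 * t = 1 / 4 * (8 * S7) * t := by ring
      _ ≤ 1 / 4 * (Ω₀ ^ 2 * t ^ 2) * t :=
          mul_le_mul_of_nonneg_right (by linarith) (by linarith)
      _ = _ := by ring
end
end

section
/- Let Ω = Ω₀ ε^{-4} with Ω₀ > 0 large enough. Then |g_{η,ε}(x) − g_sym(x)| ≤ C Ω^{-1/4} uniformly for 𝐱 ∈ A_η, where g_sym is the symmetric comparison profile. -/
open MeasureTheory Filter Topology Set Real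

noncomputable section

/-- The symmetric comparison functional
`E^sym[f] = 2π ∫ (1/2)(f')² + (1/2)α²Ω²(1-x)²f² + ε⁻²f⁴`. -/
def symEnergy (ε α Ω η : ℝ) (f : ℝ → ℝ) : ℝ :=
  2 * π * ∫ x in annIcc ε η,
    ((1 / 2) * (deriv f x) ^ 2 + (1 / 2) * α ^ 2 * Ω ^ 2 * (1 - x) ^ 2 * (f x) ^ 2 +
      (1 / ε ^ 2) * (f x) ^ 4)

/-- Domain of the symmetric comparison functional. -/
def symDomain (ε η : ℝ) : Set (ℝ → ℝ) :=
  {f | ContDiff ℝ 1 f ∧ 2 * π * (∫ x in annIcc ε η, (f x) ^ 2) = 1}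

/-- `g` is the positive minimizer of the symmetric comparison functional. -/
def IsSymMin (ε α Ω η : ℝ) (g : ℝ → ℝ) : Prop :=
  g ∈ symDomain ε η ∧ (∀ x ∈ annIcc ε η, 0 < g x) ∧
    ∀ f ∈ symDomain ε η, symEnergy ε α Ω η g ≤ symEnergy ε α Ω η f


lemma ii_mono {L : ℝ} (hL : 0 ≤ L) {f g : ℝ → ℝ} (hf : Continuous f) (hg : Continuous g)
    (h : ∀ y ∈ Icc (-L) L, f y ≤ g y) : ∫ y in (-L)..L, f y ≤ ∫ y in (-L)..L, g y :=
  intervalIntegral.integral_mono_on (by linarith) (hf.intervalIntegrable _ _)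
    (hg.intervalIntegrable _ _) h

lemma ii_add {L : ℝ} {f g : ℝ → ℝ} (hf : Continuous f) (hg : Continuous g) :
    ∫ y in (-L)..L, (f y + g y) = (∫ y in (-L)..L, f y) + ∫ y in (-L)..L, g y :=
  intervalIntegral.integral_add (hf.intervalIntegrable _ _) (hg.intervalIntegrable _ _)

lemma ii_sub {L : ℝ} {f g : ℝ → ℝ} (hf : Continuous f) (hg : Continuous g) :
    ∫ y in (-L)..L, (f y - g y) = (∫ y in (-L)..L, f y) - ∫ y in (-L)..L, g y :=
  intervalIntegral.integral_sub (hf.intervalIntegrable _ _) (hg.intervalIntegrable _ _)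

lemma ii_mul {L c : ℝ} {f : ℝ → ℝ} :
    ∫ y in (-L)..L, c * f y = c * ∫ y in (-L)..L, f y :=
  intervalIntegral.integral_const_mul _ _

/-- weak Euler-Lagrange equation -/
noncomputable def WEL (L : ℝ) (w V : ℝ → ℝ) (lam : ℝ) (F F' : ℝ → ℝ) : Prop :=
  ∀ φ φ' : ℝ → ℝ, (∀ y, HasDerivAt φ (φ' y) y) → Continuous φ' →
    ∫ y in (-L)..L, w y * (F' y * φ' y + 2 * V y * F y * φ y + 4 * F y ^ 3 * φ y
      - lam * F y * φ y) = 0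

/-- scaled energy -/
noncomputable def ScE (L : ℝ) (w V : ℝ → ℝ) (F F' : ℝ → ℝ) : ℝ :=
  ∫ y in (-L)..L, w y * ((1/2) * F' y ^ 2 + V y * F y ^ 2 + F y ^ 4)

/-- scaled minimizer -/
structure ScMin (L : ℝ) (w V : ℝ → ℝ) (N : ℝ) (F F' : ℝ → ℝ) : Prop where
  hd : ∀ y, HasDerivAt F (F' y) y
  hc : Continuous F'
  pos : ∀ y, 0 < F y
  mass : ∫ y in (-L)..L, w y * F y ^ 2 = N
  min : ∀ f f' : ℝ → ℝ, (∀ y, HasDerivAt f (f' y) y) → Continuous f' →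
    ∫ y in (-L)..L, w y * f y ^ 2 = N → ScE L w V F F' ≤ ScE L w V f f'

lemma cont_of_hd {F F' : ℝ → ℝ} (h : ∀ y, HasDerivAt F (F' y) y) : Continuous F :=
  continuous_iff_continuousAt.2 fun y => (h y).continuousAt

lemma homog_ineq {L N : ℝ} {w V F F' : ℝ → ℝ} (hL : 0 ≤ L) (hN : 0 < N) (hw : Continuous w)
    (hV : Continuous V) (hw0 : ∀ y ∈ Icc (-L) L, 0 ≤ w y) (h : ScMin L w V N F F')
    (f f' : ℝ → ℝ) (hf : ∀ y, HasDerivAt f (f' y) y) (hf' : Continuous f') (n A B : ℝ)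
    (hn : ∫ y in (-L)..L, w y * f y ^ 2 = n)
    (hA : ∫ y in (-L)..L, w y * ((1/2) * f' y ^ 2 + V y * f y ^ 2) = A)
    (hB : ∫ y in (-L)..L, w y * f y ^ 4 = B) :
    ScE L w V F F' * n ^ 2 ≤ N * A * n + N ^ 2 * B := by
  have hfc := cont_of_hd hf
  have hB0 : 0 ≤ B := by
    rw [← hB]
    apply intervalIntegral.integral_nonneg (by linarith)
    intro y hy
    have := hw0 y hy
    positivity
  have hn0 : 0 ≤ n := by
    rw [← hn]
    apply intervalIntegral.integral_nonneg (by linarith)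
    intro y hy
    have := hw0 y hy
    positivity
  rcases hn0.eq_or_lt with h0 | h0
  · rw [← h0]; simp; positivity
  set c := Real.sqrt (N / n) with hc
  have hc2 : c ^ 2 = N / n := Real.sq_sqrt (by positivity)
  have h1 : ∫ y in (-L)..L, w y * (c * f y) ^ 2 = N := by
    have : ∀ y, w y * (c * f y) ^ 2 = c ^ 2 * (w y * f y ^ 2) := fun y => by ring
    simp only [this]
    rw [ii_mul, hn, hc2]; field_simp
  have h2 := h.min (fun y => c * f y) (fun y => c * f' y) (fun y => (hf y).const_mul c)
    (by fun_prop) h1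
  have h3 : ScE L w V (fun y => c * f y) (fun y => c * f' y) = c ^ 2 * A + c ^ 4 * B := by
    unfold ScE
    rw [← hA, ← hB, ← ii_mul, ← ii_mul, ← ii_add (by fun_prop) (by fun_prop)]
    congr 1; ext y; ring
  rw [h3] at h2
  have h4 : c ^ 4 = (N / n) ^ 2 := by rw [← hc2]; ring
  rw [h4, hc2] at h2
  calc ScE L w V F F' * n ^ 2 ≤ (N / n * A + (N / n) ^ 2 * B) * n ^ 2 := by gcongr
    _ = _ := by field_simp

/-- multiplier -/
noncomputable def ScLam (L : ℝ) (w V : ℝ → ℝ) (N : ℝ) (F F' : ℝ → ℝ) : ℝ :=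
  (∫ y in (-L)..L, w y * (F' y ^ 2 + 2 * V y * F y ^ 2 + 4 * F y ^ 4)) / N

lemma wel_of_min {L N : ℝ} {w V F F' : ℝ → ℝ} (hL : 0 ≤ L) (hN : 0 < N) (hw : Continuous w)
    (hV : Continuous V) (hw0 : ∀ y ∈ Icc (-L) L, 0 ≤ w y) (h : ScMin L w V N F F') :
    WEL L w V (ScLam L w V N F F') F F' := by
  intro φ φ' hφ hφ'
  have hFc := cont_of_hd h.hd
  have hφc := cont_of_hd hφ
  have hF'c := h.hc
  set n1 := ∫ y in (-L)..L, w y * (F y * φ y) with hn1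
  set n2 := ∫ y in (-L)..L, w y * (φ y ^ 2) with hn2
  set A0 := ∫ y in (-L)..L, w y * ((1/2) * F' y ^ 2 + V y * F y ^ 2) with hA0
  set A1 := ∫ y in (-L)..L, w y * (F' y * φ' y + 2 * V y * F y * φ y) with hA1
  set A2 := ∫ y in (-L)..L, w y * ((1/2) * φ' y ^ 2 + V y * φ y ^ 2) with hA2
  set B0 := ∫ y in (-L)..L, w y * (F y ^ 4) with hB0
  set B1 := ∫ y in (-L)..L, w y * (F y ^ 3 * φ y) with hB1
  set B2 := ∫ y in (-L)..L, w y * (F y ^ 2 * φ y ^ 2) with hB2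
  set B3 := ∫ y in (-L)..L, w y * (F y * φ y ^ 3) with hB3
  set B4 := ∫ y in (-L)..L, w y * (φ y ^ 4) with hB4
  have hE : ScE L w V F F' = A0 + B0 := by
    unfold ScE
    rw [hA0, hB0, ← ii_add (by fun_prop) (by fun_prop)]
    congr 1; ext y; ring
  have hlam : ScLam L w V N F F' = (2 * A0 + 4 * B0) / N := by
    unfold ScLam
    rw [hA0, hB0, ← ii_mul, ← ii_mul, ← ii_add (by fun_prop) (by fun_prop)]
    congr 2; ext y; ring
  have key : ∀ t : ℝ, (A0 + B0) * (N + 2 * t * n1 + t ^ 2 * n2) ^ 2 ≤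
      N * (A0 + t * A1 + t ^ 2 * A2) * (N + 2 * t * n1 + t ^ 2 * n2) +
      N ^ 2 * (B0 + (4 * t) * B1 + (6 * t ^ 2) * B2 + (4 * t ^ 3) * B3 + t ^ 4 * B4) := by
    intro t
    rw [← hE]
    apply homog_ineq hL hN hw hV hw0 h (fun y => F y + t * φ y) (fun y => F' y + t * φ' y)
      (fun y => (h.hd y).add ((hφ y).const_mul t)) (by fun_prop)
    · rw [← h.mass, hn1, hn2, ← ii_mul, ← ii_mul, ← ii_add (by fun_prop) (by fun_prop),
        ← ii_add (by fun_prop) (by fun_prop)]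
      congr 1; ext y; ring
    · rw [hA0, hA1, hA2, ← ii_mul, ← ii_mul, ← ii_add (by fun_prop) (by fun_prop),
        ← ii_add (by fun_prop) (by fun_prop)]
      congr 1; ext y; ring
    · rw [hB0, hB1, hB2, hB3, hB4, ← ii_mul, ← ii_mul, ← ii_mul, ← ii_mul,
        ← ii_add (by fun_prop) (by fun_prop), ← ii_add (by fun_prop) (by fun_prop),
        ← ii_add (by fun_prop) (by fun_prop), ← ii_add (by fun_prop) (by fun_prop)]
      congr 1; ext y; ring
  have hid := fun x : ℝ => hasDerivAt_id x
  have hder : HasDerivAt (fun t : ℝ => N * (A0 + t * A1 + t ^ 2 * A2) *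
      (N + 2 * t * n1 + t ^ 2 * n2) +
      N ^ 2 * (B0 + (4 * t) * B1 + (6 * t ^ 2) * B2 + (4 * t ^ 3) * B3 + t ^ 4 * B4)
      - (A0 + B0) * (N + 2 * t * n1 + t ^ 2 * n2) ^ 2)
      (N * A1 * N + N * A0 * (2 * n1) + N ^ 2 * (4 * B1) - (A0 + B0) * (2 * N * (2 * n1))) 0 := by
    have e1 : HasDerivAt (fun t : ℝ => N + 2 * t * n1 + t ^ 2 * n2) (2 * n1) 0 := by
      have := ((((hasDerivAt_id (0:ℝ)).const_mul 2).mul_const n1).const_add N).add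
        (((hasDerivAt_id (0:ℝ)).pow 2).mul_const n2)
      refine HasDerivAt.congr_deriv (f := _) this ?_; simp
    have e2 : HasDerivAt (fun t : ℝ => N * (A0 + t * A1 + t ^ 2 * A2)) (N * A1) 0 := by
      have := ((((hasDerivAt_id (0:ℝ)).mul_const A1).const_add A0).add
        (((hasDerivAt_id (0:ℝ)).pow 2).mul_const A2)).const_mul N
      refine HasDerivAt.congr_deriv (f := _) this ?_; simp
    have e3 : HasDerivAt (fun t : ℝ => N ^ 2 * (B0 + (4 * t) * B1 + (6 * t ^ 2) * B2
        + (4 * t ^ 3) * B3 + t ^ 4 * B4)) (N ^ 2 * (4 * B1)) 0 := by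
      have := ((((((((hasDerivAt_id (0:ℝ)).const_mul 4).mul_const B1).const_add B0).add
        ((((hasDerivAt_id (0:ℝ)).pow 2).const_mul 6).mul_const B2))).add
        ((((hasDerivAt_id (0:ℝ)).pow 3).const_mul 4).mul_const B3)).add
        (((hasDerivAt_id (0:ℝ)).pow 4).mul_const B4)).const_mul (N ^ 2)
      refine HasDerivAt.congr_deriv (f := _) this ?_; simp
    have := ((e2.mul e1).add e3).sub ((e1.pow 2).const_mul (A0 + B0))
    refine HasDerivAt.congr_deriv (f := _) this ?_; simp
  have hmin : IsLocalMin (fun t : ℝ => N * (A0 + t * A1 + t ^ 2 * A2) *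
      (N + 2 * t * n1 + t ^ 2 * n2) +
      N ^ 2 * (B0 + (4 * t) * B1 + (6 * t ^ 2) * B2 + (4 * t ^ 3) * B3 + t ^ 4 * B4)
      - (A0 + B0) * (N + 2 * t * n1 + t ^ 2 * n2) ^ 2) 0 := by
    apply Filter.Eventually.of_forall
    intro t
    have := key t
    dsimp only
    ring_nf at this ⊢
    linarith
  have h0 := hmin.hasDerivAt_eq_zero hder
  have hfin : A1 + 4 * B1 - ScLam L w V N F F' * n1 = 0 := by
    rw [hlam]
    field_simp
    have : N * (N * (A1 + 4 * B1) - (2 * A0 + 4 * B0) * n1) = 0 := by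
      linear_combination h0
    rcases mul_eq_zero.1 this with h' | h'
    · exact absurd h' hN.ne'
    · linarith
  rw [← hfin, hA1, hB1, hn1, ← ii_mul, ← ii_mul, ← ii_add (by fun_prop) (by fun_prop),
        ← ii_sub (by fun_prop) (by fun_prop)]
  congr 1; ext y; ring


lemma gauss_int : Integrable (fun y : ℝ => Real.exp (-y ^ 2)) := by
  have := integrable_exp_neg_mul_sq (b := 1) one_pos
  simpa using this

lemma gauss_le {L : ℝ} (hL : 0 ≤ L) : ∫ y in (-L)..L, Real.exp (-y ^ 2) ≤ 2 := by
  rw [intervalIntegral.integral_of_le (by linarith)]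
  have h1 : ∫ y in Ioc (-L) L, Real.exp (-y ^ 2) ≤ ∫ y : ℝ, Real.exp (-y ^ 2) :=
    setIntegral_le_integral gauss_int (Eventually.of_forall fun y => (Real.exp_pos _).le)
  have h2 : ∫ y : ℝ, Real.exp (-y ^ 2) = Real.sqrt π := by
    have := integral_gaussian 1
    simpa using this
  have h3 : Real.sqrt π ≤ 2 := by
    rw [Real.sqrt_le_left (by norm_num)]
    have := Real.pi_le_four
    linarith
  linarith

lemma one_add_sq_mul_exp (y : ℝ) : (1 + y ^ 2) * Real.exp (-2 * y ^ 2) ≤ Real.exp (-y ^ 2) := by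
  have h : Real.exp (-2 * y ^ 2) = Real.exp (-y ^ 2) * Real.exp (-y ^ 2) := by
    rw [← Real.exp_add]; congr 1; ring
  have h1 : (1 + y ^ 2) * Real.exp (-y ^ 2) ≤ 1 := by
    rw [Real.exp_neg, ← div_eq_mul_inv, div_le_one (Real.exp_pos _)]
    linarith [Real.add_one_le_exp (y ^ 2)]
  rw [h, ← mul_assoc]
  have := Real.exp_pos (-y ^ 2)
  nlinarith

/-- uniform bounds for weight and potential -/
structure Bd (L a K : ℝ) (w V : ℝ → ℝ) : Prop where
  hL : 1 ≤ L
  hw : Continuous w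
  hV : Continuous V
  w1 : ∀ y ∈ Icc (-L) L, 1/2 ≤ w y
  w2 : ∀ y ∈ Icc (-L) L, w y ≤ 3/2
  V1 : ∀ y ∈ Icc (-L) L, a * y ^ 2 - 1 ≤ V y
  V2 : ∀ y ∈ Icc (-L) L, V y ≤ K * (1 + y ^ 2)

lemma energy_le {a K N : ℝ} (hK : 0 < K) (hN : 0 < N) : ∃ M : ℝ, 0 < M ∧
    ∀ (L : ℝ) (w V F F' : ℝ → ℝ), Bd L a K w V → ScMin L w V N F F' → ScE L w V F F' ≤ M := by
  refine ⟨(N * (3 * (2 + K)) * 3 + N ^ 2 * 3) / (Real.exp (-2)) ^ 2, by positivity, ?_⟩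
  intro L w V F F' hb h
  have hL := hb.hL
  have hw := hb.hw
  have hV := hb.hV
  have hw0 : ∀ y ∈ Icc (-L) L, 0 ≤ w y := fun y hy => by linarith [hb.w1 y hy]
  by_cases hE : ScE L w V F F' ≤ 0
  · exact hE.trans (by positivity)
  push Not at hE
  have hd : ∀ y : ℝ, HasDerivAt (fun y : ℝ => Real.exp (-y ^ 2))
      (Real.exp (-y ^ 2) * (-(2 * y))) y := by
    intro y
    have := ((hasDerivAt_id y).pow 2).neg.exp
    refine HasDerivAt.congr_deriv (f := _) this ?_; simp
  have key := homog_ineq (by linarith) hN hw hV hw0 h _ _ hd (by fun_prop) _ _ _ rfl rfl rfl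
  set n := ∫ y in (-L)..L, w y * Real.exp (-y ^ 2) ^ 2 with hn
  set A := ∫ y in (-L)..L, w y * ((1/2) * (Real.exp (-y ^ 2) * (-(2 * y))) ^ 2
    + V y * Real.exp (-y ^ 2) ^ 2) with hA
  set B := ∫ y in (-L)..L, w y * Real.exp (-y ^ 2) ^ 4 with hB
  have hsq : ∀ y : ℝ, Real.exp (-y ^ 2) ^ 2 = Real.exp (-2 * y ^ 2) := by
    intro y; rw [← Real.exp_nat_mul]; congr 1; push_cast; ring
  have hle1 : ∀ y : ℝ, Real.exp (-y ^ 2) ≤ 1 := fun y => by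
    rw [Real.exp_le_one_iff]; nlinarith [sq_nonneg y]
  have g2 := gauss_le (L := L) (by linarith)
  have hn3 : n ≤ 3 := by
    have : n ≤ ∫ y in (-L)..L, (3/2) * Real.exp (-y ^ 2) := by
      apply ii_mono (by linarith) (by fun_prop) (by fun_prop)
      intro y hy
      have h1 := hb.w2 y hy
      have h2 := hw0 y hy
      have h3 := hle1 y
      have h4 := Real.exp_pos (-y ^ 2)
      have h5 : Real.exp (-y ^ 2) ^ 2 ≤ Real.exp (-y ^ 2) := by nlinarith
      gcongr
    rw [ii_mul] at this
    linarith
  have hB3 : B ≤ 3 := by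
    have : B ≤ ∫ y in (-L)..L, (3/2) * Real.exp (-y ^ 2) := by
      apply ii_mono (by linarith) (by fun_prop) (by fun_prop)
      intro y hy
      have h1 := hb.w2 y hy
      have h2 := hw0 y hy
      have h3 := hle1 y
      have h4 := Real.exp_pos (-y ^ 2)
      have h5 : Real.exp (-y ^ 2) ^ 4 ≤ Real.exp (-y ^ 2) :=
        pow_le_of_le_one h4.le h3 (by norm_num)
      gcongr
    rw [ii_mul] at this
    linarith
  have hA3 : A ≤ 3 * (2 + K) := by
    have : A ≤ ∫ y in (-L)..L, (3/2 * (2 + K)) * Real.exp (-y ^ 2) := by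
      apply ii_mono (by linarith) (by fun_prop) (by fun_prop)
      intro y hy
      have h1 := hb.w2 y hy
      have h2 := hw0 y hy
      have h4 := Real.exp_pos (-2 * y ^ 2)
      have h6 := one_add_sq_mul_exp y
      have h7 := hb.V2 y hy
      rw [mul_pow, hsq, mul_assoc]
      have h8 : 1 / 2 * (Real.exp (-2 * y ^ 2) * (-(2 * y)) ^ 2) + V y * Real.exp (-2 * y ^ 2)
        ≤ (2 + K) * Real.exp (-y ^ 2) := by
        calc _ ≤ 1 / 2 * (Real.exp (-2 * y ^ 2) * (-(2 * y)) ^ 2)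
              + (K * (1 + y ^ 2)) * Real.exp (-2 * y ^ 2) := by gcongr
          _ ≤ (2 + K) * ((1 + y ^ 2) * Real.exp (-2 * y ^ 2)) := by nlinarith
          _ ≤ _ := by gcongr
      calc _ ≤ w y * ((2 + K) * Real.exp (-y ^ 2)) := by gcongr
        _ ≤ 3/2 * ((2 + K) * Real.exp (-y ^ 2)) := by gcongr
    rw [ii_mul] at this
    nlinarith
  have hn1 : Real.exp (-2) ≤ n := by
    have h1 : ∫ y in (-1:ℝ)..1, (1/2) * Real.exp (-2) ≤ ∫ y in (-1:ℝ)..1, w y * Real.exp (-y ^ 2) ^ 2 := by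
      apply ii_mono (by linarith) (by fun_prop) (by fun_prop)
      intro y hy
      have h1 := hb.w1 y ⟨by linarith [hy.1], by linarith [hy.2]⟩
      rw [hsq]
      have : y ^ 2 ≤ 1 := by nlinarith [hy.1, hy.2]
      gcongr
      linarith
    have h2 : ∫ y in (-1:ℝ)..1, w y * Real.exp (-y ^ 2) ^ 2 ≤ n := by
      apply intervalIntegral.integral_mono_interval (by linarith) (by linarith) (by linarith)
      · filter_upwards [ae_restrict_mem measurableSet_Ioc] with y hy
        have := hw0 y ⟨hy.1.le, hy.2⟩
        simp only [Pi.zero_apply]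
        positivity
      · exact (by fun_prop : Continuous fun y => w y * Real.exp (-y ^ 2) ^ 2).intervalIntegrable _ _
    simp at h1
    linarith
  have hep := Real.exp_pos (-2)
  rw [le_div_iff₀ (by positivity)]
  calc _ ≤ ScE L w V F F' * n ^ 2 := by gcongr
    _ ≤ N * A * n + N ^ 2 * B := key
    _ ≤ N * (3 * (2 + K)) * n + N ^ 2 * B := by gcongr; linarith
    _ ≤ _ := by gcongr

/-- uniform bounds for minimizers -/
structure FBd (L M : ℝ) (w V : ℝ → ℝ) (N : ℝ) (F F' : ℝ → ℝ) : Prop where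
  lam : ScLam L w V N F F' ≤ M
  f0 : ∫ y in (-L)..L, F y ^ 2 ≤ M
  f1 : ∫ y in (-L)..L, F' y ^ 2 ≤ M
  f2 : ∫ y in (-L)..L, y ^ 2 * F y ^ 2 ≤ M
  f4 : ∫ y in (-L)..L, y ^ 4 * F y ^ 2 ≤ M

lemma fbd {a K N : ℝ} (ha : 0 < a) (hK : 0 < K) (hN : 0 < N) : ∃ M : ℝ, 0 < M ∧
    ∀ (L : ℝ) (w V F F' : ℝ → ℝ), Bd L a K w V → ScMin L w V N F F' → FBd L M w V N F F' := by
  obtain ⟨E, hE0, hE⟩ := energy_le (a := a) hK hN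
  set M1 := (4 * E + 2 * N) / N with hM1
  set M2 := 2 * (E + N) / a with hM2
  set M4 := (3/2 * (2 + M1) * M2 + N) / a with hM4
  have hM1p : 0 < M1 := by positivity
  have hM2p : 0 < M2 := by positivity
  have hM4p : 0 < M4 := by positivity
  refine ⟨M1 + 2 * N + 4 * (E + N) + M2 + M4, by positivity, ?_⟩
  intro L w V F F' hb h
  have hw0 : ∀ y ∈ Icc (-L) L, 0 ≤ w y := fun y hy => by linarith [hb.w1 y hy]
  have hL := hb.hL
  have hw := hb.hw
  have hV := hb.hV
  have hFc := cont_of_hd h.hd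
  have hF'c := h.hc
  have hEF := hE L w V F F' hb h
  have hlam : ScLam L w V N F F' ≤ M1 := by
    unfold ScLam
    rw [hM1]
    gcongr
    have : ∫ y in (-L)..L, w y * (F' y ^ 2 + 2 * V y * F y ^ 2 + 4 * F y ^ 4) ≤
       ∫ y in (-L)..L, (4 * (w y * ((1/2) * F' y ^ 2 + V y * F y ^ 2 + F y ^ 4))
        + 2 * (w y * F y ^ 2)) := by
      apply ii_mono (by linarith) (by fun_prop) (by fun_prop)
      intro y hy
      have h1 := hw0 y hy
      have h2 := hb.V1 y hy
      have h3 : 0 ≤ V y + 1 := by nlinarith [mul_nonneg ha.le (sq_nonneg y)]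
      have h4 := mul_nonneg h1 (sq_nonneg (F' y))
      have h5 := mul_nonneg h1 (mul_nonneg h3 (sq_nonneg (F y)))
      nlinarith
    rw [ii_add (by fun_prop) (by fun_prop), ii_mul, ii_mul, h.mass] at this
    unfold ScE at hEF
    linarith
  have hf0 : ∫ y in (-L)..L, F y ^ 2 ≤ 2 * N := by
    have : ∫ y in (-L)..L, F y ^ 2 ≤ ∫ y in (-L)..L, 2 * (w y * F y ^ 2) := by
      apply ii_mono (by linarith) (by fun_prop) (by fun_prop)
      intro y hy
      have h1 := hb.w1 y hy
      nlinarith [sq_nonneg (F y)]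
    rw [ii_mul, h.mass] at this
    exact this
  have hlow : ∫ y in (-L)..L, ((1/4) * F' y ^ 2 + (a/2) * (y ^ 2 * F y ^ 2)) ≤ E + N := by
    have : ∫ y in (-L)..L, ((1/4) * F' y ^ 2 + (a/2) * (y ^ 2 * F y ^ 2)) ≤
       ∫ y in (-L)..L, ((w y * ((1/2) * F' y ^ 2 + V y * F y ^ 2 + F y ^ 4))
        + (w y * F y ^ 2)) := by
      apply ii_mono (by linarith) (by fun_prop) (by fun_prop)
      intro y hy
      have h1 := hb.w1 y hy
      have h2 := hb.V1 y hy
      have h4 : (1/2) * F' y ^ 2 ≤ w y * F' y ^ 2 := by gcongr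
      have h5 : (1/2) * (a * y ^ 2 * F y ^ 2) ≤ w y * ((V y + 1) * F y ^ 2) := by
        have : 0 ≤ a * y ^ 2 * F y ^ 2 := by positivity
        calc _ ≤ w y * (a * y ^ 2 * F y ^ 2) := by gcongr
          _ ≤ _ := by
            have : a * y ^ 2 ≤ V y + 1 := by linarith
            have := hw0 y hy
            gcongr
      have h6 : 0 ≤ w y * F y ^ 4 := by have := hw0 y hy; positivity
      linarith
    rw [ii_add (f := fun y => w y * ((1/2) * F' y ^ 2 + V y * F y ^ 2 + F y ^ 4))
      (by fun_prop) (by fun_prop), h.mass] at this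
    unfold ScE at hEF
    linarith
  rw [ii_add (by fun_prop) (by fun_prop), ii_mul, ii_mul] at hlow
  have p1 : 0 ≤ ∫ y in (-L)..L, F' y ^ 2 :=
    intervalIntegral.integral_nonneg (by linarith) fun y _ => by positivity
  have p2 : 0 ≤ ∫ y in (-L)..L, y ^ 2 * F y ^ 2 :=
    intervalIntegral.integral_nonneg (by linarith) fun y _ => by positivity
  have hf1 : ∫ y in (-L)..L, F' y ^ 2 ≤ 4 * (E + N) := by nlinarith
  have hf2 : ∫ y in (-L)..L, y ^ 2 * F y ^ 2 ≤ M2 := by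
    rw [hM2, le_div_iff₀ ha]; nlinarith
  have hf4 : ∫ y in (-L)..L, y ^ 4 * F y ^ 2 ≤ M4 := by
    have hel := wel_of_min (by linarith) hN hw hV hw0 h (fun y => y ^ 2 * F y)
      (fun y => 2 * y * F y + y ^ 2 * F' y) (fun y => by
        refine HasDerivAt.congr_deriv (f := _) (((hasDerivAt_id y).pow 2).mul (h.hd y)) ?_
        simp) (by fun_prop)
    set lam := ScLam L w V N F F'
    have : ∫ y in (-L)..L, a * (y ^ 4 * F y ^ 2) ≤ ∫ y in (-L)..L,
       ((w y * (F' y * (2 * y * F y + y ^ 2 * F' y) + 2 * V y * F y * (y ^ 2 * F y)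
        + 4 * F y ^ 3 * (y ^ 2 * F y) - lam * F y * (y ^ 2 * F y)))
        + ((3/2 * (2 + M1)) * (y ^ 2 * F y ^ 2) + w y * F y ^ 2)) := by
      apply ii_mono (by linarith) (by fun_prop) (by fun_prop)
      intro y hy
      have h1 := hb.w1 y hy
      have h2 := hb.V1 y hy
      have h0 := hw0 y hy
      have h3 := hb.w2 y hy
      have h4 : 0 ≤ w y * (y * F' y + F y) ^ 2 := by positivity
      have h5 : (1/2) * (2 * a * y ^ 4 * F y ^ 2) ≤ w y * (2 * a * y ^ 4 * F y ^ 2) := by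
        gcongr
      have h6 : w y * (y ^ 2 * F y ^ 2 * (2 * (a * y ^ 2 - 1))) ≤
        w y * (y ^ 2 * F y ^ 2 * (2 * V y)) := by gcongr
      have h7 : w y * (y ^ 2 * F y ^ 2 * (2 + lam)) ≤ 3 / 2 * (y ^ 2 * F y ^ 2 * (2 + M1)) := by
        calc _ ≤ w y * (y ^ 2 * F y ^ 2 * (2 + M1)) := by gcongr
          _ ≤ _ := by gcongr
      have h8 : 0 ≤ w y * (4 * F y ^ 4 * y ^ 2) := by positivity
      nlinarith
    rw [ii_mul, ii_add (by fun_prop) (by fun_prop), hel, ii_add (by fun_prop) (by fun_prop),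
      h.mass, ii_mul] at this
    rw [hM4, le_div_iff₀ ha]
    have : 3/2 * (2 + M1) * (∫ y in (-L)..L, y ^ 2 * F y ^ 2) ≤ 3/2 * (2 + M1) * M2 := by gcongr
    linarith
  refine ⟨?_, ?_, ?_, ?_, ?_⟩ <;> linarith


lemma lower_bd {a K N M : ℝ} (hK : 0 < K) (hN : 0 < N) (hM : 0 < M) (R : ℝ) (hR : 0 < R) :
    ∃ c : ℝ, 0 < c ∧
    ∀ (L : ℝ) (V S S' : ℝ → ℝ), Bd L a K (fun _ => 1) V → (∀ y, 0 ≤ V y) →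
      ScMin L (fun _ => 1) V N S S' → FBd L M (fun _ => 1) V N S S' →
      ∀ y ∈ Icc (-L) L, |y| ≤ R → c ≤ S y := by
  set R2 := R + Real.sqrt (2 * M / N) + 1 with hR2
  have hs0 := Real.sqrt_nonneg (2 * M / N)
  have hR2p : 0 < R2 := by positivity
  have hR2M : M / R2 ^ 2 ≤ N / 2 := by
    have h1 : Real.sqrt (2 * M / N) ^ 2 = 2 * M / N := Real.sq_sqrt (by positivity)
    have h2 : 2 * M / N ≤ R2 ^ 2 := by rw [← h1]; gcongr; linarith
    rw [div_le_iff₀ hN] at h2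
    rw [div_le_iff₀ (by positivity)]
    linarith
  set c2 := N / (8 * Real.exp (R2 ^ 2)) with hc2
  have hc2p : 0 < c2 := by positivity
  set Q := 2 * ((8 + 2 * K) * 2 + 4 * M) with hQ
  set O := R2 + 1 / 2 * Real.exp (2 * R2 ^ 2) * Q with hO
  refine ⟨Real.sqrt c2 * Real.exp (-O), by positivity, ?_⟩
  intro L V S S' hb hV0 h hf x hx hxR
  have hL := hb.hL
  have hV := hb.hV
  have hSc := cont_of_hd h.hd
  have hS'c := h.hc
  -- a point with large value
  have hpt : ∃ y0 ∈ Icc (-L) L, |y0| ≤ R2 ∧ c2 ≤ S y0 ^ 2 := by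
    by_contra! hcon
    have h1 : ∫ y in (-L)..L, 1 * S y ^ 2 ≤ ∫ y in (-L)..L,
        ((c2 * Real.exp (R2 ^ 2)) * Real.exp (-y ^ 2) + (1 / R2 ^ 2) * (y ^ 2 * S y ^ 2)) := by
      apply ii_mono (by linarith) (by fun_prop) (by fun_prop)
      intro y hy
      by_cases hyR : |y| ≤ R2
      · have h2 := (hcon y hy hyR).le
        have h3 : 1 ≤ Real.exp (R2 ^ 2) * Real.exp (-y ^ 2) := by
          rw [← Real.exp_add, Real.one_le_exp_iff]
          have := sq_le_sq' (by linarith [neg_abs_le y]) ((le_abs_self y).trans hyR)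
          linarith
        have h4 : 0 ≤ (1 / R2 ^ 2) * (y ^ 2 * S y ^ 2) := by positivity
        nlinarith
      · push Not at hyR
        have h3 : R2 ^ 2 ≤ y ^ 2 := by rw [← sq_abs y]; gcongr
        have h4 : 0 ≤ c2 * Real.exp (R2 ^ 2) * Real.exp (-y ^ 2) := by positivity
        have h5 : 1 * S y ^ 2 ≤ (1 / R2 ^ 2) * (y ^ 2 * S y ^ 2) := by
          rw [← mul_assoc]
          gcongr
          rw [one_div, inv_mul_eq_div, le_div_iff₀ (by positivity)]
          linarith
        linarith
    rw [h.mass, ii_add (by fun_prop) (by fun_prop), ii_mul, ii_mul] at h1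
    have h2 := gauss_le (L := L) (by linarith)
    have h3 : c2 * Real.exp (R2 ^ 2) = N / 8 := by
      rw [hc2]; field_simp
    rw [h3] at h1
    have h4 : (1 / R2 ^ 2) * (∫ y in (-L)..L, y ^ 2 * S y ^ 2) ≤ M / R2 ^ 2 := by
      rw [one_div, inv_mul_eq_div]; gcongr; exact hf.f2
    nlinarith
  -- log derivative bound
  set P : ℝ → ℝ := fun y => (S y)⁻¹ with hP
  have hSP : ∀ y, S y * P y = 1 := fun y => mul_inv_cancel₀ (h.pos y).ne'
  have hPd : ∀ y, HasDerivAt P (-S' y * P y ^ 2) y := fun y => by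
    refine HasDerivAt.congr_deriv (f := _) ((h.hd y).inv (h.pos y).ne') ?_
    simp [hP, div_eq_mul_inv]
  have hPc := cont_of_hd hPd
  have hlam0 : 0 ≤ ScLam L (fun _ => 1) V N S S' := by
    unfold ScLam
    apply div_nonneg _ hN.le
    apply intervalIntegral.integral_nonneg (by linarith)
    intro y _
    have := hV0 y
    positivity
  have hq : ∫ y in (-L)..L, Real.exp (-2 * y ^ 2) * (S' y * P y) ^ 2 ≤ Q := by
    have hel := wel_of_min (by linarith) hN hb.hw hV (fun y _ => by norm_num) h
      (fun y => Real.exp (-2 * y ^ 2) * P y)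
      (fun y => Real.exp (-2 * y ^ 2) * (-4 * y) * P y
        + Real.exp (-2 * y ^ 2) * (-S' y * P y ^ 2))
      (fun y => by
        refine HasDerivAt.congr_deriv (f := _)
          ((((hasDerivAt_id y).pow 2).const_mul (-2)).exp.mul (hPd y)) ?_
        simp; left; ring) (by fun_prop)
    set lam := ScLam L (fun _ => 1) V N S S'
    have h1 : ∫ y in (-L)..L, ((1/2) * (Real.exp (-2 * y ^ 2) * (S' y * P y) ^ 2) +
        1 * (S' y * (Real.exp (-2 * y ^ 2) * (-4 * y) * P y
        + Real.exp (-2 * y ^ 2) * (-S' y * P y ^ 2)) + 2 * V y * S y * (Real.exp (-2 * y ^ 2) * P y)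
        + 4 * S y ^ 3 * (Real.exp (-2 * y ^ 2) * P y) - lam * S y * (Real.exp (-2 * y ^ 2) * P y)))
        ≤ ∫ y in (-L)..L, ((8 + 2 * K) * Real.exp (-y ^ 2) + 4 * S y ^ 2) := by
      apply ii_mono (by linarith) (by fun_prop) (by fun_prop)
      intro y hy
      have hX := Real.exp_pos (-2 * y ^ 2)
      have hX1 : Real.exp (-2 * y ^ 2) ≤ 1 := by
        rw [Real.exp_le_one_iff]; nlinarith [sq_nonneg y]
      have hX2 := one_add_sq_mul_exp y
      have hV2 := hb.V2 y hy
      have hsp := hSP y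
      set X := Real.exp (-2 * y ^ 2)
      set q := S' y * P y
      have e1 : (1/2) * (X * q ^ 2) +
        1 * (S' y * (X * (-4 * y) * P y
        + X * (-S' y * P y ^ 2)) + 2 * V y * S y * (X * P y)
        + 4 * S y ^ 3 * (X * P y) - lam * S y * (X * P y))
        = X * (-(1/2) * q ^ 2 - 4 * y * q + 2 * V y + 4 * S y ^ 2 - lam) := by
        simp only [q]
        linear_combination (2 * V y * X + 4 * S y ^ 2 * X - lam * X) * hsp
      rw [e1]
      have e2 : -(1/2) * q ^ 2 - 4 * y * q + 2 * V y + 4 * S y ^ 2 - lam ≤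
        (8 + 2 * K) * (1 + y ^ 2) + 4 * S y ^ 2 := by
        nlinarith [sq_nonneg (q + 4 * y)]
      calc _ ≤ X * ((8 + 2 * K) * (1 + y ^ 2) + 4 * S y ^ 2) := by gcongr
        _ = (8 + 2 * K) * ((1 + y ^ 2) * X) + 4 * (X * S y ^ 2) := by ring
        _ ≤ (8 + 2 * K) * Real.exp (-y ^ 2) + 4 * (1 * S y ^ 2) := by gcongr
        _ = _ := by ring
    rw [ii_add (by fun_prop) (by fun_prop), hel, ii_mul, ii_add (by fun_prop) (by fun_prop),
      ii_mul, ii_mul] at h1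
    have h2 := gauss_le (L := L) (by linarith)
    have h3 := hf.f0
    have h4 : (8 + 2 * K) * (∫ y in (-L)..L, Real.exp (-y ^ 2)) ≤ (8 + 2 * K) * 2 := by gcongr
    linarith
  have hosc : ∀ p r : ℝ, p ≤ r → -L ≤ p → r ≤ L → -R2 ≤ p → r ≤ R2 →
      |Real.log (S r) - Real.log (S p)| ≤ O := by
    intro p r hpr hpL hrL hpR hrR
    have hlog : ∀ y, HasDerivAt (fun y => Real.log (S y)) (S' y * P y) y := fun y =>
      (h.hd y).log (h.pos y).ne'
    have e1 : ∫ y in p..r, S' y * P y = Real.log (S r) - Real.log (S p) :=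
      intervalIntegral.integral_eq_sub_of_hasDerivAt (fun y _ => hlog y)
        ((by fun_prop : Continuous fun y => S' y * P y).intervalIntegrable _ _)
    rw [← e1]
    have e2 : |∫ y in p..r, S' y * P y| ≤ ∫ y in p..r, |S' y * P y| :=
      intervalIntegral.abs_integral_le_integral_abs hpr
    have e3 : ∫ y in p..r, |S' y * P y| ≤ ∫ y in p..r, (1/2 + (1/2 * Real.exp (2 * R2 ^ 2)) *
        (Real.exp (-2 * y ^ 2) * (S' y * P y) ^ 2)) := by
      apply intervalIntegral.integral_mono_on hpr
        ((by fun_prop : Continuous _).intervalIntegrable _ _)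
        ((by fun_prop : Continuous _).intervalIntegrable _ _)
      intro y hy
      have h1 : y ^ 2 ≤ R2 ^ 2 := sq_le_sq' (by linarith [hy.1]) (by linarith [hy.2])
      have h3 : 1 ≤ Real.exp (2 * R2 ^ 2) * Real.exp (-2 * y ^ 2) := by
        rw [← Real.exp_add, Real.one_le_exp_iff]
        linarith
      have h4 : |S' y * P y| ≤ 1/2 + 1/2 * (S' y * P y) ^ 2 := by
        rw [← sq_abs (S' y * P y)]
        nlinarith [sq_nonneg (|S' y * P y| - 1)]
      have h5 := mul_le_mul_of_nonneg_right h3 (sq_nonneg (S' y * P y))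
      linarith
    rw [intervalIntegral.integral_add
        ((by fun_prop : Continuous _).intervalIntegrable _ _)
        ((by fun_prop : Continuous _).intervalIntegrable _ _),
        intervalIntegral.integral_const_mul] at e3
    have e4 : ∫ y in p..r, Real.exp (-2 * y ^ 2) * (S' y * P y) ^ 2 ≤
        ∫ y in (-L)..L, Real.exp (-2 * y ^ 2) * (S' y * P y) ^ 2 := by
      apply intervalIntegral.integral_mono_interval hpL hpr hrL
      · filter_upwards with y
        simp only [Pi.zero_apply]
        positivity
      · exact (by fun_prop : Continuous _).intervalIntegrable _ _
    have e5 : (1/2 * Real.exp (2 * R2 ^ 2)) *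
        (∫ y in p..r, Real.exp (-2 * y ^ 2) * (S' y * P y) ^ 2) ≤
        (1/2 * Real.exp (2 * R2 ^ 2)) * Q := by
      gcongr; linarith
    simp only [intervalIntegral.integral_const, smul_eq_mul] at e3
    linarith
  obtain ⟨y0, hy0, hy0R, hy0S⟩ := hpt
  have hxR2 : |x| ≤ R2 := by linarith
  have hfin : |Real.log (S x) - Real.log (S y0)| ≤ O := by
    rcases le_total y0 x with hle | hle
    · exact hosc y0 x hle hy0.1 hx.2 (by linarith [neg_abs_le y0]) (by linarith [le_abs_self x])
    · rw [abs_sub_comm]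
      exact hosc x y0 hle hx.1 hy0.2 (by linarith [neg_abs_le x]) (by linarith [le_abs_self y0])
  have h1 : Real.log (S y0) + (-O) ≤ Real.log (S x) := by
    have := (abs_le.1 hfin).1; linarith
  have h2 := Real.exp_le_exp.2 h1
  rw [Real.exp_add, Real.exp_log (h.pos _), Real.exp_log (h.pos _)] at h2
  have h3 : Real.sqrt c2 ≤ S y0 := Real.sqrt_le_iff.2 ⟨(h.pos _).le, hy0S⟩
  calc _ ≤ S y0 * Real.exp (-O) := by gcongr
    _ ≤ _ := h2

lemma odd_moment {L N lam : ℝ} {V S S' : ℝ → ℝ} (hL : 0 ≤ L) (hV : Continuous V)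
    (hVe : ∀ y, V (-y) = V y)
    (h : ScMin L (fun _ => 1) V N S S') (hel : WEL L (fun _ => 1) V lam S S') :
    ∫ y in (-L)..L, y * S y ^ 2 = 0 := by
  have hSc := cont_of_hd h.hd
  have hS'c := h.hc
  set T : ℝ → ℝ := fun y => S (-y) with hT
  set T' : ℝ → ℝ := fun y => -S' (-y) with hT'
  have hTd : ∀ y, HasDerivAt T (T' y) y := fun y => by
    refine HasDerivAt.congr_deriv (f := _) ((h.hd (-y)).comp y (hasDerivAt_neg y)) ?_
    simp [hT']
  have hTc : Continuous T := cont_of_hd hTd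
  have hT'c : Continuous T' := by fun_prop
  have hTpos : ∀ y, 0 < T y := fun y => h.pos _
  have helT : WEL L (fun _ => 1) V lam T T' := by
    intro φ φ' hφ hφ'
    have := hel (fun y => φ (-y)) (fun y => -φ' (-y)) (fun y => by
      refine HasDerivAt.congr_deriv (f := _) ((hφ (-y)).comp y (hasDerivAt_neg y)) ?_
      simp) (by fun_prop)
    have e := intervalIntegral.integral_comp_neg (a := -L) (b := L) (fun y : ℝ => (1:ℝ) * (S' y * -φ' (-y)
      + 2 * V y * S y * φ (-y) + 4 * S y ^ 3 * φ (-y) - lam * S y * φ (-y)))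
    rw [neg_neg, this] at e
    rw [← e]
    congr 1; ext y; simp only [hT, hT', neg_neg, hVe]; ring
  set P : ℝ → ℝ := fun y => (S y)⁻¹ with hP
  have hSP : ∀ y, S y * P y = 1 := fun y => mul_inv_cancel₀ (h.pos y).ne'
  have hPd : ∀ y, HasDerivAt P (-S' y * P y ^ 2) y := fun y => by
    refine HasDerivAt.congr_deriv (f := _) ((h.hd y).inv (h.pos y).ne') ?_
    simp [hP, div_eq_mul_inv]
  have hPc := cont_of_hd hPd
  set Z : ℝ → ℝ := fun y => (T y)⁻¹ with hZ
  have hTZ : ∀ y, T y * Z y = 1 := fun y => mul_inv_cancel₀ (hTpos y).ne'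
  have hZd : ∀ y, HasDerivAt Z (-T' y * Z y ^ 2) y := fun y => by
    refine HasDerivAt.congr_deriv (f := _) ((hTd y).inv (hTpos y).ne') ?_
    simp [hZ, div_eq_mul_inv]
  have hZc := cont_of_hd hZd
  have hud : ∀ y, HasDerivAt (fun y => S y - T y) (S' y - T' y) y := fun y =>
    (h.hd y).sub (hTd y)
  have i1 := hel _ _ hud (by fun_prop)
  have i2 := helT _ _ hud (by fun_prop)
  have i3 := hel (fun y => (S y - T y) ^ 2 * P y)
    (fun y => 2 * (S y - T y) * (S' y - T' y) * P y + (S y - T y) ^ 2 * (-S' y * P y ^ 2))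
    (fun y => by
      refine HasDerivAt.congr_deriv (f := _) (((hud y).pow 2).mul (hPd y)) ?_
      simp) (by fun_prop)
  have i4 := helT (fun y => (S y - T y) ^ 2 * Z y)
    (fun y => 2 * (S y - T y) * (S' y - T' y) * Z y + (S y - T y) ^ 2 * (-T' y * Z y ^ 2))
    (fun y => by
      refine HasDerivAt.congr_deriv (f := _) (((hud y).pow 2).mul (hZd y)) ?_
      simp) (by fun_prop)
  have hmono : ∫ y in (-L)..L, 2 * (S y ^ 2 - T y ^ 2) ^ 2 ≤ 0 := by
    have := ii_mono hL (f := fun y => 2 * (S y ^ 2 - T y ^ 2) ^ 2) (g := fun y =>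
      ((1 * (S' y * (S' y - T' y) + 2 * V y * S y * (S y - T y)
        + 4 * S y ^ 3 * (S y - T y) - lam * S y * (S y - T y)))
      - (1 * (T' y * (S' y - T' y) + 2 * V y * T y * (S y - T y)
        + 4 * T y ^ 3 * (S y - T y) - lam * T y * (S y - T y))))
      - (1/2) * ((1 * (S' y * (2 * (S y - T y) * (S' y - T' y) * P y
            + (S y - T y) ^ 2 * (-S' y * P y ^ 2))
        + 2 * V y * S y * ((S y - T y) ^ 2 * P y)
        + 4 * S y ^ 3 * ((S y - T y) ^ 2 * P y) - lam * S y * ((S y - T y) ^ 2 * P y)))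
      + (1 * (T' y * (2 * (S y - T y) * (S' y - T' y) * Z y
            + (S y - T y) ^ 2 * (-T' y * Z y ^ 2))
        + 2 * V y * T y * ((S y - T y) ^ 2 * Z y)
        + 4 * T y ^ 3 * ((S y - T y) ^ 2 * Z y) - lam * T y * ((S y - T y) ^ 2 * Z y)))))
      (by fun_prop) (by fun_prop) (by
        intro y _
        have h1 := hSP y
        have h2 := hTZ y
        set u := S y - T y with hu
        set u' := S' y - T' y with hu'
        have e1 : (1 * (S' y * (2 * u * u' * P y + u ^ 2 * (-S' y * P y ^ 2))
          + 2 * V y * S y * (u ^ 2 * P y)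
          + 4 * S y ^ 3 * (u ^ 2 * P y) - lam * S y * (u ^ 2 * P y)))
          = u' ^ 2 - (u' - u * (S' y * P y)) ^ 2 + (2 * V y + 4 * S y ^ 2 - lam) * u ^ 2 := by
          linear_combination (2 * V y + 4 * S y ^ 2 - lam) * u ^ 2 * h1
        have e2 : (1 * (T' y * (2 * u * u' * Z y + u ^ 2 * (-T' y * Z y ^ 2))
          + 2 * V y * T y * (u ^ 2 * Z y)
          + 4 * T y ^ 3 * (u ^ 2 * Z y) - lam * T y * (u ^ 2 * Z y)))
          = u' ^ 2 - (u' - u * (T' y * Z y)) ^ 2 + (2 * V y + 4 * T y ^ 2 - lam) * u ^ 2 := by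
          linear_combination (2 * V y + 4 * T y ^ 2 - lam) * u ^ 2 * h2
        rw [e1, e2]
        have h3 := sq_nonneg (u' - u * (S' y * P y))
        have h4 := sq_nonneg (u' - u * (T' y * Z y))
        generalize (u' - u * (S' y * P y)) ^ 2 = A at *
        generalize (u' - u * (T' y * Z y)) ^ 2 = B at *
        rw [hu', hu]
        nlinarith)
    rw [ii_sub (by fun_prop) (by fun_prop), ii_sub (by fun_prop) (by fun_prop), ii_mul,
      ii_mul (c := (1/2 : ℝ)), ii_add (by fun_prop) (by fun_prop), i1, i2, i3, i4] at this
    rw [ii_mul]; linarith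
  rw [ii_mul] at hmono
  set d := ∫ y in (-L)..L, y * S y ^ 2 with hd
  have hdT : ∫ y in (-L)..L, y * T y ^ 2 = -d := by
    have := intervalIntegral.integral_comp_neg (a := -L) (b := L) (fun y : ℝ => y * S y ^ 2)
    rw [neg_neg, ← hd] at this
    rw [← this, ← intervalIntegral.integral_neg]
    congr 1; ext y; simp only [hT]; ring
  set m := ∫ y in (-L)..L, y ^ 2 with hm
  have hm0 : 0 ≤ m := intervalIntegral.integral_nonneg (by linarith) fun y _ => by positivity
  have hquad : ∀ t : ℝ, 0 ≤ 4 * t * d + t ^ 2 * m := by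
    intro t
    have h0 : 0 ≤ ∫ y in (-L)..L, ((S y ^ 2 - T y ^ 2) + t * y) ^ 2 :=
      intervalIntegral.integral_nonneg (by linarith) fun y _ => by positivity
    have e : ∫ y in (-L)..L, ((S y ^ 2 - T y ^ 2) + t * y) ^ 2 =
        (∫ y in (-L)..L, (S y ^ 2 - T y ^ 2) ^ 2) + (2 * t) * (d - (-d)) + t ^ 2 * m := by
      rw [← hdT, hd, hm, ← ii_sub (by fun_prop) (by fun_prop), ← ii_mul, ← ii_mul,
        ← ii_add (by fun_prop) (by fun_prop), ← ii_add (by fun_prop) (by fun_prop)]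
      congr 1; ext y; ring
    linarith
  have h1 := hquad (-d / (m + 1))
  have h2 : 4 * (-d / (m + 1)) * d + (-d / (m + 1)) ^ 2 * m =
      -(d ^ 2 * (3 * m + 4)) / (m + 1) ^ 2 := by field_simp; ring
  rw [h2] at h1
  rw [div_nonneg_iff] at h1
  rcases h1 with h1 | h1
  · have : d ^ 2 * (3 * m + 4) ≤ 0 := by linarith [h1.1]
    have h3 : d ^ 2 ≤ 0 := by nlinarith [sq_nonneg d]
    nlinarith
  · have : 0 < (m + 1) ^ 2 := by positivity
    linarith [h1.2]

lemma sup_le_h1 {L : ℝ} (hL : 1 ≤ L) {u u' : ℝ → ℝ} (hu : ∀ y, HasDerivAt u (u' y) y)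
    (hu' : Continuous u') (x : ℝ) (hx : x ∈ Icc (-L) L) :
    u x ^ 2 ≤ 2 * ∫ y in (-L)..L, (u' y ^ 2 + u y ^ 2) := by
  have huc := cont_of_hd hu
  set I := ∫ y in (-L)..L, (u' y ^ 2 + u y ^ 2) with hI
  have hseg : ∀ p r, p ≤ r → -L ≤ p → r ≤ L → |u r ^ 2 - u p ^ 2| ≤ I := by
    intro p r hpr hp hr
    have e1 : ∫ y in p..r, 2 * u y * u' y = u r ^ 2 - u p ^ 2 :=
      intervalIntegral.integral_eq_sub_of_hasDerivAt (f := fun y => u y ^ 2) (fun y _ => by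
        refine HasDerivAt.congr_deriv (f := _) ((hu y).pow 2) ?_; simp)
        ((by fun_prop : Continuous _).intervalIntegrable _ _)
    rw [← e1]
    calc _ ≤ ∫ y in p..r, |2 * u y * u' y| := intervalIntegral.abs_integral_le_integral_abs hpr
      _ ≤ ∫ y in p..r, (u' y ^ 2 + u y ^ 2) := by
        apply intervalIntegral.integral_mono_on hpr
          ((by fun_prop : Continuous _).intervalIntegrable _ _)
          ((by fun_prop : Continuous _).intervalIntegrable _ _)
        intro y _
        rw [abs_le]
        constructor <;> nlinarith [sq_nonneg (u y - u' y), sq_nonneg (u y + u' y)]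
      _ ≤ I := by
        apply intervalIntegral.integral_mono_interval hp hpr hr
        · filter_upwards with y
          simp only [Pi.zero_apply]
          positivity
        · exact (by fun_prop : Continuous _).intervalIntegrable _ _
  have h1 : ∫ y in (-L)..L, u x ^ 2 ≤ ∫ y in (-L)..L, (I + u y ^ 2) := by
    apply ii_mono (by linarith) (by fun_prop) (by fun_prop)
    intro y hy
    rcases le_total y x with hle | hle
    · have := (abs_le.1 (hseg y x hle hy.1 hx.2)).2
      linarith
    · have := (abs_le.1 (hseg x y hle hx.1 hy.2)).1
      linarith
  have h2 : ∫ y in (-L)..L, u y ^ 2 ≤ I := by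
    apply ii_mono (by linarith) (by fun_prop) (by fun_prop)
    intro y _
    nlinarith [sq_nonneg (u' y)]
  have hI0 : 0 ≤ I := intervalIntegral.integral_nonneg (by linarith) fun y _ => by positivity
  rw [ii_add (by fun_prop) (by fun_prop)] at h1
  simp only [intervalIntegral.integral_const, smul_eq_mul] at h1
  nlinarith


lemma aux_cube (y : ℝ) : (1 + |y| ^ 3) ^ 2 ≤ 2 * ((1 + y ^ 2) * (1 + y ^ 4)) := by
  have h6 : (|y| ^ 3) ^ 2 = y ^ 6 := by rw [← pow_mul, mul_comm, pow_mul, sq_abs]; ring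
  have h1 := sq_nonneg (|y| ^ 3 - 1)
  have h2 := sq_nonneg y
  have h3 := sq_nonneg (y ^ 2)
  have h4 : 2 * ((1 + y ^ 2) * (1 + y ^ 4)) = 2 + 2 * y ^ 2 + 2 * (y ^ 2) ^ 2 + 2 * y ^ 6 := by ring
  rw [h4, ← h6]
  linarith [h1]

lemma aux_quad {e u u' : ℝ} (he0 : 0 ≤ e) (he1 : e ≤ 1) :
    e * u * u' + e ^ 2 * u ^ 2 / 2 ≤ e * (u' ^ 2 + u ^ 2) := by
  have h2 : u * u' ≤ (u' ^ 2 + u ^ 2) / 2 := by nlinarith [sq_nonneg (u - u')]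
  have h3 : e * (u * u') ≤ e * ((u' ^ 2 + u ^ 2) / 2) := by gcongr
  have h4 : e ^ 2 * u ^ 2 ≤ e * u ^ 2 := by
    gcongr; nlinarith
  nlinarith [mul_nonneg he0 (sq_nonneg u')]

set_option maxHeartbeats 2000000 in
lemma ptwise {w e y G S G' S' PG PS V V0 lG lS m k M a C0 : ℝ}
    (hPG : G * PG = 1) (hPS : S * PS = 1) (hw1 : 1/2 ≤ w) (hw2 : w ≤ 3/2)
    (he0 : 0 ≤ e) (hm0 : 0 < m) (hm1 : m ≤ 1) (hk0 : 0 < k) (hkm : k ≤ m / 2)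
    (hka : k ≤ m / 2 * a) (hek : e ≤ k / 2) (he1 : e ≤ 1)
    (hlG : lG ≤ M) (hlS : lS ≤ M) (hVV : 3 * a * y ^ 2 - 1 ≤ V + V0)
    (hS0 : 0 < S) (hG0 : 0 < G)
    (hco : m * (a * y ^ 2 + 1) ≤ m * (3 * a * y ^ 2 - 1 - M) + 2 * S ^ 2)
    (hC0 : 0 ≤ C0) (hdV : |V - V0| ≤ C0 * e * (1 + |y| ^ 3)) :
    k / 4 * ((G' - S') ^ 2 + (G - S) ^ 2) ≤
      ((w * (G' * (G' - S') + 2 * V * G * (G - S) + 4 * G ^ 3 * (G - S) - lG * G * (G - S))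
      - 1 * (S' * (e * (G - S) + w * (G' - S')) + 2 * V0 * S * (w * (G - S))
          + 4 * S ^ 3 * (w * (G - S)) - lS * S * (w * (G - S))))
      - (1 - m) / 2 * (w * (G' * (2 * (G - S) * (G' - S') * PG + (G - S) ^ 2 * (-G' * PG ^ 2))
          + 2 * V * G * ((G - S) ^ 2 * PG) + 4 * G ^ 3 * ((G - S) ^ 2 * PG)
          - lG * G * ((G - S) ^ 2 * PG))
        + 1 * (S' * ((e * (G - S) ^ 2 + w * (2 * (G - S) * (G' - S'))) * PS
              + w * (G - S) ^ 2 * (-S' * PS ^ 2))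
          + 2 * V0 * S * (w * (G - S) ^ 2 * PS) + 4 * S ^ 3 * (w * (G - S) ^ 2 * PS)
          - lS * S * (w * (G - S) ^ 2 * PS))))
      + ((lG - lS) / 2 * (w * G ^ 2 - w * S ^ 2)
        + (9 * C0 ^ 2 + 1) / k * e ^ 2 * ((1 + y ^ 4) * (G ^ 2 + S ^ 2) + S' ^ 2)) := by
  obtain ⟨u, hu⟩ : ∃ u, u = G - S := ⟨_, rfl⟩
  obtain ⟨u', hu'⟩ : ∃ u', u' = G' - S' := ⟨_, rfl⟩
  rw [← hu, ← hu']
  have e1 : w * (G' * (2 * u * u' * PG + u ^ 2 * (-G' * PG ^ 2))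
          + 2 * V * G * (u ^ 2 * PG) + 4 * G ^ 3 * (u ^ 2 * PG)
          - lG * G * (u ^ 2 * PG)) ≤ w * (u' ^ 2 + (2 * V + 4 * G ^ 2 - lG) * u ^ 2) := by
    have h1 : w * (G' * (2 * u * u' * PG + u ^ 2 * (-G' * PG ^ 2))
          + 2 * V * G * (u ^ 2 * PG) + 4 * G ^ 3 * (u ^ 2 * PG)
          - lG * G * (u ^ 2 * PG)) = w * (u' ^ 2 + (2 * V + 4 * G ^ 2 - lG) * u ^ 2)
          - w * (u' - u * (G' * PG)) ^ 2 := by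
      linear_combination w * (2 * V + 4 * G ^ 2 - lG) * u ^ 2 * hPG
    have h2 : 0 ≤ w * (u' - u * (G' * PG)) ^ 2 := by
      have : 0 ≤ w := by linarith
      positivity
    linarith
  have e2 : 1 * (S' * ((e * u ^ 2 + w * (2 * u * u')) * PS + w * u ^ 2 * (-S' * PS ^ 2))
          + 2 * V0 * S * (w * u ^ 2 * PS) + 4 * S ^ 3 * (w * u ^ 2 * PS)
          - lS * S * (w * u ^ 2 * PS)) ≤ w * (u' ^ 2 + (2 * V0 + 4 * S ^ 2 - lS) * u ^ 2)
          + e * u * u' + e ^ 2 * u ^ 2 / 2 := by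
    obtain ⟨p, hp⟩ : ∃ p, p = u * (S' * PS) - u' := ⟨_, rfl⟩
    have h1 : 1 * (S' * ((e * u ^ 2 + w * (2 * u * u')) * PS + w * u ^ 2 * (-S' * PS ^ 2))
          + 2 * V0 * S * (w * u ^ 2 * PS) + 4 * S ^ 3 * (w * u ^ 2 * PS)
          - lS * S * (w * u ^ 2 * PS)) = w * (u' ^ 2 + (2 * V0 + 4 * S ^ 2 - lS) * u ^ 2)
          + e * u * u' - (w * p ^ 2 - e * u * p) := by
      rw [hp]
      linear_combination w * (2 * V0 + 4 * S ^ 2 - lS) * u ^ 2 * hPS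
    have h2 : 1/2 * p ^ 2 ≤ w * p ^ 2 := by gcongr
    have h3 := sq_nonneg (p - e * u)
    linarith
  have e3 : (w * (G' * u' + 2 * V * G * u + 4 * G ^ 3 * u - lG * G * u)
      - 1 * (S' * (e * u + w * u') + 2 * V0 * S * (w * u) + 4 * S ^ 3 * (w * u)
        - lS * S * (w * u))) = w * (u' ^ 2 + (V + V0 - (lG + lS) / 2) * u ^ 2
        + 2 * (G ^ 2 + S ^ 2) * u ^ 2) + 2 * w * (G + S) ^ 2 * u ^ 2
        + w * (V - V0) * (G + S) * u - (lG - lS) / 2 * (w * G ^ 2 - w * S ^ 2) - e * (S' * u) := by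
    rw [hu, hu']; ring
  rw [e3]
  have hθ : 0 ≤ (1 - m) / 2 := by linarith
  have e4 := mul_le_mul_of_nonneg_left (add_le_add e1 e2) hθ
  refine le_trans ?_ (add_le_add (sub_le_sub_left e4 _) le_rfl)
  -- coercivity
  have c1 : w * (m * (a * y ^ 2 + 1) * u ^ 2) ≤ w * ((m * (V + V0 - (lG + lS) / 2)
      + 2 * (G + S) ^ 2) * u ^ 2) := by
    have : 0 ≤ w := by linarith
    have h1 : m * (3 * a * y ^ 2 - 1 - M) ≤ m * (V + V0 - (lG + lS) / 2) := by
      gcongr; linarith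
    have h2 : S ^ 2 ≤ (G + S) ^ 2 := by gcongr; linarith
    gcongr
    linarith
  have c2 : k * (1 + y ^ 2) ≤ (m / 2) * (a * y ^ 2 + 1) := by
    have := mul_le_mul_of_nonneg_right hka (sq_nonneg y)
    linarith
  have c3 : k * ((1 + y ^ 2) * u ^ 2) ≤ w * (m * (a * y ^ 2 + 1) * u ^ 2) := by
    have h0 : 0 ≤ m * (a * y ^ 2 + 1) := by
      have : 0 ≤ k * (1 + y ^ 2) := by positivity
      linarith
    have h1 := mul_le_mul_of_nonneg_right c2 (sq_nonneg u)
    have h2 : 1/2 * (m * (a * y ^ 2 + 1) * u ^ 2) ≤ w * (m * (a * y ^ 2 + 1) * u ^ 2) := by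
      gcongr
    linarith
  have c4 : k * u' ^ 2 ≤ w * (m * u' ^ 2) := by
    have h2 : 1/2 * (m * u' ^ 2) ≤ w * (m * u' ^ 2) := by gcongr
    have h3 := mul_le_mul_of_nonneg_right hkm (sq_nonneg u')
    linarith
  have c5 : 0 ≤ w * (m * (2 * (G ^ 2 + S ^ 2) * u ^ 2)) := by
    have : 0 ≤ w := by linarith
    positivity
  -- quadratic error
  have q1 : (1 - m) / 2 * (e * u * u' + e ^ 2 * u ^ 2 / 2) ≤ k / 4 * (u' ^ 2 + u ^ 2) := by
    have h1 := aux_quad (u := u) (u' := u') he0 he1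
    have h5 : 0 ≤ e * (u' ^ 2 + u ^ 2) := by positivity
    calc _ ≤ (1 - m) / 2 * (e * (u' ^ 2 + u ^ 2)) := by gcongr
      _ ≤ 1 / 2 * (e * (u' ^ 2 + u ^ 2)) := by gcongr; linarith
      _ ≤ 1 / 2 * (k / 2 * (u' ^ 2 + u ^ 2)) := by gcongr
      _ = _ := by ring
  -- linear errors
  have l1 : e * (S' * u) ≤ k / 4 * u ^ 2 + 1 / k * e ^ 2 * S' ^ 2 := by
    have h1 : k / 4 * u ^ 2 + 1 / k * e ^ 2 * S' ^ 2 - e * (S' * u)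
      = (k * u / 2 - e * S') ^ 2 / k := by field_simp; ring
    have : 0 ≤ (k * u / 2 - e * S') ^ 2 / k := by positivity
    linarith
  have l2 : -(w * (V - V0) * (G + S) * u) ≤ k / 4 * ((1 + y ^ 2) * u ^ 2)
      + 9 * C0 ^ 2 / k * e ^ 2 * ((1 + y ^ 4) * (G ^ 2 + S ^ 2)) := by
    have h0 : -(w * (V - V0) * (G + S) * u) ≤ |w * (V - V0) * (G + S) * u| := neg_le_abs _
    have h1 : |w * (V - V0) * (G + S) * u| ≤ 3/2 * (C0 * e * (1 + |y| ^ 3)) * (G + S) * |u| := by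
      rw [abs_mul, abs_mul, abs_mul, abs_of_nonneg (by linarith : (0:ℝ) ≤ w),
        abs_of_pos (by linarith : 0 < G + S)]
      gcongr
    -- young
    obtain ⟨X, hX⟩ : ∃ X, X = C0 * e * (1 + |y| ^ 3) * (G + S) := ⟨_, rfl⟩
    have h3 : X ^ 2 ≤ C0 ^ 2 * e ^ 2 * (2 * ((1 + y ^ 2) * (1 + y ^ 4))) * (2 * (G ^ 2 + S ^ 2)) := by
      have t1 := aux_cube y
      have t2 : (G + S) ^ 2 ≤ 2 * (G ^ 2 + S ^ 2) := by linarith [sq_nonneg (G - S)]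
      calc X ^ 2 = C0 ^ 2 * e ^ 2 * (1 + |y| ^ 3) ^ 2 * (G + S) ^ 2 := by rw [hX]; ring
        _ ≤ _ := by gcongr
    have h4 : 3/2 * X * |u| ≤ k / 4 * ((1 + y ^ 2) * u ^ 2)
        + 9 / 4 / (k * (1 + y ^ 2)) * X ^ 2 := by
      have t1 : k / 4 * ((1 + y ^ 2) * u ^ 2) + 9 / 4 / (k * (1 + y ^ 2)) * X ^ 2
        - 3/2 * X * |u| = (k * (1 + y ^ 2) * |u| / 2 - 3/2 * X) ^ 2 / (k * (1 + y ^ 2)) := by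
        rw [← sq_abs u]
        field_simp; ring
      have : 0 ≤ (k * (1 + y ^ 2) * |u| / 2 - 3/2 * X) ^ 2 / (k * (1 + y ^ 2)) := by positivity
      linarith
    have h5 : 9 / 4 / (k * (1 + y ^ 2)) * X ^ 2 ≤
        9 * C0 ^ 2 / k * e ^ 2 * ((1 + y ^ 4) * (G ^ 2 + S ^ 2)) := by
      calc _ ≤ 9 / 4 / (k * (1 + y ^ 2)) * (C0 ^ 2 * e ^ 2 * (2 * ((1 + y ^ 2) * (1 + y ^ 4)))
            * (2 * (G ^ 2 + S ^ 2))) := by gcongr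
        _ = _ := by field_simp; ring
    have h6 : 3/2 * (C0 * e * (1 + |y| ^ 3)) * (G + S) * |u| = 3/2 * X * |u| := by
      rw [hX]; ring
    linarith
  have l3 : (9 * C0 ^ 2 + 1) / k * e ^ 2 * ((1 + y ^ 4) * (G ^ 2 + S ^ 2) + S' ^ 2) =
      9 * C0 ^ 2 / k * e ^ 2 * ((1 + y ^ 4) * (G ^ 2 + S ^ 2)) + 1 / k * e ^ 2 * S' ^ 2
      + 9 * C0 ^ 2 / k * e ^ 2 * S' ^ 2 + 1 / k * e ^ 2 * ((1 + y ^ 4) * (G ^ 2 + S ^ 2)) := by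
    ring
  have l4 : 0 ≤ 9 * C0 ^ 2 / k * e ^ 2 * S' ^ 2 := by positivity
  have l5 : 0 ≤ 1 / k * e ^ 2 * ((1 + y ^ 4) * (G ^ 2 + S ^ 2)) := by positivity
  have l6 : k / 4 * u ^ 2 ≤ k / 4 * ((1 + y ^ 2) * u ^ 2) := by
    have : 0 ≤ k / 4 * (y ^ 2 * u ^ 2) := by positivity
    linarith
  have id1 : w * (u' ^ 2 + (V + V0 - (lG + lS) / 2) * u ^ 2 + 2 * (G ^ 2 + S ^ 2) * u ^ 2)
      + 2 * w * (G + S) ^ 2 * u ^ 2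
      - (1 - m) / 2 * (w * (u' ^ 2 + (2 * V + 4 * G ^ 2 - lG) * u ^ 2) +
        (w * (u' ^ 2 + (2 * V0 + 4 * S ^ 2 - lS) * u ^ 2) + e * u * u' + e ^ 2 * u ^ 2 / 2))
      = w * (m * u' ^ 2) + w * ((m * (V + V0 - (lG + lS) / 2) + 2 * (G + S) ^ 2) * u ^ 2)
        + w * (m * (2 * (G ^ 2 + S ^ 2) * u ^ 2))
        - (1 - m) / 2 * (e * u * u' + e ^ 2 * u ^ 2 / 2) := by
    ring
  have l7 : 0 ≤ k * u' ^ 2 := by positivity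
  linarith


set_option maxHeartbeats 2000000 in
lemma core_h1 {L e N lG lS m k M a C0 : ℝ} {V V0 G G' S S' : ℝ → ℝ} (hL : 1 ≤ L)
    (hV : Continuous V) (hV0 : Continuous V0)
    (hG : ScMin L (fun y => 1 + e * y) V N G G') (hS : ScMin L (fun _ => 1) V0 N S S')
    (welG : WEL L (fun y => 1 + e * y) V lG G G') (welS : WEL L (fun _ => 1) V0 lS S S')
    (hodd : ∫ y in (-L)..L, y * S y ^ 2 = 0)
    (hw1 : ∀ y ∈ Icc (-L) L, 1/2 ≤ 1 + e * y) (hw2 : ∀ y ∈ Icc (-L) L, 1 + e * y ≤ 3/2)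
    (he0 : 0 ≤ e) (hm0 : 0 < m) (hm1 : m ≤ 1) (hk0 : 0 < k) (hkm : k ≤ m / 2)
    (hka : k ≤ m / 2 * a) (hek : e ≤ k / 2) (he1 : e ≤ 1)
    (hlG : lG ≤ M) (hlS : lS ≤ M) (hVV : ∀ y ∈ Icc (-L) L, 3 * a * y ^ 2 - 1 ≤ V y + V0 y)
    (hco : ∀ y ∈ Icc (-L) L,
      m * (a * y ^ 2 + 1) ≤ m * (3 * a * y ^ 2 - 1 - M) + 2 * S y ^ 2)
    (hC0 : 0 ≤ C0) (hdV : ∀ y ∈ Icc (-L) L, |V y - V0 y| ≤ C0 * e * (1 + |y| ^ 3))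
    (g0 : ∫ y in (-L)..L, G y ^ 2 ≤ M) (g4 : ∫ y in (-L)..L, y ^ 4 * G y ^ 2 ≤ M)
    (s0 : ∫ y in (-L)..L, S y ^ 2 ≤ M) (s4 : ∫ y in (-L)..L, y ^ 4 * S y ^ 2 ≤ M)
    (s1 : ∫ y in (-L)..L, S' y ^ 2 ≤ M) :
    k / 4 * ∫ y in (-L)..L, ((G' y - S' y) ^ 2 + (G y - S y) ^ 2) ≤
      (9 * C0 ^ 2 + 1) / k * e ^ 2 * (5 * M) := by
  have hGc := cont_of_hd hG.hd
  have hG'c := hG.hc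
  have hSc := cont_of_hd hS.hd
  have hS'c := hS.hc
  set P : ℝ → ℝ := fun y => (S y)⁻¹ with hP
  have hSP : ∀ y, S y * P y = 1 := fun y => mul_inv_cancel₀ (hS.pos y).ne'
  have hPd : ∀ y, HasDerivAt P (-S' y * P y ^ 2) y := fun y => by
    refine HasDerivAt.congr_deriv (f := _) ((hS.hd y).inv (hS.pos y).ne') ?_
    simp [hP, div_eq_mul_inv]
  have hPc := cont_of_hd hPd
  set Z : ℝ → ℝ := fun y => (G y)⁻¹ with hZ
  have hGZ : ∀ y, G y * Z y = 1 := fun y => mul_inv_cancel₀ (hG.pos y).ne'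
  have hZd : ∀ y, HasDerivAt Z (-G' y * Z y ^ 2) y := fun y => by
    refine HasDerivAt.congr_deriv (f := _) ((hG.hd y).inv (hG.pos y).ne') ?_
    simp [hZ, div_eq_mul_inv]
  have hZc := cont_of_hd hZd
  have hud : ∀ y, HasDerivAt (fun y => G y - S y) (G' y - S' y) y := fun y =>
    (hG.hd y).sub (hS.hd y)
  have hwd : ∀ y, HasDerivAt (fun y => 1 + e * y) e y := fun y => by
    refine HasDerivAt.congr_deriv (f := _) (((hasDerivAt_id y).const_mul e).const_add 1) ?_
    simp
  have i1 := welG _ _ hud (by fun_prop)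
  have i2 := welS (fun y => (1 + e * y) * (G y - S y))
    (fun y => e * (G y - S y) + (1 + e * y) * (G' y - S' y))
    (fun y => (hwd y).mul (hud y)) (by fun_prop)
  have i3 := welG (fun y => (G y - S y) ^ 2 * Z y)
    (fun y => 2 * (G y - S y) * (G' y - S' y) * Z y + (G y - S y) ^ 2 * (-G' y * Z y ^ 2))
    (fun y => by
      refine HasDerivAt.congr_deriv (f := _) (((hud y).pow 2).mul (hZd y)) ?_
      simp) (by fun_prop)
  have i4 := welS (fun y => (1 + e * y) * (G y - S y) ^ 2 * P y)
    (fun y => (e * (G y - S y) ^ 2 + (1 + e * y) * (2 * (G y - S y) * (G' y - S' y))) * P y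
      + (1 + e * y) * (G y - S y) ^ 2 * (-S' y * P y ^ 2))
    (fun y => by
      refine HasDerivAt.congr_deriv (f := _) (((hwd y).mul ((hud y).pow 2)).mul (hPd y)) ?_
      simp) (by fun_prop)
  have i5 : ∫ y in (-L)..L, (1 + e * y) * S y ^ 2 = N := by
    have : ∀ y, (1 + e * y) * S y ^ 2 = 1 * S y ^ 2 + e * (y * S y ^ 2) := fun y => by ring
    simp only [this]
    rw [ii_add (by fun_prop) (by fun_prop), ii_mul (c := e), hodd, hS.mass]
    ring
  have i6 := hG.mass
  have main := ii_mono (L := L) (by linarith)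
    (f := fun y => k / 4 * ((G' y - S' y) ^ 2 + (G y - S y) ^ 2)) (g := fun y =>
      (((1 + e * y) * (G' y * (G' y - S' y) + 2 * V y * G y * (G y - S y)
          + 4 * G y ^ 3 * (G y - S y) - lG * G y * (G y - S y))
      - 1 * (S' y * (e * (G y - S y) + (1 + e * y) * (G' y - S' y))
          + 2 * V0 y * S y * ((1 + e * y) * (G y - S y))
          + 4 * S y ^ 3 * ((1 + e * y) * (G y - S y)) - lS * S y * ((1 + e * y) * (G y - S y))))
      - (1 - m) / 2 * ((1 + e * y) * (G' y * (2 * (G y - S y) * (G' y - S' y) * Z y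
            + (G y - S y) ^ 2 * (-G' y * Z y ^ 2))
          + 2 * V y * G y * ((G y - S y) ^ 2 * Z y) + 4 * G y ^ 3 * ((G y - S y) ^ 2 * Z y)
          - lG * G y * ((G y - S y) ^ 2 * Z y))
        + 1 * (S' y * ((e * (G y - S y) ^ 2 + (1 + e * y) * (2 * (G y - S y) * (G' y - S' y))) * P y
              + (1 + e * y) * (G y - S y) ^ 2 * (-S' y * P y ^ 2))
          + 2 * V0 y * S y * ((1 + e * y) * (G y - S y) ^ 2 * P y)
          + 4 * S y ^ 3 * ((1 + e * y) * (G y - S y) ^ 2 * P y)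
          - lS * S y * ((1 + e * y) * (G y - S y) ^ 2 * P y))))
      + ((lG - lS) / 2 * ((1 + e * y) * G y ^ 2 - (1 + e * y) * S y ^ 2)
        + (9 * C0 ^ 2 + 1) / k * e ^ 2 * ((1 + y ^ 4) * (G y ^ 2 + S y ^ 2) + S' y ^ 2)))
    (by fun_prop) (by fun_prop) (fun y hy => ptwise (hGZ y) (hSP y) (hw1 y hy) (hw2 y hy)
      he0 hm0 hm1 hk0 hkm hka hek he1 hlG hlS (hVV y hy) (hS.pos y) (hG.pos y) (hco y hy) hC0
      (hdV y hy))
  rw [ii_mul] at main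
  generalize (∫ y in (-L)..L, ((G' y - S' y) ^ 2 + (G y - S y) ^ 2)) = I at main ⊢
  rw [ii_add (by fun_prop) (by fun_prop), ii_sub (by fun_prop) (by fun_prop),
    ii_sub (by fun_prop) (by fun_prop), ii_mul (c := (1 - m) / 2),
    ii_add (by fun_prop) (by fun_prop), i1, i2, i3, i4, ii_add (by fun_prop) (by fun_prop),
    ii_mul (c := (lG - lS) / 2), ii_sub (by fun_prop) (by fun_prop), i5, i6,
    ii_mul (c := (9 * C0 ^ 2 + 1) / k * e ^ 2)] at main
  have j : ∫ y in (-L)..L, ((1 + y ^ 4) * (G y ^ 2 + S y ^ 2) + S' y ^ 2) ≤ 5 * M := by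
    have : ∀ y, (1 + y ^ 4) * (G y ^ 2 + S y ^ 2) + S' y ^ 2 =
      G y ^ 2 + y ^ 4 * G y ^ 2 + S y ^ 2 + y ^ 4 * S y ^ 2 + S' y ^ 2 := fun y => by ring
    simp only [this]
    rw [ii_add (by fun_prop) (by fun_prop), ii_add (by fun_prop) (by fun_prop),
      ii_add (by fun_prop) (by fun_prop), ii_add (by fun_prop) (by fun_prop)]
    linarith
  have j2 : (9 * C0 ^ 2 + 1) / k * e ^ 2 *
      (∫ y in (-L)..L, ((1 + y ^ 4) * (G y ^ 2 + S y ^ 2) + S' y ^ 2)) ≤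
      (9 * C0 ^ 2 + 1) / k * e ^ 2 * (5 * M) := by gcongr
  linarith

theorem core (β N C0 : ℝ) (hβ : 0 < β) (hN : 0 < N) (hC0 : 0 < C0) :
    ∃ C δ : ℝ, 0 < δ ∧ ∀ (L e : ℝ) (V G G' S S' : ℝ → ℝ), 0 < e → 1 ≤ L → e * (1 + L) ≤ δ →
      Continuous V →
      (∀ y ∈ Icc (-L) L, |V y - β ^ 2 / 2 * y ^ 2| ≤ C0 * e * (1 + |y| ^ 3)) →
      ScMin L (fun y => 1 + e * y) V N G G' →
      ScMin L (fun _ => 1) (fun y => β ^ 2 / 2 * y ^ 2) N S S' →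
      ∀ y ∈ Icc (-L) L, |G y - S y| ≤ C * e := by
  set a := β ^ 2 / 4 with ha
  have ha0 : 0 < a := by positivity
  set K := β ^ 2 + 1 with hK
  have hK0 : 0 < K := by positivity
  obtain ⟨M, hM0, hM⟩ := fbd ha0 hK0 hN
  set R := Real.sqrt ((M + 2) / (2 * a)) + 1 with hR
  have hR0 : 0 < R := by positivity
  have hR2 : M + 2 ≤ 2 * a * R ^ 2 := by
    have h1 : Real.sqrt ((M + 2) / (2 * a)) ^ 2 = (M + 2) / (2 * a) := Real.sq_sqrt (by positivity)
    have h2 : (M + 2) / (2 * a) ≤ R ^ 2 := by rw [← h1]; gcongr; linarith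
    rw [div_le_iff₀ (by positivity)] at h2
    linarith
  obtain ⟨c, hc0, hc⟩ := lower_bd (a := a) hK0 hN hM0 R hR0
  set m := min 1 (2 * c ^ 2 / (M + 2)) with hm
  have hm0 : 0 < m := by positivity
  have hm1 : m ≤ 1 := min_le_left _ _
  have hmc : m * (M + 2) ≤ 2 * c ^ 2 := by
    rw [← le_div_iff₀ (by positivity)]; exact min_le_right _ _
  set k := m / 2 * min a 1 with hk
  have hk0 : 0 < k := by positivity
  have hkm : k ≤ m / 2 := by
    have : m / 2 * min a 1 ≤ m / 2 * 1 := by gcongr; exact min_le_right _ _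
    linarith
  have hka : k ≤ m / 2 * a := by
    rw [hk]; gcongr; exact min_le_left _ _
  refine ⟨Real.sqrt (40 * ((9 * C0 ^ 2 + 1) / k) * M / k),
    min (min (1/2) (k / 2)) (min (a / C0) (1 / C0)), by positivity, ?_⟩
  intro L e V G G' S S' he hL hδ hV hdV hG hS x hx
  have hd1 : e * (1 + L) ≤ 1/2 := hδ.trans ((min_le_left _ _).trans (min_le_left _ _))
  have hd2 : e * (1 + L) ≤ k/2 := hδ.trans ((min_le_left _ _).trans (min_le_right _ _))
  have hd3 : C0 * (e * (1 + L)) ≤ a := by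
    have : e * (1 + L) ≤ a / C0 := hδ.trans ((min_le_right _ _).trans (min_le_left _ _))
    rw [le_div_iff₀ hC0] at this; linarith
  have hd4 : C0 * (e * (1 + L)) ≤ 1 := by
    have : e * (1 + L) ≤ 1 / C0 := hδ.trans ((min_le_right _ _).trans (min_le_right _ _))
    rw [le_div_iff₀ hC0] at this; linarith
  have heL : 0 < e * L := by positivity
  have hw1 : ∀ y ∈ Icc (-L) L, 1/2 ≤ 1 + e * y := fun y hy => by
    have : e * (-L) ≤ e * y := by gcongr; exact hy.1
    linarith
  have hw2 : ∀ y ∈ Icc (-L) L, 1 + e * y ≤ 3/2 := fun y hy => by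
    have : e * y ≤ e * L := by gcongr; exact hy.2
    linarith
  have hdV' : ∀ y ∈ Icc (-L) L, |V y - β ^ 2 / 2 * y ^ 2| ≤ C0 * (e * (1 + L)) * (1 + y ^ 2) := by
    intro y hy
    refine (hdV y hy).trans ?_
    have h1 : 1 + |y| ^ 3 ≤ (1 + L) * (1 + y ^ 2) := by
      have h2 : |y| ≤ L := abs_le.2 hy
      have h3 : |y| ^ 3 = |y| * y ^ 2 := by rw [← sq_abs y]; ring
      have h4 : |y| * y ^ 2 ≤ L * y ^ 2 := by gcongr
      nlinarith [sq_nonneg y]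
    calc _ ≤ C0 * e * ((1 + L) * (1 + y ^ 2)) := by gcongr
      _ = _ := by ring
  have hV1 : ∀ y ∈ Icc (-L) L, a * y ^ 2 - 1 ≤ V y := by
    intro y hy
    have h1 := (abs_le.1 (hdV' y hy)).1
    have h2 := mul_le_mul_of_nonneg_right hd3 (sq_nonneg y)
    have : β ^ 2 / 2 * y ^ 2 = 2 * (a * y ^ 2) := by rw [ha]; ring
    linarith
  have hV2 : ∀ y ∈ Icc (-L) L, V y ≤ K * (1 + y ^ 2) := by
    intro y hy
    have h1 := (abs_le.1 (hdV' y hy)).2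
    have h2 := mul_le_mul_of_nonneg_right hd4 (sq_nonneg y)
    have : K * (1 + y ^ 2) = β ^ 2 + 1 + β ^ 2 * y ^ 2 + y ^ 2 := by rw [hK]; ring
    have h3 : 0 ≤ β ^ 2 * y ^ 2 := by positivity
    have h4 : 0 ≤ β ^ 2 := by positivity
    linarith
  have bdG : Bd L a K (fun y => 1 + e * y) V := ⟨hL, by fun_prop, hV, hw1, hw2, hV1, hV2⟩
  have bdS : Bd L a K (fun _ => 1) (fun y => β ^ 2 / 2 * y ^ 2) := by
    refine ⟨hL, by fun_prop, by fun_prop, fun y _ => by norm_num, fun y _ => by norm_num, ?_, ?_⟩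
    · intro y _
      have : 0 ≤ a * y ^ 2 := by positivity
      have : β ^ 2 / 2 * y ^ 2 = 2 * (a * y ^ 2) := by rw [ha]; ring
      linarith
    · intro y _
      have : K * (1 + y ^ 2) = β ^ 2 + 1 + β ^ 2 * y ^ 2 + y ^ 2 := by rw [hK]; ring
      have h3 : 0 ≤ β ^ 2 * y ^ 2 := by positivity
      have h4 : 0 ≤ β ^ 2 := by positivity
      have h5 := sq_nonneg y
      linarith
  have fG := hM _ _ _ _ _ bdG hG
  have fS := hM _ _ _ _ _ bdS hS
  have welG := wel_of_min (by linarith) hN bdG.hw hV (fun y hy => by linarith [hw1 y hy]) hG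
  have welS := wel_of_min (by linarith) hN bdS.hw bdS.hV (fun y hy => by norm_num) hS
  have hodd := odd_moment (by linarith) bdS.hV (fun y => by ring) hS welS
  have hlow := hc _ _ _ _ bdS (fun y => by positivity) hS fS
  have h1 := core_h1 (C0 := C0) (m := m) (k := k) (a := a) (M := M) hL hV bdS.hV hG hS welG welS
    hodd hw1 hw2 he.le hm0 hm1 hk0 hkm hka (by linarith) (by linarith) fG.lam fS.lam
    (fun y hy => by
      have := hV1 y hy
      have : β ^ 2 / 2 * y ^ 2 = 2 * (a * y ^ 2) := by rw [ha]; ring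
      linarith)
    (fun y hy => by
      by_cases hyR : |y| ≤ R
      · have h2 := hlow y hy hyR
        have h3 : c ^ 2 ≤ S y ^ 2 := by gcongr
        have h4 : 0 ≤ m * (a * y ^ 2) := by positivity
        linarith
      · push Not at hyR
        have h3 : R ^ 2 ≤ y ^ 2 := by rw [← sq_abs y]; gcongr
        have h4 : 2 * a * R ^ 2 ≤ 2 * a * y ^ 2 := by gcongr
        have h5 : m * (M + 2) ≤ m * (2 * a * y ^ 2) := by gcongr; linarith
        have h6 := sq_nonneg (S y)
        linarith)
    hC0.le hdV fG.f0 fG.f4 fS.f0 fS.f4 fS.f1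
  have hGc := hG.hc
  have hSc := hS.hc
  have h2 := sup_le_h1 hL (u := fun y => G y - S y) (u' := fun y => G' y - S' y)
    (fun y => (hG.hd y).sub (hS.hd y)) (by fun_prop) x hx
  have h3 : (G x - S x) ^ 2 ≤ (Real.sqrt (40 * ((9 * C0 ^ 2 + 1) / k) * M / k) * e) ^ 2 := by
    rw [mul_pow, Real.sq_sqrt (by positivity)]
    set I := ∫ y in (-L)..L, ((G' y - S' y) ^ 2 + (G y - S y) ^ 2)
    have h4 : I ≤ 4 * ((9 * C0 ^ 2 + 1) / k * e ^ 2 * (5 * M)) / k := by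
      rw [le_div_iff₀ hk0]; linarith
    calc _ ≤ 2 * I := h2
      _ ≤ 2 * (4 * ((9 * C0 ^ 2 + 1) / k * e ^ 2 * (5 * M)) / k) := by gcongr
      _ = _ := by ring
  exact abs_le_of_sq_le_sq h3 (by positivity)


lemma pos_ext {L : ℝ} {F F' : ℝ → ℝ} (hL : 0 < L) (hd : ∀ y, HasDerivAt F (F' y) y)
    (hc : Continuous F') (hpos : ∀ y ∈ Icc (-L) L, 0 < F y) :
    ∃ H H' : ℝ → ℝ, (∀ y, HasDerivAt H (H' y) y) ∧ Continuous H' ∧ (∀ y, 0 < H y) ∧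
      ∀ y ∈ Icc (-L) L, H y = F y ∧ H' y = F' y := by
  have hFc := cont_of_hd hd
  obtain ⟨z, hz, hzm⟩ := isCompact_Icc.exists_isMinOn (s := Icc (-L) L)
    ⟨0, by constructor <;> linarith⟩ hFc.continuousOn
  set c := F z with hcdef
  have hc0 : 0 < c := hpos z hz
  have hF1 : ContDiff ℝ 1 F := by
    rw [contDiff_one_iff_deriv]
    refine ⟨fun y => (hd y).differentiableAt, ?_⟩
    have : deriv F = F' := funext fun y => (hd y).deriv
    rw [this]; exact hc
  set H : ℝ → ℝ := fun y => Real.smoothTransition (4 * F y / c - 2) * F y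
    + (1 - Real.smoothTransition (4 * F y / c - 2)) * c with hH
  have hth : ContDiff ℝ 1 (fun y => Real.smoothTransition (4 * F y / c - 2)) := by
    apply Real.smoothTransition.contDiff.comp
    fun_prop
  have hH1 : ContDiff ℝ 1 H := by
    exact (hth.mul hF1).add ((contDiff_const.sub hth).mul contDiff_const)
  rw [contDiff_one_iff_deriv] at hH1
  refine ⟨H, deriv H, fun y => (hH1.1 y).hasDerivAt, hH1.2, ?_, ?_⟩
  · intro y
    have h0 := Real.smoothTransition.nonneg (4 * F y / c - 2)
    have h1 := Real.smoothTransition.le_one (4 * F y / c - 2)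
    rcases h0.eq_or_lt with h | h
    · simp only [hH]; rw [← h]; linarith
    · have h2 : 0 < F y := by
        by_contra hn
        have : 4 * F y / c ≤ 0 := div_nonpos_of_nonpos_of_nonneg (by linarith) hc0.le
        rw [Real.smoothTransition.zero_of_nonpos (by linarith)] at h
        exact lt_irrefl _ h
      have h3 : 0 ≤ (1 - Real.smoothTransition (4 * F y / c - 2)) * c :=
        mul_nonneg (by linarith) hc0.le
      have := mul_pos h h2
      simp only [hH]; linarith
  · intro y hy
    have hcy : c ≤ F y := hzm hy
    have key : ∀ t, 3 / 4 * c < F t → H t = F t := by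
      intro t ht
      have : 3 ≤ 4 * F t / c := by rw [le_div_iff₀ hc0]; linarith
      simp only [hH]
      rw [Real.smoothTransition.one_of_one_le (by linarith)]
      ring
    refine ⟨key y (by linarith), ?_⟩
    have : H =ᶠ[𝓝 y] F := by
      filter_upwards [hFc.continuousAt.eventually (lt_mem_nhds (show 3/4 * c < F y by linarith))]
        with t ht using key t ht
    rw [this.deriv_eq, (hd y).deriv]

lemma scmin_ext {L N : ℝ} {w V W F F' : ℝ → ℝ} (hL : 0 < L) (hd : ∀ y, HasDerivAt F (F' y) y)
    (hc : Continuous F') (hpos : ∀ y ∈ Icc (-L) L, 0 < F y)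
    (mass : ∫ y in (-L)..L, w y * F y ^ 2 = N)
    (min : ∀ f f' : ℝ → ℝ, (∀ y, HasDerivAt f (f' y) y) → Continuous f' →
      ∫ y in (-L)..L, w y * f y ^ 2 = N → ScE L w V F F' ≤ ScE L w V f f')
    (hVW : ∀ y ∈ Icc (-L) L, V y = W y) :
    ∃ H H' : ℝ → ℝ, ScMin L w W N H H' ∧ ∀ y ∈ Icc (-L) L, H y = F y := by
  obtain ⟨H, H', h1, h2, h3, h4⟩ := pos_ext hL hd hc hpos
  refine ⟨H, H', ⟨h1, h2, h3, ?_, ?_⟩, fun y hy => (h4 y hy).1⟩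
  · rw [← mass]
    apply intervalIntegral.integral_congr
    intro y hy
    rw [uIcc_of_le (by linarith)] at hy
    simp only [(h4 y hy).1]
  · intro f f' hf hf' hm
    have e1 : ScE L w W H H' = ScE L w V F F' := by
      apply intervalIntegral.integral_congr
      intro y hy
      rw [uIcc_of_le (by linarith)] at hy
      simp only [(h4 y hy).1, (h4 y hy).2, hVW y hy]
    have e2 : ScE L w W f f' = ScE L w V f f' := by
      apply intervalIntegral.integral_congr
      intro y hy
      rw [uIcc_of_le (by linarith)] at hy
      simp only [hVW y hy]
    rw [e1, e2]
    exact min f f' hf hf' hm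

lemma ann_int {ε L : ℝ} (hε : 0 < ε) (hL : 0 < L) (k : ℝ → ℝ) :
    ∫ x in Icc (1 - ε ^ 2 * L) (1 + ε ^ 2 * L), k x =
      ε ^ 2 * ∫ y in (-L)..L, k (1 + ε ^ 2 * y) := by
  have : 0 ≤ ε ^ 2 * L := by positivity
  rw [integral_Icc_eq_integral_Ioc, ← intervalIntegral.integral_of_le (by linarith),
    intervalIntegral.mul_integral_comp_add_mul]
  congr 1; ring

lemma scale_min {ε L : ℝ} {p Q W g : ℝ → ℝ} (hε : 0 < ε) (hL : 0 < L)
    (hW : ∀ y ∈ Icc (-L) L, ε ^ 4 * Q (1 + ε ^ 2 * y) = W y)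
    (hg : ContDiff ℝ 1 g)
    (mass : 2 * π * (∫ x in Icc (1 - ε ^ 2 * L) (1 + ε ^ 2 * L), p x * g x ^ 2) = 1)
    (pos : ∀ x ∈ Icc (1 - ε ^ 2 * L) (1 + ε ^ 2 * L), 0 < g x)
    (min : ∀ f : ℝ → ℝ, ContDiff ℝ 1 f →
      2 * π * (∫ x in Icc (1 - ε ^ 2 * L) (1 + ε ^ 2 * L), p x * f x ^ 2) = 1 →
      2 * π * (∫ x in Icc (1 - ε ^ 2 * L) (1 + ε ^ 2 * L),
        p x * ((1 / 2) * (deriv g x) ^ 2 + Q x * g x ^ 2 + (1 / ε ^ 2) * g x ^ 4)) ≤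
      2 * π * (∫ x in Icc (1 - ε ^ 2 * L) (1 + ε ^ 2 * L),
        p x * ((1 / 2) * (deriv f x) ^ 2 + Q x * f x ^ 2 + (1 / ε ^ 2) * f x ^ 4))) :
    ∃ H H' : ℝ → ℝ, ScMin L (fun y => p (1 + ε ^ 2 * y)) W (1 / (2 * π)) H H' ∧
      ∀ y ∈ Icc (-L) L, H y = ε * g (1 + ε ^ 2 * y) := by
  have hpi := Real.pi_pos
  have hmass : ∀ f F : ℝ → ℝ, (∀ y, F y = ε * f (1 + ε ^ 2 * y)) →
      ∫ x in Icc (1 - ε ^ 2 * L) (1 + ε ^ 2 * L), p x * f x ^ 2 =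
      ∫ y in (-L)..L, p (1 + ε ^ 2 * y) * F y ^ 2 := by
    intro f F h
    rw [ann_int hε hL, ← ii_mul]
    congr 1; ext y; rw [h]; ring
  have hen : ∀ f F F' : ℝ → ℝ, (∀ y, F y = ε * f (1 + ε ^ 2 * y)) →
      (∀ y, F' y = ε ^ 3 * deriv f (1 + ε ^ 2 * y)) →
      ∫ x in Icc (1 - ε ^ 2 * L) (1 + ε ^ 2 * L),
        p x * ((1 / 2) * (deriv f x) ^ 2 + Q x * f x ^ 2 + (1 / ε ^ 2) * f x ^ 4) =
      1 / ε ^ 4 * ScE L (fun y => p (1 + ε ^ 2 * y)) (fun y => ε ^ 4 * Q (1 + ε ^ 2 * y)) F F' := by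
    intro f F F' h h'
    rw [ann_int hε hL, ScE, ← ii_mul, ← ii_mul]
    congr 1; ext y; rw [h, h']; field_simp
  have hlin : ∀ y, HasDerivAt (fun y => 1 + ε ^ 2 * y) (ε ^ 2) y := fun y => by
    refine HasDerivAt.congr_deriv (f := _) (((hasDerivAt_id y).const_mul (ε ^ 2)).const_add 1) ?_
    simp
  have hg' := contDiff_one_iff_deriv.1 hg
  have hg'c := hg'.2
  apply scmin_ext (V := fun y => ε ^ 4 * Q (1 + ε ^ 2 * y))
    (F' := fun y => ε ^ 3 * deriv g (1 + ε ^ 2 * y)) hL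
  · intro y
    have := ((hg'.1 (1 + ε ^ 2 * y)).hasDerivAt.comp y (hlin y)).const_mul ε
    refine HasDerivAt.congr_deriv (f := _) this ?_
    ring
  · fun_prop
  · intro y hy
    apply mul_pos hε
    apply pos
    have h1 : ε ^ 2 * y ≤ ε ^ 2 * L := by gcongr; exact hy.2
    have h2 : ε ^ 2 * (-L) ≤ ε ^ 2 * y := by gcongr; exact hy.1
    constructor <;> linarith
  · rw [← hmass g _ (fun y => rfl)]
    field_simp
    linarith
  · intro f f' hf hf' hm
    have hlin2 : ∀ x, HasDerivAt (fun x => (x - 1) / ε ^ 2) (1 / ε ^ 2) x := fun x =>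
      ((hasDerivAt_id x).sub_const 1).div_const (ε ^ 2)
    have hd : ∀ x, HasDerivAt (fun x => f ((x - 1) / ε ^ 2) / ε) (f' ((x - 1) / ε ^ 2) / ε ^ 3) x := by
      intro x
      refine HasDerivAt.congr_deriv (f := _)
        (((hf ((x - 1) / ε ^ 2)).comp x (hlin2 x)).div_const ε) ?_
      field_simp
    have hder : deriv (fun x => f ((x - 1) / ε ^ 2) / ε) = fun x => f' ((x - 1) / ε ^ 2) / ε ^ 3 :=
      funext fun x => (hd x).deriv
    have hback : ∀ y, (1 + ε ^ 2 * y - 1) / ε ^ 2 = y := fun y => by field_simp; ring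
    have hF : ∀ y, f y = ε * (fun x => f ((x - 1) / ε ^ 2) / ε) (1 + ε ^ 2 * y) := fun y => by
      simp only [hback]; field_simp
    have hF' : ∀ y, f' y = ε ^ 3 * deriv (fun x => f ((x - 1) / ε ^ 2) / ε) (1 + ε ^ 2 * y) :=
      fun y => by simp only [hder, hback]; field_simp
    have := min (fun x => f ((x - 1) / ε ^ 2) / ε)
      (contDiff_one_iff_deriv.2 ⟨fun x => (hd x).differentiableAt, by rw [hder]; fun_prop⟩)
      (by rw [hmass _ f hF, hm]; field_simp)
    rw [hen _ f f' hF hF', hen g _ _ (fun y => rfl) (fun y => rfl)] at this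
    have h5 : 0 < 2 * π * (1 / ε ^ 4) := by positivity
    rw [← mul_assoc, ← mul_assoc] at this
    exact le_of_mul_le_mul_left this h5
  · exact hW

lemma int_step {δ C : ℝ} {f f' : ℝ → ℝ} (n : ℕ) (hC : 0 ≤ C) (h0 : f 0 = 0)
    (hd : ∀ t, |t| ≤ δ → HasDerivAt f (f' t) t) (hb : ∀ t, |t| ≤ δ → |f' t| ≤ C * |t| ^ n) :
    ∀ t, |t| ≤ δ → |f t| ≤ C * |t| ^ (n + 1) := by
  intro t ht
  have hsub : ∀ u ∈ Icc (-|t|) |t|, |u| ≤ |t| := fun u hu => abs_le.2 hu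
  have := (convex_Icc (-|t|) |t|).norm_image_sub_le_of_norm_hasDerivWithin_le
    (f := f) (f' := f') (C := C * |t| ^ n) (x := 0) (y := t)
    (fun u hu => (hd u ((hsub u hu).trans ht)).hasDerivWithinAt)
    (fun u hu => by
      have h1 := hsub u hu
      have h2 := hb u (h1.trans ht)
      rw [Real.norm_eq_abs]
      refine h2.trans ?_
      gcongr)
    (by constructor <;> linarith [abs_nonneg t]) (abs_le.1 le_rfl)
  rw [h0, sub_zero, sub_zero, Real.norm_eq_abs, Real.norm_eq_abs] at this
  rw [pow_succ, ← mul_assoc]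
  exact this

lemma rpow_taylor (s : ℝ) (hs : 2 < s) : ∃ C : ℝ, 0 ≤ C ∧ ∀ t : ℝ, |t| ≤ 1/2 →
    |((1 + t) ^ s - 1) / s - ((1 + t) ^ 2 - 1) / 2 - (s - 2) / 2 * t ^ 2| ≤ C * |t| ^ 3 := by
  have hpos : ∀ t : ℝ, |t| ≤ 1/2 → 1 + t ≠ 0 := fun t ht => by
    have := (abs_le.1 ht).1; intro h; linarith
  have hcont : ContinuousOn (fun t : ℝ => (s - 1) * (s - 2) * (1 + t) ^ (s - 3)) (Icc (-(1/2)) (1/2)) := by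
    apply ContinuousOn.mul continuousOn_const
    apply ContinuousOn.rpow_const (by fun_prop)
    intro t ht
    exact Or.inl (hpos t (abs_le.2 ht))
  obtain ⟨C, hC⟩ := isCompact_Icc.exists_bound_of_continuousOn hcont
  have hrp : ∀ (p t : ℝ), |t| ≤ 1/2 → HasDerivAt (fun t : ℝ => (1 + t) ^ p) (p * (1 + t) ^ (p - 1)) t := by
    intro p t ht
    refine HasDerivAt.congr_deriv (f := _)
      (((hasDerivAt_id t).const_add 1).rpow_const (p := p) (Or.inl (hpos t ht))) ?_
    simp
  have hC0 : 0 ≤ C := (norm_nonneg _).trans (hC 0 (by norm_num))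
  refine ⟨C, hC0, ?_⟩
  have s3 := int_step (δ := 1/2) (C := C)
    (f := fun t : ℝ => (s - 1) * (1 + t) ^ (s - 2) - 1 - (s - 2))
    (f' := fun t : ℝ => (s - 1) * (s - 2) * (1 + t) ^ (s - 3)) 0 hC0
    (by simp; ring)
    (fun t ht => by
      refine HasDerivAt.congr_deriv (f := _)
        ((((hrp (s - 2) t ht).const_mul (s - 1)).sub_const 1).sub_const (s - 2)) ?_
      rw [show s - 2 - 1 = s - 3 by ring]; ring)
    (fun t ht => by simpa using hC t (abs_le.1 ht))
  have s2 := int_step (δ := 1/2) (C := C)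
    (f := fun t : ℝ => (1 + t) ^ (s - 1) - (1 + t) - (s - 2) * t)
    (f' := fun t : ℝ => (s - 1) * (1 + t) ^ (s - 2) - 1 - (s - 2)) 1 hC0
    (by simp)
    (fun t ht => by
      refine HasDerivAt.congr_deriv (f := _)
        (((hrp (s - 1) t ht).sub ((hasDerivAt_id t).const_add 1)).sub
          ((hasDerivAt_id t).const_mul (s - 2))) ?_
      rw [show s - 1 - 1 = s - 2 by ring]; ring)
    (by simpa using s3)
  exact int_step (δ := 1/2) (C := C)
    (f := fun t : ℝ => ((1 + t) ^ s - 1) / s - ((1 + t) ^ 2 - 1) / 2 - (s - 2) / 2 * t ^ 2)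
    (f' := fun t : ℝ => (1 + t) ^ (s - 1) - (1 + t) - (s - 2) * t) 2 hC0
    (by simp)
    (fun t ht => by
      refine HasDerivAt.congr_deriv (f := _)
        (((((hrp s t ht).sub_const 1).div_const s).sub
          (((((hasDerivAt_id t).const_add 1).pow 2).sub_const 1).div_const 2)).sub
          (((hasDerivAt_id t).pow 2).const_mul ((s - 2) / 2))) ?_
      have : s ≠ 0 := by linarith
      simp
      field_simp
      )
    (by simpa using s2)

lemma cent_bd {t d : ℝ} (ht : |t| ≤ 1/2) (hd : 0 ≤ d) :
    |(1 / 2) * (1 - d) ^ 2 / (1 + t) ^ 2 + (1 / 2) * (1 + t) ^ 2 - (1 - d) - 2 * t ^ 2| ≤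
      2 * (d + t ^ 2) * (6 * |t| + d) := by
  have h1 := abs_le.1 ht
  have hx : 1/2 ≤ 1 + t := by linarith
  have hx0 : 0 < 1 + t := by linarith
  have e1 : (1 / 2) * (1 - d) ^ 2 / (1 + t) ^ 2 + (1 / 2) * (1 + t) ^ 2 - (1 - d) - 2 * t ^ 2 =
      (d - t ^ 2) * (4 * t + 3 * t ^ 2 + d) / (2 * (1 + t) ^ 2) := by
    field_simp; ring
  rw [e1, abs_div, abs_mul, abs_of_pos (show 0 < 2 * (1 + t) ^ 2 by positivity),
    div_le_iff₀ (by positivity)]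
  have h2 : |d - t ^ 2| ≤ d + t ^ 2 := by
    rw [abs_le]; constructor <;> linarith [sq_nonneg t]
  have h3 : |4 * t + 3 * t ^ 2 + d| ≤ 6 * |t| + d := by
    have : t ^ 2 ≤ 1/2 * |t| := by rw [← sq_abs t, sq]; gcongr
    have h4 := neg_abs_le t
    have h5 := le_abs_self t
    rw [abs_le]; constructor <;> linarith [sq_nonneg t]
  have h6 : 1/4 ≤ (1 + t) ^ 2 := by
    calc (1/4 : ℝ) = (1/2) ^ 2 := by norm_num
      _ ≤ _ := by gcongr
  have h7 : |d - t ^ 2| * |4 * t + 3 * t ^ 2 + d| ≤ (d + t ^ 2) * (6 * |t| + d) := by gcongr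
  have h8 : 0 ≤ (d + t ^ 2) * (6 * |t| + d) := by positivity
  have h9 := mul_le_mul_of_nonneg_left h6 h8
  linarith

lemma alphaP_sq {s γ : ℝ} (hs : 2 < s) (hγ : 0 < γ) : alphaP s γ ^ 2 = 4 + γ * (s - 2) := by
  have : 0 < γ * (s - 2) := mul_pos hγ (by linarith)
  exact Real.sq_sqrt (by linarith)

set_option maxHeartbeats 1000000 in
lemma pot_bd (s γ Ω₀ : ℝ) (hs : 2 < s) (hγ : 0 < γ) (hΩ : 0 < Ω₀) :
    ∃ C0 : ℝ, 0 < C0 ∧ ∀ ε y : ℝ, 0 < ε → ε ^ 2 * (1 + |y|) ≤ 1/2 →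
      |ε ^ 4 * ((Ω₀ / ε ^ 4) ^ 2 * Upot s γ (Ω₀ / ε ^ 4) (1 + ε ^ 2 * y))
        - (alphaP s γ * Ω₀) ^ 2 / 2 * y ^ 2| ≤ C0 * ε ^ 2 * (1 + |y| ^ 3) := by
  obtain ⟨C, hC0, hC⟩ := rpow_taylor s hs
  set q := 1 / Ω₀ with hq
  have hq0 : 0 < q := by positivity
  refine ⟨Ω₀ ^ 2 * (2 * (7 * q + q ^ 2 + 6) + γ * C), by positivity, ?_⟩
  intro ε y hε hy
  set e := ε ^ 2 with he
  have he0 : 0 < e := by positivity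
  have hay := abs_nonneg y
  have he1 : e ≤ 1 := by
    have : 0 ≤ e * |y| := by positivity
    linarith
  have ht : |e * y| ≤ 1/2 := by rw [abs_mul, abs_of_pos he0]; linarith
  set t := e * y with htdef
  have hε4 : ε ^ 4 = e ^ 2 := by rw [he]; ring
  set W := Ω₀ / ε ^ 4 with hW
  have hW0 : 0 < W := by positivity
  obtain ⟨d, hd0, hd1, hd⟩ : ∃ d : ℝ, 0 ≤ d ∧ d ≤ e ^ 2 * q ∧ (⌊W⌋ : ℝ) / W = 1 - d := by
    refine ⟨1 - (⌊W⌋ : ℝ) / W, ?_, ?_, by ring⟩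
    · have : (⌊W⌋ : ℝ) / W ≤ 1 := by
        rw [div_le_one hW0]; exact Int.floor_le W
      linarith
    · have h1 : W - 1 < (⌊W⌋ : ℝ) := Int.sub_one_lt_floor W
      have h2 : e ^ 2 * q = 1 / W := by rw [hW, hε4, hq]; field_simp
      rw [h2, sub_le_iff_le_add, ← add_div, le_div_iff₀ hW0]; linarith
  have hU : Upot s γ W (1 + t) = ((1 / 2) * (1 - d) ^ 2 / (1 + t) ^ 2 + (1 / 2) * (1 + t) ^ 2
      - (1 - d)) + γ * (((1 + t) ^ s - 1) / s - ((1 + t) ^ 2 - 1) / 2) := by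
    unfold Upot
    rw [← div_pow, hd]; ring
  have hA := cent_bd ht hd0
  have hB := hC t ht
  have hα := alphaP_sq hs hγ
  have hmain : ε ^ 4 * (W ^ 2 * Upot s γ W (1 + t)) - (alphaP s γ * Ω₀) ^ 2 / 2 * y ^ 2 =
      Ω₀ ^ 2 / e ^ 2 * (((1 / 2) * (1 - d) ^ 2 / (1 + t) ^ 2 + (1 / 2) * (1 + t) ^ 2
      - (1 - d) - 2 * t ^ 2) + γ * (((1 + t) ^ s - 1) / s - ((1 + t) ^ 2 - 1) / 2
        - (s - 2) / 2 * t ^ 2)) := by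
    have h1 : ε ^ 4 * (W ^ 2 * Upot s γ W (1 + t)) = Ω₀ ^ 2 / e ^ 2 * Upot s γ W (1 + t) := by
      rw [hW, hε4]; field_simp
    have h2 : (alphaP s γ * Ω₀) ^ 2 / 2 * y ^ 2 =
        Ω₀ ^ 2 / e ^ 2 * (2 * t ^ 2 + γ * ((s - 2) / 2 * t ^ 2)) := by
      rw [mul_pow, hα, htdef]; field_simp; ring
    rw [h1, h2, hU]; ring
  rw [hmain]
  generalize (1 / 2) * (1 - d) ^ 2 / (1 + t) ^ 2 + (1 / 2) * (1 + t) ^ 2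
      - (1 - d) - 2 * t ^ 2 = A at hA
  generalize ((1 + t) ^ s - 1) / s - ((1 + t) ^ 2 - 1) / 2 - (s - 2) / 2 * t ^ 2 = B at hB
  have hat : |t| = e * |y| := by rw [htdef, abs_mul, abs_of_pos he0]
  set Y := |y| with hY
  have ht2 : t ^ 2 = e ^ 2 * Y ^ 2 := by rw [← sq_abs t, hat]; ring
  rw [hat] at hA hB
  rw [ht2] at hA
  have hd2 : d ≤ e * q := hd1.trans (by
    have : e ^ 2 ≤ e := by rw [sq]; exact mul_le_of_le_one_left he0.le he1
    gcongr)
  have hA2 : |A| ≤ e ^ 3 * (2 * (7 * q + q ^ 2 + 6) * (1 + Y ^ 3)) := by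
    have y1 : Y ≤ 1 + Y ^ 3 := by nlinarith [sq_nonneg (Y - 1), mul_nonneg hay (sq_nonneg (Y - 1))]
    have y2 : Y ^ 2 ≤ 1 + Y ^ 3 := by nlinarith [sq_nonneg (Y - 1), mul_nonneg hay (sq_nonneg (Y - 1))]
    have y0 : 0 ≤ Y ^ 3 := by positivity
    have y3 : 1 ≤ 1 + Y ^ 3 := le_add_of_nonneg_right y0
    have y4 : Y ^ 3 ≤ 1 + Y ^ 3 := le_add_of_nonneg_left zero_le_one
    calc |A| ≤ _ := hA
      _ ≤ 2 * (e ^ 2 * q + e ^ 2 * Y ^ 2) * (6 * (e * Y) + e * q) := by gcongr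
      _ = e ^ 3 * (2 * (6 * q * Y + q ^ 2 * 1 + 6 * Y ^ 3 + q * Y ^ 2)) := by ring
      _ ≤ e ^ 3 * (2 * (6 * q * (1 + Y ^ 3) + q ^ 2 * (1 + Y ^ 3) + 6 * (1 + Y ^ 3) + q * (1 + Y ^ 3))) := by
        gcongr
      _ = _ := by ring
  have hB2 : |B| ≤ e ^ 3 * (C * (1 + Y ^ 3)) := by
    calc |B| ≤ _ := hB
      _ = e ^ 3 * (C * Y ^ 3) := by ring
      _ ≤ _ := by gcongr; linarith
  calc |Ω₀ ^ 2 / e ^ 2 * (A + γ * B)| ≤ Ω₀ ^ 2 / e ^ 2 * (|A| + γ * |B|) := by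
        rw [abs_mul, abs_of_pos (show 0 < Ω₀ ^ 2 / e ^ 2 by positivity)]
        gcongr
        refine (abs_add_le _ _).trans ?_
        rw [abs_mul, abs_of_pos hγ]
    _ ≤ Ω₀ ^ 2 / e ^ 2 * (e ^ 3 * (2 * (7 * q + q ^ 2 + 6) * (1 + Y ^ 3))
        + γ * (e ^ 3 * (C * (1 + Y ^ 3)))) := by gcongr
    _ = _ := by field_simp

lemma eta_facts {b : ℝ} (η : ℝ → ℝ)
    (hη1 : Tendsto (fun ε => η ε / |Real.log ε|) (𝓝[>] (0 : ℝ)) atTop)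
    (hη2 : Tendsto (fun ε => η ε / |Real.log ε| ^ b) (𝓝[>] (0 : ℝ)) (𝓝 0)) (δ : ℝ) (hδ : 0 < δ) :
    ∀ᶠ ε in 𝓝[>] (0 : ℝ), 0 < ε ∧ 1 ≤ η ε ∧ ε ^ 2 * (1 + η ε) ≤ δ := by
  have hlog : Tendsto (fun ε : ℝ => |Real.log ε|) (𝓝[>] (0 : ℝ)) atTop :=
    tendsto_abs_atBot_atTop.comp Real.tendsto_log_nhdsGT_zero
  have h1 := (tendsto_rpow_mul_exp_neg_mul_atTop_nhds_zero b 2 (by norm_num)).comp hlog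
  have h2 : Tendsto (fun ε : ℝ => ε ^ 2) (𝓝[>] (0 : ℝ)) (𝓝 0) := by
    have : Tendsto (fun ε : ℝ => ε ^ 2) (𝓝 (0 : ℝ)) (𝓝 (0 ^ 2)) := (continuous_pow 2).tendsto 0
    rw [zero_pow (by norm_num)] at this
    exact this.mono_left nhdsWithin_le_nhds
  have hlt : ∀ᶠ ε in 𝓝[>] (0 : ℝ), ε < 1 :=
    (gt_mem_nhds (zero_lt_one)).filter_mono nhdsWithin_le_nhds
  filter_upwards [self_mem_nhdsWithin, hlt, hη1.eventually_ge_atTop 1, hlog.eventually_ge_atTop 1,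
    hη2.eventually (gt_mem_nhds zero_lt_one), h1.eventually (gt_mem_nhds (show 0 < δ / 2 by linarith)),
    h2.eventually (gt_mem_nhds (show 0 < δ / 2 by linarith))] with ε e0 e1 a1 a2 a3 a4 a5
  have e0 : 0 < ε := e0
  have hl0 : 0 < |Real.log ε| := by linarith
  rw [le_div_iff₀ hl0] at a1
  rw [div_lt_one (by positivity)] at a3
  refine ⟨e0, by linarith, ?_⟩
  have hex : Real.exp (-2 * |Real.log ε|) = ε ^ 2 := by
    rw [abs_of_neg (Real.log_neg e0 e1), show -2 * -Real.log ε = Real.log ε + Real.log ε by ring,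
      Real.exp_add, Real.exp_log e0]; ring
  simp only [Function.comp] at a4
  rw [hex] at a4
  have : ε ^ 2 * η ε ≤ ε ^ 2 * |Real.log ε| ^ b := by gcongr
  linarith

lemma V_cont {s γ Ω ε L c : ℝ} (hL : 0 ≤ L) (h : ε ^ 2 * (1 + L) ≤ 1/2) :
    Continuous (fun y : ℝ => c * Upot s γ Ω (1 + ε ^ 2 * max (-L) (min y L))) := by
  have hpos : ∀ y : ℝ, 1 + ε ^ 2 * max (-L) (min y L) ≠ 0 := by
    intro y
    have h1 : -L ≤ max (-L) (min y L) := le_max_left _ _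
    have h2 : ε ^ 2 * (-L) ≤ ε ^ 2 * max (-L) (min y L) := by gcongr
    have := sq_nonneg ε
    intro h3; linarith
  have hcx : Continuous (fun y : ℝ => 1 + ε ^ 2 * max (-L) (min y L)) := by fun_prop
  unfold Upot
  have h1 : Continuous (fun y : ℝ => (1 + ε ^ 2 * max (-L) (min y L)) ^ s) :=
    hcx.rpow_const (fun y => Or.inl (hpos y))
  have h2 : Continuous (fun y : ℝ => (1 / 2) * ((⌊Ω⌋ : ℝ) ^ 2 / Ω ^ 2) /
      (1 + ε ^ 2 * max (-L) (min y L)) ^ 2) :=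
    continuous_const.div (hcx.pow 2) (fun y => pow_ne_zero 2 (hpos y))
  fun_prop

/-- **Comparison of `g_{η,ε}` with the symmetric profile.**
For `Ω = Ω₀ε^{-4}` with `Ω₀` large enough:
`|g_{η,ε}(x) - g_sym(x)| ≤ C Ω^{-1/4}` uniformly on `A_η`. -/
theorem gv_annulus_profile_symmetry_estimate
    (s γ b : ℝ) (hs : 2 < s) (hγ0 : 0 < γ) (hγ1 : γ ≤ 1) (hb : 1 < b)
    (η : ℝ → ℝ)
    (hη1 : Tendsto (fun ε => η ε / |Real.log ε|) (𝓝[>] (0 : ℝ)) atTop)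
    (hη2 : Tendsto (fun ε => η ε / |Real.log ε| ^ b) (𝓝[>] (0 : ℝ)) (𝓝 0)) :
    ∃ Ωbar : ℝ, ∀ Ω₀ : ℝ, Ωbar < Ω₀ →
      ∃ C : ℝ, ∀ᶠ ε in 𝓝[>] (0 : ℝ), ∀ g gsym : ℝ → ℝ,
        IsGVAnnMin ε s γ (Ω₀ / ε ^ 4) (η ε) g →
        IsSymMin ε (alphaP s γ) (Ω₀ / ε ^ 4) (η ε) gsym →
        ∀ x ∈ annIcc ε (η ε), |g x - gsym x| ≤ C * (Ω₀ / ε ^ 4) ^ (-(1 : ℝ) / 4) := by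
  refine ⟨0, fun Ω₀ hΩ => ?_⟩
  have hα : 0 < alphaP s γ := Real.sqrt_pos.2 (by nlinarith [mul_pos hγ0 (sub_pos.2 hs)])
  obtain ⟨C0, hC0, hpot⟩ := pot_bd s γ Ω₀ hs hγ0 hΩ
  have hpi := Real.pi_pos
  obtain ⟨C, δ, hδ, hcore⟩ := core (alphaP s γ * Ω₀) (1 / (2 * π)) C0 (by positivity)
    (by positivity) hC0
  refine ⟨C * Ω₀ ^ ((1 : ℝ) / 4), ?_⟩
  filter_upwards [eta_facts η hη1 hη2 (min δ (1/2)) (by positivity)] with ε hε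
  obtain ⟨hε, hL, hsm⟩ := hε
  intro g gsym hg hs' x hx
  set L := η ε with hLdef
  have hL0 : 0 < L := by linarith
  have hsm1 : ε ^ 2 * (1 + L) ≤ δ := hsm.trans (min_le_left _ _)
  have hsm2 : ε ^ 2 * (1 + L) ≤ 1/2 := hsm.trans (min_le_right _ _)
  have hproj : ∀ y ∈ Icc (-L) L, max (-L) (min y L) = y := fun y hy => by
    rw [min_eq_left hy.2, max_eq_right hy.1]
  set W : ℝ → ℝ := fun y => (ε ^ 4 * (Ω₀ / ε ^ 4) ^ 2) *
    Upot s γ (Ω₀ / ε ^ 4) (1 + ε ^ 2 * max (-L) (min y L)) with hW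
  have hWc : Continuous W := V_cont hL0.le hsm2
  have hWe : ∀ y ∈ Icc (-L) L,
      ε ^ 4 * ((Ω₀ / ε ^ 4) ^ 2 * Upot s γ (Ω₀ / ε ^ 4) (1 + ε ^ 2 * y)) = W y := fun y hy => by
    simp only [hW, hproj y hy]; ring
  obtain ⟨⟨g1, g2⟩, g3, g4⟩ := hg
  obtain ⟨G, G', hG, hGe⟩ := scale_min (p := fun x => x)
    (Q := fun x => (Ω₀ / ε ^ 4) ^ 2 * Upot s γ (Ω₀ / ε ^ 4) x) hε hL0 hWe g1 g2 g3
    (fun f hf hm => g4 f ⟨hf, hm⟩)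
  obtain ⟨⟨s1, s2⟩, s3, s4⟩ := hs'
  obtain ⟨S, S', hS, hSe⟩ := scale_min (p := fun _ => 1)
    (Q := fun x => (1 / 2) * alphaP s γ ^ 2 * (Ω₀ / ε ^ 4) ^ 2 * (1 - x) ^ 2)
    (W := fun y => (alphaP s γ * Ω₀) ^ 2 / 2 * y ^ 2) hε hL0
    (fun y hy => by field_simp; ring) s1
    (by simpa only [one_mul, annIcc] using s2) s3
    (fun f hf hm => by
      have := s4 f ⟨hf, by simpa only [one_mul, annIcc] using hm⟩
      simpa only [one_mul, annIcc, symEnergy] using this)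
  have hε2 : 0 < ε ^ 2 := by positivity
  have hyd : 1 + ε ^ 2 * ((x - 1) / ε ^ 2) = x := by field_simp; ring
  have hy : (x - 1) / ε ^ 2 ∈ Icc (-L) L := by
    constructor
    · rw [le_div_iff₀ hε2]; linarith [hx.1]
    · rw [div_le_iff₀ hε2]; linarith [hx.2]
  have hfin := hcore L (ε ^ 2) W G G' S S' hε2 hL hsm1 hWc
    (fun y hy => by
      rw [← hWe y hy]
      apply hpot ε y hε
      have : |y| ≤ L := abs_le.2 hy
      refine le_trans ?_ hsm2
      gcongr)
    hG hS _ hy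
  rw [hGe _ hy, hSe _ hy, hyd, ← mul_sub, abs_mul, abs_of_pos hε] at hfin
  have h1 : |g x - gsym x| ≤ C * ε := by
    have : ε * |g x - gsym x| ≤ ε * (C * ε) := by linarith
    exact le_of_mul_le_mul_left this hε
  have h2 : (Ω₀ / ε ^ 4) ^ (-(1 : ℝ) / 4) = (Ω₀ ^ ((1 : ℝ) / 4))⁻¹ * ε := by
    have h3 : (ε ^ 4) ^ ((1 : ℝ) / 4) = ε := by
      rw [← Real.rpow_natCast, ← Real.rpow_mul hε.le]; norm_num
    rw [neg_div, Real.rpow_neg (by positivity), Real.div_rpow hΩ.le (by positivity), h3, inv_div,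
      div_eq_mul_inv, mul_comm]
  have h4 : 0 < Ω₀ ^ ((1 : ℝ) / 4) := by positivity
  rw [h2]
  calc _ ≤ C * ε := h1
    _ = _ := by field_simp
end
end
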